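/- arXiv:2304.03256 — 4 statements merged into one kernel-verified Lean document; each statement's English description precedes it below -/
import Mathlib

section
/- For every integer k ≥ 3 there exists a finite simple graph G together with a vertex v of G of degree 1 such that: (i) the edge set of G admits a partition into a k-bounded linear forest and a matching; and (ii) for every partition (F, M) of the edge set of G into a k-bounded linear forest F and a matching M, the unique edge of G incident to v belongs to M. -/
/-- `M` is a matching in `G`: a set of pairwise vertex-disjoint edges of `G`. -/
def IsMatchingIn {V : Type} (G : SimpleGraph V) (M : Set (Sym2 V)) : Prop :=
  M ⊆ G.edgeSet ∧ ∀ e ∈ M, ∀ f ∈ M, e ≠ f → ∀ v : V, v ∈ e → v ∉ f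

/-- `F` is a `k`-bounded linear forest in `G`: a set of edges of `G` spanning a graph with
no cycle, maximum degree at most `2`, and no path with `k+1` edges. -/
def IsBddLinearForestIn {V : Type} (G : SimpleGraph V) (k : ℕ) (F : Set (Sym2 V)) : Prop :=
  F ⊆ G.edgeSet ∧
  (SimpleGraph.fromEdgeSet F).IsAcyclic ∧
  (∀ v : V, {e ∈ F | v ∈ e}.ncard ≤ 2) ∧
  (∀ (u w : V) (p : (SimpleGraph.fromEdgeSet F).Walk u w), p.IsPath → p.length ≤ k)

/-- `(F, M)` is a partition of the edge set of `G` into a `k`-bounded linear forest `F`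
and a matching `M`. -/
def IsMLFDecomp {V : Type} (G : SimpleGraph V) (k : ℕ) (F M : Set (Sym2 V)) : Prop :=
  F ∪ M = G.edgeSet ∧ Disjoint F M ∧ IsBddLinearForestIn G k F ∧ IsMatchingIn G M

/-- There is a finite graph with a vertex of degree `1` whose incident edge lies in the matching
of every decomposition into a `k`-bounded linear forest and a matching. -/
def HasForcer (k : ℕ) : Prop :=
  ∃ (V : Type) (_ : Fintype V) (G : SimpleGraph V) (v : V) (e : Sym2 V),
    e ∈ G.edgeSet ∧ v ∈ e ∧ (∀ f ∈ G.edgeSet, v ∈ f → f = e) ∧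
    (∃ F M : Set (Sym2 V), IsMLFDecomp G k F M) ∧
    (∀ F M : Set (Sym2 V), IsMLFDecomp G k F M → e ∈ M)

/-- A graph on `Fin n` in which only consecutive vertices are adjacent has no cycle. -/
theorem isAcyclic_of_consecutive {n : ℕ} {H : SimpleGraph (Fin n)}
    (hH : ∀ x y, H.Adj x y → x.val + 1 = y.val ∨ y.val + 1 = x.val) : H.IsAcyclic := by
  classical
  intro u p hp
  obtain ⟨m, hm, hmax⟩ := p.support.toFinset.exists_max_image id ⟨u, by simp⟩
  rw [List.mem_toFinset] at hm
  have hc := hp.rotate hm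
  have hle : ∀ x ∈ (p.rotate m hm).support, x.val ≤ m.val := by
    intro x hx
    exact hmax x (by simpa using (p.mem_support_rotate_iff m hm).1 hx)
  have h₁ := hH _ _ ((p.rotate m hm).adj_snd hc.not_nil)
  have h₂ := hH _ _ ((p.rotate m hm).adj_penultimate hc.not_nil)
  have h₃ := hle _ ((p.rotate m hm).getVert_mem_support 1)
  have h₄ := hle _ ((p.rotate m hm).getVert_mem_support ((p.rotate m hm).length - 1))
  refine hc.snd_ne_penultimate (Fin.ext ?_)
  simp only [SimpleGraph.Walk.snd, SimpleGraph.Walk.penultimate] at *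
  omega

/-- If `c` is constant on components with fibres of size at most `k + 1`, then every path has
length at most `k`. -/
theorem length_le_of_fibre_card_le {V : Type} [Fintype V] {H : SimpleGraph V} {k : ℕ}
    (c : V → ℕ) (hc : ∀ x y, H.Adj x y → c x = c y)
    (hcard : ∀ i, (Finset.univ.filter fun x => c x = c i).card ≤ k + 1)
    {u w : V} (p : H.Walk u w) (hp : p.IsPath) : p.length ≤ k := by
  classical
  have hconst : ∀ {u w : V} (p : H.Walk u w), ∀ x ∈ p.support, c x = c u := by
    intro u w p
    induction p with
    | nil => simp
    | cons h p ih =>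
      intro x hx
      rcases List.mem_cons.1 hx with rfl | hx
      · rfl
      · rw [ih x hx, hc _ _ h]
  have hsub : p.support.toFinset ⊆ Finset.univ.filter fun x => c x = c u := by
    intro x hx
    simpa using hconst p x (by simpa using hx)
  have h := (Finset.card_le_card hsub).trans (hcard u)
  rw [List.toFinset_card_of_nodup hp.support_nodup, SimpleGraph.Walk.length_support] at h
  omega

section Decomposition

variable {V : Type} {G : SimpleGraph V} {k : ℕ} {F M : Set (Sym2 V)}

theorem IsMLFDecomp.mem_or_mem (h : IsMLFDecomp G k F M) {v a b : V} (ha : G.Adj v a)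
    (hb : G.Adj v b) (hab : a ≠ b) : s(v, a) ∈ F ∨ s(v, b) ∈ F := by
  obtain ⟨hun, -, -, -, hM⟩ := h
  by_contra! hF
  have ha' : s(v, a) ∈ M := ((Set.ext_iff.1 hun _).2 ha).resolve_left hF.1
  have hb' : s(v, b) ∈ M := ((Set.ext_iff.1 hun _).2 hb).resolve_left hF.2
  exact hM _ ha' _ hb' (mt Sym2.congr_right.1 hab) v (by simp) (by simp)

theorem IsMLFDecomp.not_three [Finite V] (h : IsMLFDecomp G k F M) {v a b c : V} (hab : a ≠ b)
    (hac : a ≠ c) (hbc : b ≠ c) : ¬(s(v, a) ∈ F ∧ s(v, b) ∈ F ∧ s(v, c) ∈ F) := by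
  rintro ⟨ha, hb, hc⟩
  have hdeg := h.2.2.1.2.2.1 v
  have hsub : ({s(v, a), s(v, b), s(v, c)} : Set (Sym2 V)) ⊆ {e ∈ F | v ∈ e} := by
    rintro e (rfl | rfl | rfl) <;> simp [ha, hb, hc]
  have hcard : ({s(v, a), s(v, b), s(v, c)} : Set (Sym2 V)).ncard = 3 :=
    Set.ncard_eq_three.2 ⟨_, _, _, mt Sym2.congr_right.1 hab, mt Sym2.congr_right.1 hac,
      mt Sym2.congr_right.1 hbc, rfl⟩
  have := Set.ncard_le_ncard hsub (Set.toFinite _)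
  omega

theorem isChain_fromEdgeSet_adj {F : Set (Sym2 V)} {l : List V} (hl : l.Nodup)
    (hc : l.IsChain fun x y => s(x, y) ∈ F) : l.IsChain (SimpleGraph.fromEdgeSet F).Adj := by
  have hne : l.IsChain (· ≠ ·) := List.Pairwise.isChain hl
  rw [List.isChain_iff_getElem] at *
  exact fun i hi => (SimpleGraph.fromEdgeSet_adj F).2 ⟨hc i hi, hne i hi⟩

theorem IsMLFDecomp.not_isChain (h : IsMLFDecomp G k F M) {l : List V} (hl : l.Nodup)
    (hk : l.length = k + 2) : ¬l.IsChain fun x y => s(x, y) ∈ F := by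
  intro hc
  have hne : l ≠ [] := List.ne_nil_of_length_pos (by omega)
  have hlen := h.2.2.1.2.2.2 _ _ (.ofSupport l hne (isChain_fromEdgeSet_adj hl hc))
    (.mk' (by rwa [SimpleGraph.Walk.support_ofSupport]))
  rw [SimpleGraph.Walk.length_ofSupport] at hlen
  omega

theorem IsMLFDecomp.not_cycle (h : IsMLFDecomp G k F M) {a : V} {l : List V}
    (hl : (a :: l).Nodup) (hlen : 2 ≤ l.length) :
    ¬((a :: l).IsChain (fun x y => s(x, y) ∈ F) ∧
      s(a, (a :: l).getLast (l.cons_ne_nil a)) ∈ F) := by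
  rintro ⟨hc, hlast⟩
  let p := SimpleGraph.Walk.ofSupport _ (l.cons_ne_nil a) (isChain_fromEdgeSet_adj hl hc)
  have hp : p.IsPath := .mk' (by rwa [SimpleGraph.Walk.support_ofSupport])
  have hplen : p.length = l.length :=
    SimpleGraph.Walk.length_ofSupport _ _
  have hadj : (SimpleGraph.fromEdgeSet F).Adj a ((a :: l).getLast (l.cons_ne_nil a)) := by
    refine (SimpleGraph.fromEdgeSet_adj F).2 ⟨hlast, fun hal => ?_⟩
    have hl' : l ≠ [] := List.ne_nil_of_length_pos (by omega)
    rw [List.getLast_cons hl'] at hal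
    exact (List.nodup_cons.1 hl).1 (hal ▸ List.getLast_mem hl')
  have hsub := h.2.2.1.2.1.subsingleton_path a ((a :: l).getLast (l.cons_ne_nil a))
  have : p.length = 1 := congrArg (fun q => q.1.length)
    (hsub.elim ⟨p, hp⟩ (SimpleGraph.Path.singleton hadj))
  omega

end Decomposition

/-- A criterion for the existence of a forcer: the edges of a graph on `Fin n` are split into a
linear forest `F` (with paths made of consecutive vertices, `c` naming the components) and a
matching `M`, and the clauses satisfied by the linear forest `R` of an arbitrary decomposition
rule out the edge `vw`. -/
theorem hasForcer_of_clauses {n k : ℕ} {F M : Finset (Sym2 (Fin n))} (c : Fin n → ℕ)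
    {v w : Fin n}
    (hdiag : ∀ e ∈ F ∪ M, ¬e.IsDiag) (hdisj : Disjoint F M)
    (hv : ∀ x, s(v, x) ∈ F ∪ M ↔ x = w)
    (hM : ∀ x y z, s(x, y) ∈ M → s(x, z) ∈ M → y = z)
    (hF : ∀ x y, s(x, y) ∈ F → (x.val + 1 = y.val ∨ y.val + 1 = x.val) ∧ c x = c y)
    (hcard : ∀ i, (Finset.univ.filter fun x => c x = c i).card ≤ k + 1)
    (hforce : ∀ R : Fin n → Fin n → Prop, (∀ x y, R x y → R y x) →
      (∀ x y z, s(x, y) ∈ F ∪ M → s(x, z) ∈ F ∪ M → y ≠ z → R x y ∨ R x z) →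
      (∀ x a b d, a ≠ b → a ≠ d → b ≠ d → ¬(R x a ∧ R x b ∧ R x d)) →
      (∀ (a : Fin n) (l : List (Fin n)), (a :: l).Nodup → 2 ≤ l.length →
        ¬((a :: l).IsChain R ∧ R a ((a :: l).getLast (l.cons_ne_nil a)))) →
      (∀ l : List (Fin n), l.Nodup → l.length = k + 2 → ¬l.IsChain R) → ¬R v w) :
    HasForcer k := by
  let G : SimpleGraph (Fin n) := SimpleGraph.fromEdgeSet (F ∪ M : Finset (Sym2 (Fin n)))
  have hG : G.edgeSet = (F ∪ M : Finset (Sym2 (Fin n))) := by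
    rw [SimpleGraph.edgeSet_fromEdgeSet]
    exact sdiff_eq_left.2 (Set.disjoint_left.2 fun e he => hdiag e he)
  have hadj : ∀ x y, s(x, y) ∈ F ∪ M → G.Adj x y := fun x y h => by
    rw [← SimpleGraph.mem_edgeSet, hG]
    exact h
  have hvw : s(v, w) ∈ G.edgeSet := hadj v w ((hv w).2 rfl)
  refine ⟨Fin n, inferInstance, G, v, s(v, w), hvw, by simp, ?_, ⟨F, M, ?_, ?_, ⟨?_, ?_, ?_, ?_⟩,
    ?_, ?_⟩, ?_⟩
  · intro f hf hvf
    obtain ⟨x, rfl⟩ := Sym2.mem_iff_exists.1 hvf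
    rw [hG] at hf
    rw [(hv x).1 hf]
  · rw [hG, Finset.coe_union]
  · exact_mod_cast hdisj
  · rw [hG, Finset.coe_union]
    exact Set.subset_union_left
  · exact isAcyclic_of_consecutive fun x y h => (hF x y h.1).1
  · intro x
    have hsub : {e ∈ (F : Set (Sym2 (Fin n))) | x ∈ e} ⊆
        (fun y => s(x, y)) '' (Fin.val ⁻¹' {x.val + 1, x.val - 1}) := by
      rintro e ⟨he, hxe⟩
      obtain ⟨y, rfl⟩ := Sym2.mem_iff_exists.1 hxe
      refine ⟨y, ?_, rfl⟩
      have := (hF x y he).1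
      simp only [Set.mem_preimage, Set.mem_insert_iff, Set.mem_singleton_iff]
      omega
    calc _ ≤ _ := Set.ncard_le_ncard hsub (Set.toFinite _)
      _ ≤ _ := Set.ncard_image_le (Set.toFinite _)
      _ = (Fin.val '' (Fin.val ⁻¹' {x.val + 1, x.val - 1} : Set (Fin n))).ncard :=
        (Set.ncard_image_of_injective _ Fin.val_injective).symm
      _ ≤ _ := Set.ncard_le_ncard (Set.image_preimage_subset _ _) (Set.toFinite _)
      _ ≤ 2 := (Set.ncard_insert_le _ _).trans (by simp)
  · exact fun _ _ p hp => length_le_of_fibre_card_le c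
      (fun x y h => (hF x y ((SimpleGraph.fromEdgeSet_adj _).1 h).1).2) hcard p hp
  · rw [hG, Finset.coe_union]
    exact Set.subset_union_right
  · intro e he f hf hef x hxe hxf
    obtain ⟨y, rfl⟩ := Sym2.mem_iff_exists.1 hxe
    obtain ⟨z, rfl⟩ := Sym2.mem_iff_exists.1 hxf
    exact hef (by rw [hM x y z he hf])
  · intro F' M' h
    have hnot := hforce (fun x y => s(x, y) ∈ F') (fun x y hxy => by rwa [Sym2.eq_swap])
      (fun x y z hy hz hyz => h.mem_or_mem (hadj x y hy) (hadj x z hz) hyz)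
      (fun x a b d hab had hbd => h.not_three hab had hbd)
      (fun a l hl hlen => h.not_cycle hl hlen) (fun l hl hlen => h.not_isChain hl hlen)
    exact ((Set.ext_iff.1 h.1 _).2 hvw).resolve_left hnot

theorem forcer_three : HasForcer 3 := by
  refine hasForcer_of_clauses (n := 8)
    (F := {s(0, 1), s(1, 2), s(2, 3), s(4, 5), s(5, 6)})
    (M := {s(0, 7), s(1, 5), s(2, 6)}) ![0, 0, 0, 0, 1, 1, 1, 2]
    (v := 7) (w := 0) (by decide) (by decide) (by decide) (by decide) (by decide) (by decide) ?_
  intro R hsymm hor hdeg hcyc hpath h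
  have := hor 1 0 5 (by decide) (by decide) (by decide)
  have := hor 1 0 2 (by decide) (by decide) (by decide)
  have := hor 1 5 2 (by decide) (by decide) (by decide)
  have := hor 5 1 4 (by decide) (by decide) (by decide)
  have := hor 5 1 6 (by decide) (by decide) (by decide)
  have := hor 5 4 6 (by decide) (by decide) (by decide)
  have := hor 2 1 3 (by decide) (by decide) (by decide)
  have := hor 2 1 6 (by decide) (by decide) (by decide)
  have := hor 2 3 6 (by decide) (by decide) (by decide)
  have := hor 6 5 2 (by decide) (by decide) (by decide)
  have := hcyc 1 [5, 6, 2] (by decide) (by decide)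
  have := hpath [7, 0, 1, 5, 4] (by decide) (by decide)
  have := hpath [7, 0, 1, 2, 3] (by decide) (by decide)
  have := hpath [1, 5, 6, 2, 3] (by decide) (by decide)
  have := hpath [1, 2, 6, 5, 4] (by decide) (by decide)
  have := hpath [3, 2, 1, 5, 6] (by decide) (by decide)
  have := hpath [4, 5, 1, 2, 6] (by decide) (by decide)
  simp only [List.isChain_cons_cons, List.isChain_singleton, List.getLast_cons_cons,
    List.getLast_singleton, and_true] at *
  grind

theorem forcer_four : HasForcer 4 := by
  refine hasForcer_of_clauses (n := 6)
    (F := {s(0, 1), s(1, 2), s(2, 3), s(3, 4)})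
    (M := {s(0, 4), s(1, 3), s(2, 5)}) ![0, 0, 0, 0, 0, 1]
    (v := 5) (w := 2) (by decide) (by decide) (by decide) (by decide) (by decide) (by decide) ?_
  intro R hsymm hor hdeg hcyc hpath h
  have := hor 2 3 1 (by decide) (by decide) (by decide)
  have := hdeg 2 5 3 1 (by decide) (by decide) (by decide)
  have := hor 3 2 1 (by decide) (by decide) (by decide)
  have := hor 3 2 4 (by decide) (by decide) (by decide)
  have := hdeg 3 2 1 4 (by decide) (by decide) (by decide)
  have := hor 1 2 3 (by decide) (by decide) (by decide)
  have := hor 1 2 0 (by decide) (by decide) (by decide)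
  have := hdeg 1 2 3 0 (by decide) (by decide) (by decide)
  have := hor 0 1 4 (by decide) (by decide) (by decide)
  have := hor 4 3 0 (by decide) (by decide) (by decide)
  have := hpath [5, 2, 3, 1, 0, 4] (by decide) (by decide)
  have := hpath [5, 2, 1, 3, 4, 0] (by decide) (by decide)
  simp only [List.isChain_cons_cons, List.isChain_singleton, and_true] at *
  grind

theorem forcer_five : HasForcer 5 := by
  refine hasForcer_of_clauses (n := 7)
    (F := {s(0, 1), s(1, 2), s(2, 3), s(3, 4), s(4, 5)})
    (M := {s(0, 6), s(1, 3), s(2, 4)}) ![0, 0, 0, 0, 0, 0, 1]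
    (v := 6) (w := 0) (by decide) (by decide) (by decide) (by decide) (by decide) (by decide) ?_
  intro R hsymm hor hdeg hcyc hpath h
  have := hor 1 0 2 (by decide) (by decide) (by decide)
  have := hor 1 0 3 (by decide) (by decide) (by decide)
  have := hor 1 2 3 (by decide) (by decide) (by decide)
  have := hor 2 1 3 (by decide) (by decide) (by decide)
  have := hor 2 3 4 (by decide) (by decide) (by decide)
  have := hdeg 2 1 3 4 (by decide) (by decide) (by decide)
  have := hor 3 1 2 (by decide) (by decide) (by decide)
  have := hor 3 2 4 (by decide) (by decide) (by decide)
  have := hdeg 3 1 2 4 (by decide) (by decide) (by decide)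
  have := hor 4 2 3 (by decide) (by decide) (by decide)
  have := hor 4 2 5 (by decide) (by decide) (by decide)
  have := hor 4 3 5 (by decide) (by decide) (by decide)
  have := hcyc 1 [2, 4, 3] (by decide) (by decide)
  have := hpath [6, 0, 1, 2, 3, 4, 5] (by decide) (by decide)
  have := hpath [6, 0, 1, 3, 2, 4, 5] (by decide) (by decide)
  simp only [List.isChain_cons_cons, List.isChain_singleton, List.getLast_cons_cons,
    List.getLast_singleton, and_true] at *
  grind

theorem forcer_six : HasForcer 6 := by
  refine hasForcer_of_clauses (n := 8)
    (F := {s(0, 1), s(1, 2), s(2, 3), s(3, 4), s(4, 5), s(5, 6)})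
    (M := {s(0, 6), s(1, 4), s(2, 7), s(3, 5)}) ![0, 0, 0, 0, 0, 0, 0, 1]
    (v := 7) (w := 2) (by decide) (by decide) (by decide) (by decide) (by decide) (by decide) ?_
  intro R hsymm hor hdeg hcyc hpath h
  have := hor 2 1 3 (by decide) (by decide) (by decide)
  have := hdeg 2 7 1 3 (by decide) (by decide) (by decide)
  have := hor 1 2 4 (by decide) (by decide) (by decide)
  have := hor 1 2 0 (by decide) (by decide) (by decide)
  have := hdeg 1 2 4 0 (by decide) (by decide) (by decide)
  have := hor 3 2 4 (by decide) (by decide) (by decide)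
  have := hor 3 2 5 (by decide) (by decide) (by decide)
  have := hor 3 4 5 (by decide) (by decide) (by decide)
  have := hdeg 3 2 4 5 (by decide) (by decide) (by decide)
  have := hor 4 1 5 (by decide) (by decide) (by decide)
  have := hor 4 3 5 (by decide) (by decide) (by decide)
  have := hdeg 4 1 3 5 (by decide) (by decide) (by decide)
  have := hor 5 3 4 (by decide) (by decide) (by decide)
  have := hor 5 4 6 (by decide) (by decide) (by decide)
  have := hdeg 5 3 4 6 (by decide) (by decide) (by decide)
  have := hor 0 1 6 (by decide) (by decide) (by decide)
  have := hor 6 5 0 (by decide) (by decide) (by decide)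
  have := hcyc 3 [4, 5] (by decide) (by decide)
  have := hpath [7, 2, 1, 4, 3, 5, 6, 0] (by decide) (by decide)
  have := hpath [7, 2, 3, 5, 4, 1, 0, 6] (by decide) (by decide)
  simp only [List.isChain_cons_cons, List.isChain_singleton, List.getLast_cons_cons,
    List.getLast_singleton, and_true] at *
  grind

theorem forcer_seven : HasForcer 7 := by
  refine hasForcer_of_clauses (n := 9)
    (F := {s(0, 1), s(1, 2), s(2, 3), s(3, 4), s(4, 5), s(5, 6), s(6, 7)})
    (M := {s(0, 2), s(1, 8), s(3, 5), s(4, 6)}) ![0, 0, 0, 0, 0, 0, 0, 0, 1]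
    (v := 8) (w := 1) (by decide) (by decide) (by decide) (by decide) (by decide) (by decide) ?_
  intro R hsymm hor hdeg hcyc hpath h
  have := hor 1 0 2 (by decide) (by decide) (by decide)
  have := hdeg 1 8 0 2 (by decide) (by decide) (by decide)
  have := hor 0 1 2 (by decide) (by decide) (by decide)
  have := hor 2 1 0 (by decide) (by decide) (by decide)
  have := hdeg 2 1 0 3 (by decide) (by decide) (by decide)
  have := hor 3 2 5 (by decide) (by decide) (by decide)
  have := hor 3 2 4 (by decide) (by decide) (by decide)
  have := hor 3 5 4 (by decide) (by decide) (by decide)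
  have := hor 5 3 4 (by decide) (by decide) (by decide)
  have := hor 5 6 4 (by decide) (by decide) (by decide)
  have := hdeg 5 3 6 4 (by decide) (by decide) (by decide)
  have := hor 6 5 7 (by decide) (by decide) (by decide)
  have := hor 6 5 4 (by decide) (by decide) (by decide)
  have := hor 6 7 4 (by decide) (by decide) (by decide)
  have := hor 4 3 5 (by decide) (by decide) (by decide)
  have := hor 4 5 6 (by decide) (by decide) (by decide)
  have := hdeg 4 3 5 6 (by decide) (by decide) (by decide)
  have := hcyc 3 [5, 6, 4] (by decide) (by decide)
  have := hpath [8, 1, 0, 2, 3, 4, 5, 6, 7] (by decide) (by decide)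
  have := hpath [8, 1, 0, 2, 3, 5, 4, 6, 7] (by decide) (by decide)
  simp only [List.isChain_cons_cons, List.isChain_singleton, List.getLast_cons_cons,
    List.getLast_singleton, and_true] at *
  grind

theorem forcer_of_eight_le {k : ℕ} (hk : 8 ≤ k) : HasForcer k := by
  refine hasForcer_of_clauses (n := 10)
    (F := {s(0, 1), s(1, 2), s(2, 3), s(3, 4), s(4, 5), s(5, 6), s(6, 7), s(7, 8)})
    (M := {s(0, 2), s(1, 3), s(4, 9), s(5, 7), s(6, 8)}) ![0, 0, 0, 0, 0, 0, 0, 0, 0, 1]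
    (v := 9) (w := 4) (by decide) (by decide) (by decide) (by decide) (by decide)
    (fun i => le_trans ?_ (Nat.add_le_add_right hk 1)) ?_
  · revert i
    decide
  intro R hsymm hor hdeg hcyc hpath h
  have := hdeg 4 9 3 5 (by decide) (by decide) (by decide)
  have := hor 3 4 2 (by decide) (by decide) (by decide)
  have := hor 3 4 1 (by decide) (by decide) (by decide)
  have := hor 2 1 0 (by decide) (by decide) (by decide)
  have := hdeg 2 3 1 0 (by decide) (by decide) (by decide)
  have := hor 1 2 0 (by decide) (by decide) (by decide)
  have := hdeg 1 3 2 0 (by decide) (by decide) (by decide)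
  have := hor 0 2 1 (by decide) (by decide) (by decide)
  have := hor 5 4 7 (by decide) (by decide) (by decide)
  have := hor 5 4 6 (by decide) (by decide) (by decide)
  have := hor 7 6 8 (by decide) (by decide) (by decide)
  have := hdeg 7 5 6 8 (by decide) (by decide) (by decide)
  have := hor 6 7 8 (by decide) (by decide) (by decide)
  have := hdeg 6 5 7 8 (by decide) (by decide) (by decide)
  have := hor 8 7 6 (by decide) (by decide) (by decide)
  have := hcyc 3 [2, 0, 1] (by decide) (by decide)
  have := hcyc 5 [7, 8, 6] (by decide) (by decide)
  simp only [List.isChain_cons_cons, List.isChain_singleton, List.getLast_cons_cons,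
    List.getLast_singleton, and_true] at *
  grind

/-- For every integer `k ≥ 3` there is a finite simple graph `G` with a vertex `v`
of degree 1 (i.e. with a unique incident edge `e`) such that `G` admits a decomposition into a
`k`-bounded linear forest and a matching, and in every such decomposition `(F, M)` the unique
edge `e` incident to `v` lies in `M`.  (An `(M,k)`-forcer exists.) -/
theorem mForcer_exists (k : ℕ) (hk : 3 ≤ k) :
    ∃ (V : Type) (_ : Fintype V) (G : SimpleGraph V) (v : V) (e : Sym2 V),
      e ∈ G.edgeSet ∧ v ∈ e ∧ (∀ f ∈ G.edgeSet, v ∈ f → f = e) ∧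
      (∃ F M : Set (Sym2 V), IsMLFDecomp G k F M) ∧
      (∀ F M : Set (Sym2 V), IsMLFDecomp G k F M → e ∈ M) := by
  obtain rfl | rfl | rfl | rfl | rfl | hk :
      k = 3 ∨ k = 4 ∨ k = 5 ∨ k = 6 ∨ k = 7 ∨ 8 ≤ k := by omega
  · exact forcer_three
  · exact forcer_four
  · exact forcer_five
  · exact forcer_six
  · exact forcer_seven
  · exact forcer_of_eight_le hk
end

section
/- For every pair of integers k ≥ 3 and 1 ≤ ℓ ≤ k there exists a finite simple graph G together with a vertex v of G of degree 1 such that: (i) the edge set of G admits a partition into a k-bounded linear forest and a matching; and (ii) for every partition (F, M) of the edge set of G into a k-bounded linear forest F and a matching M, the vertex v is contained in a path with exactly ℓ edges all of whose edges lie in F, and v is contained in no path with ℓ+1 edges all of whose edges lie in F. -/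
open SimpleGraph

/-- A decomposition of `G` into a `k`-bounded linear forest and a matching, presented by the
spanning subgraph `H` of forest edges and the spanning subgraph `K` of matching edges. -/
structure IsGraphDecomp {W : Type} (k : ℕ) (G H K : SimpleGraph W) : Prop where
  adj_iff : ∀ a b, G.Adj a b ↔ H.Adj a b ∨ K.Adj a b
  disj : ∀ a b, H.Adj a b → ¬ K.Adj a b
  deg_le_two : ∀ v a b c, H.Adj v a → H.Adj v b → H.Adj v c → a = b ∨ a = c ∨ b = c
  matching : ∀ v a b, K.Adj v a → K.Adj v b → a = b
  acyclic : H.IsAcyclic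
  length_le : ∀ (u w : W) (p : H.Walk u w), p.IsPath → p.length ≤ k

theorem IsMLFDecomp.isGraphDecomp {V : Type} [Finite V] {G : SimpleGraph V} {k : ℕ}
    {F M : Set (Sym2 V)} (h : IsMLFDecomp G k F M) :
    IsGraphDecomp k G (fromEdgeSet F) (fromEdgeSet M) := by
  obtain ⟨hu, hd, ⟨hFG, hac, hdeg, hlen⟩, hMG, hM⟩ := h
  refine ⟨fun a b => ?_, fun a b hF hM' => ?_, fun v a b c ha hb hc => ?_,
    fun v a b ha hb => ?_, hac, hlen⟩
  · rw [← mem_edgeSet, ← hu]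
    simp only [fromEdgeSet_adj, Set.mem_union]
    constructor
    · intro h
      have hab : a ≠ b := by
        rw [← Set.mem_union, hu] at h
        exact G.ne_of_adj h
      tauto
    · tauto
  · rw [fromEdgeSet_adj] at hF hM'
    exact Set.disjoint_left.1 hd hF.1 hM'.1
  · by_contra! hne
    have h3 : 2 < {e ∈ F | v ∈ e}.ncard := by
      rw [Set.two_lt_ncard_iff (Set.toFinite _)]
      rw [fromEdgeSet_adj] at ha hb hc
      exact ⟨s(v, a), s(v, b), s(v, c), ⟨ha.1, by simp⟩, ⟨hb.1, by simp⟩, ⟨hc.1, by simp⟩,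
        mt Sym2.congr_right.1 hne.1, mt Sym2.congr_right.1 hne.2.1,
        mt Sym2.congr_right.1 hne.2.2⟩
    exact absurd (hdeg v) (by omega)
  · rw [fromEdgeSet_adj] at ha hb
    by_contra hne
    exact hM _ ha.1 _ hb.1 (mt Sym2.congr_right.1 hne) v (by simp) (by simp)

theorem apply_eq_of_mem_support {V α : Type*} {H : SimpleGraph V} (f : V → α)
    (hf : ∀ a b, H.Adj a b → f a = f b) {u w : V} (p : H.Walk u w) :
    ∀ z ∈ p.support, f z = f u := by
  induction p with
  | nil => simp
  | cons hadj p ih =>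
    intro z hz
    rcases List.mem_cons.1 (by simpa using hz) with rfl | hz
    · rfl
    · rw [ih z hz, hf _ _ hadj]

/-- A certificate that `(H, K)` is a decomposition of `G` into a `k`-bounded linear forest and a
matching: the vertices are labelled injectively by a path index and a position at most `k` so
that vertices adjacent in `H` lie at consecutive positions of one path. -/
structure IsLabelledDecomp {V ι : Type} (k : ℕ) (G H K : SimpleGraph V) (idx : V → ι)
    (pos : V → ℕ) : Prop where
  adj_iff : ∀ a b, G.Adj a b ↔ H.Adj a b ∨ K.Adj a b
  disj : ∀ a b, H.Adj a b → ¬ K.Adj a b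
  matching : ∀ v a b, K.Adj v a → K.Adj v b → a = b
  inj : ∀ a b, idx a = idx b → pos a = pos b → a = b
  pos_le : ∀ a, pos a ≤ k
  step : ∀ a b, H.Adj a b → idx a = idx b ∧ (pos a = pos b + 1 ∨ pos b = pos a + 1)

namespace IsLabelledDecomp

variable {V ι : Type} {k : ℕ} {G H K : SimpleGraph V} {idx : V → ι} {pos : V → ℕ}

theorem idx_eq_of_mem_support (h : IsLabelledDecomp k G H K idx pos) {u w : V} (p : H.Walk u w) :
    ∀ z ∈ p.support, idx z = idx u :=
  apply_eq_of_mem_support idx (fun a b hab => (h.step a b hab).1) p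

theorem length_le (h : IsLabelledDecomp k G H K idx pos) {u w : V} (p : H.Walk u w)
    (hp : p.IsPath) : p.length ≤ k := by
  have hnd : (p.support.map pos).Nodup := by
    refine (List.nodup_map_iff_inj_on hp.support_nodup).2 fun a ha b hb hab => ?_
    exact h.inj a b ((h.idx_eq_of_mem_support p a ha).trans
      (h.idx_eq_of_mem_support p b hb).symm) hab
  have hsub : p.support.map pos ⊆ List.range (k + 1) := by
    intro n hn
    obtain ⟨a, -, rfl⟩ := List.mem_map.1 hn
    exact List.mem_range.2 (Nat.lt_succ_of_le (h.pos_le a))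
  have := (hnd.subperm hsub).length_le
  simp only [List.length_map, Walk.length_support, List.length_range] at this
  omega

theorem isAcyclic (h : IsLabelledDecomp k G H K idx pos) : H.IsAcyclic := by
  classical
  intro v c hc
  obtain ⟨m, hm, hmax⟩ := c.support.toFinset.exists_max_image pos ⟨v, by simp⟩
  rw [List.mem_toFinset] at hm
  have hc' : (c.rotate m hm).IsCycle := hc.rotate hm
  have hmem : ∀ z ∈ (c.rotate m hm).support, pos z ≤ pos m := by
    intro z hz
    refine hmax z (List.mem_toFinset.2 ?_)
    simpa using hz
  have h1 := (c.rotate m hm).adj_snd hc'.not_nil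
  have h2 := ((c.rotate m hm).adj_penultimate hc'.not_nil).symm
  have b1 := hmem _ ((c.rotate m hm).getVert_mem_support 1)
  have b2 := hmem _ ((c.rotate m hm).getVert_mem_support ((c.rotate m hm).length - 1))
  have s1 := h.step _ _ h1
  have s2 := h.step _ _ h2
  refine hc'.snd_ne_penultimate (h.inj _ _ (s1.1.symm.trans s2.1) ?_)
  simp only [Walk.snd, Walk.penultimate] at *
  omega

theorem deg_le_two (h : IsLabelledDecomp k G H K idx pos) (v a b c : V) (ha : H.Adj v a)
    (hb : H.Adj v b) (hc : H.Adj v c) : a = b ∨ a = c ∨ b = c := by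
  have sa := h.step _ _ ha
  have sb := h.step _ _ hb
  have sc := h.step _ _ hc
  have hab := h.inj a b (sa.1.symm.trans sb.1)
  have hac := h.inj a c (sa.1.symm.trans sc.1)
  have hbc := h.inj b c (sb.1.symm.trans sc.1)
  by_contra! hne
  have := mt hab hne.1
  have := mt hac hne.2.1
  have := mt hbc hne.2.2
  omega

theorem isMLFDecomp [Finite V] (h : IsLabelledDecomp k G H K idx pos) :
    IsMLFDecomp G k H.edgeSet K.edgeSet := by
  have hH : fromEdgeSet H.edgeSet = H := fromEdgeSet_edgeSet H
  have hu : H.edgeSet ∪ K.edgeSet = G.edgeSet := by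
    ext e
    induction e with | _ a b => simp [h.adj_iff]
  refine ⟨hu, ?_, ⟨hu ▸ Set.subset_union_left, ?_, fun v => ?_, ?_⟩,
    hu ▸ Set.subset_union_right, ?_⟩
  · rw [Set.disjoint_left]
    intro e
    induction e with | _ a b => exact h.disj a b
  · rw [hH]
    exact h.isAcyclic
  · by_contra! hlt
    rw [Set.two_lt_ncard_iff (Set.toFinite _)] at hlt
    obtain ⟨e, f, g, ⟨he, hve⟩, ⟨hf, hvf⟩, ⟨hg, hvg⟩, hef, heg, hfg⟩ := hlt
    obtain ⟨a, rfl⟩ := Sym2.mem_iff_exists.1 hve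
    obtain ⟨b, rfl⟩ := Sym2.mem_iff_exists.1 hvf
    obtain ⟨c, rfl⟩ := Sym2.mem_iff_exists.1 hvg
    rcases h.deg_le_two v a b c he hf hg with rfl | rfl | rfl <;> contradiction
  · rw [hH]
    exact fun u w p hp => h.length_le p hp
  · intro e he f hf hef v hve hvf
    obtain ⟨a, rfl⟩ := Sym2.mem_iff_exists.1 hve
    obtain ⟨b, rfl⟩ := Sym2.mem_iff_exists.1 hvf
    exact hef (by rw [h.matching v a b he hf])

end IsLabelledDecomp

/-- The disjoint union of `G₁` and `G₂` together with an edge joining `u₁` and `u₂`. -/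
def attach {V₁ V₂ : Type} (G₁ : SimpleGraph V₁) (u₁ : V₁) (G₂ : SimpleGraph V₂) (u₂ : V₂) :
    SimpleGraph (V₁ ⊕ V₂) where
  Adj
    | .inl a, .inl b => G₁.Adj a b
    | .inr a, .inr b => G₂.Adj a b
    | .inl a, .inr b => a = u₁ ∧ b = u₂
    | .inr b, .inl a => a = u₁ ∧ b = u₂
  symm := ⟨by
    rintro (a | a) (b | b) h
    · exact G₁.adj_symm h
    · exact h
    · exact h
    · exact G₂.adj_symm h⟩
  loopless := ⟨by
    rintro (a | a) h
    · exact G₁.irrefl h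
    · exact G₂.irrefl h⟩

section attach

variable {V₁ V₂ : Type} {G₁ : SimpleGraph V₁} {u₁ : V₁} {G₂ : SimpleGraph V₂} {u₂ : V₂}

@[simp] theorem attach_adj_inl_inl {a b : V₁} :
    (attach G₁ u₁ G₂ u₂).Adj (.inl a) (.inl b) ↔ G₁.Adj a b := Iff.rfl

@[simp] theorem attach_adj_inr_inr {a b : V₂} :
    (attach G₁ u₁ G₂ u₂).Adj (.inr a) (.inr b) ↔ G₂.Adj a b := Iff.rfl

@[simp] theorem attach_adj_inl_inr {a : V₁} {b : V₂} :
    (attach G₁ u₁ G₂ u₂).Adj (.inl a) (.inr b) ↔ a = u₁ ∧ b = u₂ := Iff.rfl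

@[simp] theorem attach_adj_inr_inl {a : V₁} {b : V₂} :
    (attach G₁ u₁ G₂ u₂).Adj (.inr b) (.inl a) ↔ a = u₁ ∧ b = u₂ := Iff.rfl

end attach

/-- `G` has a labelled decomposition whose matching avoids `u`. -/
def HasFreeRoot {V : Type} (k : ℕ) (G : SimpleGraph V) (u : V) : Prop :=
  ∃ (ι : Type) (H K : SimpleGraph V) (idx : V → ι) (pos : V → ℕ),
    IsLabelledDecomp k G H K idx pos ∧ ∀ a, ¬ K.Adj u a

/-- `G` has a labelled decomposition in which `u` is the last vertex, at position `n`, of its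
path. -/
def HasTopRoot {V : Type} (k : ℕ) (G : SimpleGraph V) (u : V) (n : ℕ) : Prop :=
  ∃ (ι : Type) (H K : SimpleGraph V) (idx : V → ι) (pos : V → ℕ),
    IsLabelledDecomp k G H K idx pos ∧ pos u = n ∧ ∀ a, idx a = idx u → pos a ≤ n

/-- `G` has a labelled decomposition whose matching avoids `u` and in which `u` is the last
vertex, at position `n`, of its path. -/
def HasFreeTopRoot {V : Type} (k : ℕ) (G : SimpleGraph V) (u : V) (n : ℕ) : Prop :=
  ∃ (ι : Type) (H K : SimpleGraph V) (idx : V → ι) (pos : V → ℕ),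
    IsLabelledDecomp k G H K idx pos ∧ (∀ a, ¬ K.Adj u a) ∧
      pos u = n ∧ ∀ a, idx a = idx u → pos a ≤ n

section existence

variable {V₁ V₂ : Type} {G₁ : SimpleGraph V₁} {u₁ : V₁} {G₂ : SimpleGraph V₂} {u₂ : V₂} {k : ℕ}

theorem HasFreeTopRoot.hasTopRoot {n : ℕ} (h : HasFreeTopRoot k G₁ u₁ n) :
    HasTopRoot k G₁ u₁ n := by
  obtain ⟨ι, H, K, idx, pos, h, -, ht⟩ := h
  exact ⟨ι, H, K, idx, pos, h, ht⟩

theorem HasFreeTopRoot.attach_of_hasFreeRoot {n : ℕ} (h₁ : HasFreeTopRoot k G₁ u₁ n)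
    (h₂ : HasFreeRoot k G₂ u₂) : HasTopRoot k (attach G₁ u₁ G₂ u₂) (.inl u₁) n := by
  obtain ⟨ι₁, H₁, K₁, i₁, p₁, h₁, f₁, rfl, t₁⟩ := h₁
  obtain ⟨ι₂, H₂, K₂, i₂, p₂, h₂, f₂⟩ := h₂
  refine ⟨ι₁ ⊕ ι₂, H₁ ⊕g H₂, attach K₁ u₁ K₂ u₂, Sum.map i₁ i₂, Sum.elim p₁ p₂,
    ⟨?_, ?_, ?_, ?_, ?_, ?_⟩, rfl, ?_⟩
  · rintro (a | a) (b | b)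
    · simpa using h₁.adj_iff a b
    · simp
    · simp
    · simpa using h₂.adj_iff a b
  · rintro (a | a) (b | b)
    · simpa using h₁.disj a b
    · simp
    · simp
    · simpa using h₂.disj a b
  · rintro (v | v) (a | a) (b | b) ha hb <;>
      simp only [attach_adj_inl_inl, attach_adj_inr_inr, attach_adj_inl_inr,
        attach_adj_inr_inl] at ha hb
    · rw [h₁.matching v a b ha hb]
    · exact absurd (hb.1 ▸ ha) (f₁ a)
    · exact absurd (ha.1 ▸ hb) (f₁ b)
    · rw [ha.2, hb.2]
    · rw [ha.1, hb.1]
    · exact absurd (ha.2 ▸ hb) (f₂ b)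
    · exact absurd (hb.2 ▸ ha) (f₂ a)
    · rw [h₂.matching v a b ha hb]
  · rintro (a | a) (b | b) hi hp <;> simp at hi hp
    · rw [h₁.inj a b hi hp]
    · rw [h₂.inj a b hi hp]
  · rintro (a | a)
    · exact h₁.pos_le a
    · exact h₂.pos_le a
  · rintro (a | a) (b | b) h
    · simpa using h₁.step a b (by simpa using h)
    · simp at h
    · simp at h
    · simpa using h₂.step a b (by simpa using h)
  · rintro (a | a) h
    · exact t₁ a (by simpa using h)
    · simp at h

theorem HasFreeTopRoot.exists_attach {n₁ n₂ : ℕ} (h₁ : HasFreeTopRoot k G₁ u₁ n₁)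
    (h₂ : HasTopRoot k G₂ u₂ n₂) (hk : n₁ + n₂ + 1 ≤ k) :
    HasFreeRoot k (attach G₁ u₁ G₂ u₂) (.inl u₁) ∧
      (n₁ = 0 → HasFreeTopRoot k (attach G₁ u₁ G₂ u₂) (.inl u₁) (n₂ + 1)) := by
  classical
  obtain ⟨ι₁, H₁, K₁, i₁, p₁, h₁, f₁, rfl, t₁⟩ := h₁
  obtain ⟨ι₂, H₂, K₂, i₂, p₂, h₂, rfl, t₂⟩ := h₂
  have key : ∃ (idx : V₁ ⊕ V₂ → ι₁ ⊕ ι₂) (pos : V₁ ⊕ V₂ → ℕ),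
      IsLabelledDecomp k (attach G₁ u₁ G₂ u₂) (attach H₁ u₁ H₂ u₂) (K₁ ⊕g K₂) idx pos ∧
      pos (.inl u₁) = p₂ u₂ + 1 ∧
      ∀ a, idx a = idx (.inl u₁) → pos a ≤ p₂ u₂ + 1 + p₁ u₁ := by
    refine ⟨Sum.elim (fun a => if i₁ a = i₁ u₁ then .inr (i₂ u₂) else .inl (i₁ a))
        (fun b => .inr (i₂ b)),
      Sum.elim (fun a => if i₁ a = i₁ u₁ then p₂ u₂ + 1 + (p₁ u₁ - p₁ a) else p₁ a) p₂,
      ⟨?_, ?_, ?_, ?_, ?_, ?_⟩, by simp, ?_⟩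
    · rintro (a | a) (b | b)
      · simpa using h₁.adj_iff a b
      · simp
      · simp
      · simpa using h₂.adj_iff a b
    · rintro (a | a) (b | b)
      · simpa using h₁.disj a b
      · simp
      · simp
      · simpa using h₂.disj a b
    · rintro (v | v) (a | a) (b | b) ha hb <;> simp at ha hb
      · rw [h₁.matching v a b ha hb]
      · rw [h₂.matching v a b ha hb]
    · rintro (a | a) (b | b) hi hp <;> simp only [Sum.elim_inl, Sum.elim_inr] at hi hp
      · have ta := t₁ a
        have tb := t₁ b
        have hinj := h₁.inj a b
        by_cases ca : i₁ a = i₁ u₁ <;> by_cases cb : i₁ b = i₁ u₁ <;> simp [ca, cb] at hi hp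
        · rw [hinj (ca.trans cb.symm) (by have := ta ca; have := tb cb; omega)]
        · rw [hinj hi hp]
      · by_cases ca : i₁ a = i₁ u₁ <;> simp [ca] at hi hp
        have := t₂ b hi.symm
        omega
      · by_cases cb : i₁ b = i₁ u₁ <;> simp [cb] at hi hp
        have := t₂ a hi
        omega
      · rw [h₂.inj a b (by simpa using hi) hp]
    · rintro (a | a)
      · have := h₁.pos_le a
        simp only [Sum.elim_inl]
        split_ifs <;> omega
      · exact h₂.pos_le a
    · rintro (a | a) (b | b) h
      · have hs := h₁.step a b h
        have ta := t₁ a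
        have tb := t₁ b
        simp only [Sum.elim_inl, hs.1] at ta ⊢
        refine ⟨trivial, ?_⟩
        split_ifs with c
        · have := ta c
          have := tb c
          omega
        · exact hs.2
      · obtain ⟨rfl, rfl⟩ := h
        simp
      · obtain ⟨rfl, rfl⟩ := h
        simp
      · simpa using h₂.step a b h
    · rintro (a | a) h
      · simp only [Sum.elim_inl]
        split_ifs with c
        · omega
        · simp [c] at h
      · have := t₂ a (by simpa using h)
        simp only [Sum.elim_inr]
        omega
  obtain ⟨idx, pos, hd, hpos, htop⟩ := key
  have hfree : ∀ a, ¬ (K₁ ⊕g K₂).Adj (.inl u₁) a := by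
    rintro (a | a)
    · simpa using f₁ a
    · simp
  exact ⟨⟨_, _, _, idx, pos, hd, hfree⟩,
    fun h0 => ⟨_, _, _, idx, pos, hd, hfree, hpos, fun a ha => by simpa [h0] using htop a ha⟩⟩

theorem hasFreeTopRoot_single : HasFreeTopRoot k (⊥ : SimpleGraph Unit) () 0 :=
  ⟨Unit, ⊥, ⊥, id, fun _ => 0, ⟨by simp, by simp, by simp, by simp, by simp, by simp⟩,
    by simp, rfl, by simp⟩

end existence

/-- `φ` embeds `G` in `G'` so that the edges leaving the image are those joining the image of
the root `u` to the vertices in `X`. -/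
structure IsRootedEmbedding {V W : Type} (G : SimpleGraph V) (u : V) (G' : SimpleGraph W)
    (φ : V → W) (X : Set W) : Prop where
  inj : Function.Injective φ
  adj_iff : ∀ a w, G'.Adj (φ a) w ↔ (∃ b, φ b = w ∧ G.Adj a b) ∨ (a = u ∧ w ∈ X)
  not_mem : ∀ w ∈ X, ∀ a, φ a ≠ w

namespace IsRootedEmbedding

variable {V V₁ V₂ W : Type} {G : SimpleGraph V} {u : V} {G₁ : SimpleGraph V₁} {u₁ : V₁}
  {G₂ : SimpleGraph V₂} {u₂ : V₂} {G' : SimpleGraph W} {X : Set W}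

theorem attach_left {φ : V₁ ⊕ V₂ → W}
    (h : IsRootedEmbedding (attach G₁ u₁ G₂ u₂) (.inl u₁) G' φ X) :
    IsRootedEmbedding G₁ u₁ G' (φ ∘ Sum.inl) (insert (φ (.inr u₂)) X) := by
  refine ⟨h.inj.comp Sum.inl_injective, fun a w => ?_, ?_⟩
  · rw [Function.comp_apply, h.adj_iff]
    simp only [Sum.exists, attach_adj_inl_inl, attach_adj_inl_inr, Sum.inl.injEq,
      Function.comp_apply, Set.mem_insert_iff]
    grind
  · rintro w (rfl | hw) a
    · exact fun e => by simpa using h.inj e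
    · exact h.not_mem w hw _

theorem attach_right {φ : V₁ ⊕ V₂ → W}
    (h : IsRootedEmbedding (attach G₁ u₁ G₂ u₂) (.inl u₁) G' φ X) :
    IsRootedEmbedding G₂ u₂ G' (φ ∘ Sum.inr) {φ (.inl u₁)} := by
  refine ⟨h.inj.comp Sum.inr_injective, fun a w => ?_, ?_⟩
  · rw [Function.comp_apply, h.adj_iff]
    simp only [Sum.exists, attach_adj_inr_inr, attach_adj_inr_inl, reduceCtorEq, false_and,
      or_false, Function.comp_apply, Set.mem_singleton_iff]
    grind
  · rintro w rfl a
    exact fun e => by simpa using h.inj e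

theorem adj_single_iff {φ : Unit → W} (h : IsRootedEmbedding ⊥ () G' φ X) (w : W) :
    G'.Adj (φ ()) w ↔ w ∈ X := by
  rw [h.adj_iff]
  simp

end IsRootedEmbedding

theorem isRootedEmbedding_inr_attach {V : Type} (G : SimpleGraph V) (u : V) :
    IsRootedEmbedding G u (attach (⊥ : SimpleGraph Unit) () G u) Sum.inr {.inl ()} := by
  refine ⟨Sum.inr_injective, ?_, by simp⟩
  rintro a (⟨⟩ | w) <;> simp

/-- `G` with a new root joined to `u`. -/
abbrev pendant {V : Type} (G : SimpleGraph V) (u : V) : SimpleGraph (Unit ⊕ V) :=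
  attach ⊥ () G u

/-- `G₁` and `G₂` with a new root joined to `u₁` and `u₂`. -/
abbrev fork {V₁ V₂ : Type} (G₁ : SimpleGraph V₁) (u₁ : V₁) (G₂ : SimpleGraph V₂) (u₂ : V₂) :
    SimpleGraph ((Unit ⊕ V₁) ⊕ V₂) :=
  attach (pendant G₁ u₁) (.inl ()) G₂ u₂

namespace IsRootedEmbedding

variable {V V₁ V₂ W : Type} {G : SimpleGraph V} {u : V} {G₁ : SimpleGraph V₁} {u₁ : V₁}
  {G₂ : SimpleGraph V₂} {u₂ : V₂} {G' : SimpleGraph W} {x : W}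

theorem adj_pendant_iff {φ : Unit ⊕ V → W}
    (h : IsRootedEmbedding (pendant G u) (.inl ()) G' φ {x}) (w : W) :
    G'.Adj (φ (.inl ())) w ↔ w = φ (.inr u) ∨ w = x := by
  simpa using h.attach_left.adj_single_iff w

theorem fork_left {φ : (Unit ⊕ V₁) ⊕ V₂ → W}
    (h : IsRootedEmbedding (fork G₁ u₁ G₂ u₂) (.inl (.inl ())) G' φ {x}) :
    IsRootedEmbedding G₁ u₁ G' (fun a => φ (.inl (.inr a))) {φ (.inl (.inl ()))} :=
  h.attach_left.attach_right

theorem fork_right {φ : (Unit ⊕ V₁) ⊕ V₂ → W}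
    (h : IsRootedEmbedding (fork G₁ u₁ G₂ u₂) (.inl (.inl ())) G' φ {x}) :
    IsRootedEmbedding G₂ u₂ G' (fun a => φ (.inr a)) {φ (.inl (.inl ()))} :=
  h.attach_right

theorem adj_fork_iff {φ : (Unit ⊕ V₁) ⊕ V₂ → W}
    (h : IsRootedEmbedding (fork G₁ u₁ G₂ u₂) (.inl (.inl ())) G' φ {x}) (w : W) :
    G'.Adj (φ (.inl (.inl ()))) w ↔
      w = φ (.inl (.inr u₁)) ∨ w = φ (.inr u₂) ∨ w = x := by
  simpa using h.attach_left.attach_left.adj_single_iff w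

end IsRootedEmbedding

namespace IsGraphDecomp

variable {W : Type} {k : ℕ} {G H K : SimpleGraph W}

theorem mono_left (h : IsGraphDecomp k G H K) {a b : W} (hab : H.Adj a b) : G.Adj a b :=
  (h.adj_iff a b).2 (.inl hab)

theorem add_length_lt (h : IsGraphDecomp k G H K) {a b y z : W} (p : H.Walk a y)
    (q : H.Walk b z) (hp : p.IsPath) (hq : q.IsPath) (hab : H.Adj a b)
    (hpq : ∀ w ∈ p.support, w ∉ q.support) : p.length + q.length < k := by
  have := h.length_le _ _ (p.reverse.append (.cons hab q)) (by
    rw [Walk.isPath_def, Walk.support_append, Walk.support_reverse, Walk.support_cons,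
      List.tail_cons]
    refine List.Nodup.append (List.nodup_reverse.2 hp.support_nodup) hq.support_nodup ?_
    intro w hw
    exact hpq w (List.mem_reverse.1 hw))
  simp only [Walk.length_append, Walk.length_reverse, Walk.length_cons] at this
  omega

theorem not_triangle (h : IsGraphDecomp k G H K) {a b c : W} (hab : H.Adj a b)
    (hbc : H.Adj b c) (hca : H.Adj c a) : False := by
  refine h.acyclic (.cons hab (.cons hbc (.cons hca .nil))) ?_
  have := hab.ne
  have := hbc.ne
  have := hca.ne
  simp [Walk.cons_isCycle_iff]
  grind

theorem not_square (h : IsGraphDecomp k G H K) {a b c d : W} (hab : H.Adj a b)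
    (hbc : H.Adj b c) (hcd : H.Adj c d) (hda : H.Adj d a) (hac : a ≠ c) (hbd : b ≠ d) :
    False := by
  refine h.acyclic (.cons hab (.cons hbc (.cons hcd (.cons hda .nil)))) ?_
  have := hab.ne
  have := hbc.ne
  have := hcd.ne
  have := hda.ne
  simp [Walk.cons_isCycle_iff]
  grind

theorem four_le (h : IsGraphDecomp k G H K) {a b c d e : W} (hab : H.Adj a b)
    (hbc : H.Adj b c) (hcd : H.Adj c d) (hde : H.Adj d e) (hnd : [a, b, c, d, e].Nodup) :
    4 ≤ k :=
  h.length_le _ _ (.cons hab (.cons hbc (.cons hcd (.cons hde .nil))))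
    (by rw [Walk.isPath_def]; simpa using hnd)

end IsGraphDecomp

/-- Whenever `G` sits inside a decomposed graph and is joined to the rest only by an edge from a
vertex `x` to `u`, this edge belongs to the matching. -/
def ForcesMatching {V : Type} (k : ℕ) (G : SimpleGraph V) (u : V) : Prop :=
  ∀ (W : Type) (G' H K : SimpleGraph W) (φ : V → W) (x : W), IsGraphDecomp k G' H K →
    IsRootedEmbedding G u G' φ {x} → K.Adj x (φ u)

/-- Whenever `G` sits inside a decomposed graph and is joined to the rest only by an edge from a
vertex `x` to `u`, this edge belongs to the forest and `u` is the end of a forest path with `n`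
edges inside `G`. -/
def ForcesForest {V : Type} (k : ℕ) (G : SimpleGraph V) (u : V) (n : ℕ) : Prop :=
  ∀ (W : Type) (G' H K : SimpleGraph W) (φ : V → W) (x : W), IsGraphDecomp k G' H K →
    IsRootedEmbedding G u G' φ {x} → H.Adj x (φ u) ∧
      ∃ (y : W) (p : H.Walk (φ u) y), p.IsPath ∧ p.length = n ∧ ∀ z ∈ p.support, z ∈ Set.range φ

/-- Whenever `G` sits inside a decomposed graph and is joined to the rest only by an edge from a
vertex `x` to `u`, at most `n + 1` vertices can be reached from `u` along forest edges without
passing through `x`. -/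
def BoundsForest {V : Type} (k : ℕ) (G : SimpleGraph V) (u : V) (n : ℕ) : Prop :=
  ∀ (W : Type) (G' H K : SimpleGraph W) (φ : V → W) (x : W), IsGraphDecomp k G' H K →
    IsRootedEmbedding G u G' φ {x} →
      ∃ S : Finset W, φ u ∈ S ∧ S.card ≤ n + 1 ∧ ∀ a ∈ S, ∀ b, H.Adj a b → b ∈ S ∨ b = x

section forcing

variable {V V₁ V₂ : Type} {G : SimpleGraph V} {u : V} {G₁ : SimpleGraph V₁} {u₁ : V₁}
  {G₂ : SimpleGraph V₂} {u₂ : V₂} {k n n₁ n₂ : ℕ}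

theorem ForcesForest.exists_path_from (hG : ForcesForest k G u n) {W : Type}
    {G' H K : SimpleGraph W} {φ : V → W} {x : W} (hd : IsGraphDecomp k G' H K)
    (hφ : IsRootedEmbedding G u G' φ {x}) :
    ∃ (y : W) (p : H.Walk x y), p.IsPath ∧ p.length = n + 1 ∧
      ∀ z ∈ p.support, z = x ∨ z ∈ Set.range φ := by
  obtain ⟨hadj, y, p, hp, hl, hs⟩ := hG W G' H K φ x hd hφ
  refine ⟨y, .cons hadj p, ?_, by simp [hl], ?_⟩
  · rw [Walk.cons_isPath_iff]
    refine ⟨hp, fun hx => ?_⟩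
    obtain ⟨a, ha⟩ := hs x hx
    exact hφ.not_mem x rfl a ha
  · intro z hz
    rcases List.mem_cons.1 (by simpa using hz) with rfl | hz
    · exact .inl rfl
    · exact .inr (hs z hz)

theorem ForcesForest.forcesMatching_pendant (hG : ForcesForest k G u n) (hk : k ≤ n + 1) :
    ForcesMatching k (pendant G u) (.inl ()) := by
  intro W G' H K φ x hd hφ
  have hx : G'.Adj (φ (.inl ())) x := (hφ.adj_pendant_iff x).2 (.inr rfl)
  rcases (hd.adj_iff _ _).1 hx with hx | hx
  · exfalso
    obtain ⟨y, p, hp, hl, hs⟩ := hG.exists_path_from hd hφ.attach_right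
    have := hd.add_length_lt (.nil : H.Walk x x) p .nil hp hx.symm (by
      intro w hw hwp
      obtain rfl : w = x := by simpa using hw
      rcases hs w hwp with h | ⟨a, h⟩
      · exact hx.ne h.symm
      · exact hφ.not_mem w rfl _ h)
    simp only [Walk.length_nil, hl] at this
    omega
  · exact hx.symm

theorem ForcesForest.forcesMatching_fork (h₁ : ForcesForest k G₁ u₁ n₁)
    (h₂ : ForcesForest k G₂ u₂ n₂) :
    ForcesMatching k (fork G₁ u₁ G₂ u₂) (.inl (.inl ())) := by
  intro W G' H K φ x hd hφ
  have hx : G'.Adj (φ (.inl (.inl ()))) x := (hφ.adj_fork_iff x).2 (.inr (.inr rfl))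
  rcases (hd.adj_iff _ _).1 hx with hx | hx
  · exfalso
    rcases hd.deg_le_two _ _ _ _ (h₁ _ _ _ _ _ _ hd hφ.fork_left).1
      (h₂ _ _ _ _ _ _ hd hφ.fork_right).1 hx with h | h | h
    · simpa using hφ.inj h
    · exact hφ.not_mem x rfl _ h
    · exact hφ.not_mem x rfl _ h
  · exact hx.symm

theorem ForcesForest.fork_forcesMatching (h₁ : ForcesForest k G₁ u₁ n)
    (h₂ : ForcesMatching k G₂ u₂) :
    ForcesForest k (fork G₁ u₁ G₂ u₂) (.inl (.inl ())) (n + 1) := by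
  intro W G' H K φ x hd hφ
  constructor
  · have hx : G'.Adj (φ (.inl (.inl ()))) x := (hφ.adj_fork_iff x).2 (.inr (.inr rfl))
    rcases (hd.adj_iff _ _).1 hx with hx | hx
    · exact hx.symm
    · exact absurd (hd.matching _ _ _ (h₂ _ _ _ _ _ _ hd hφ.fork_right) hx)
        (hφ.not_mem x rfl _)
  · obtain ⟨y, p, hp, hl, hs⟩ := h₁.exists_path_from hd hφ.fork_left
    refine ⟨y, p, hp, hl, fun z hz => ?_⟩
    rcases hs z hz with rfl | ⟨a, rfl⟩ <;> exact Set.mem_range_self _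

theorem BoundsForest.fork_forcesMatching (h₁ : BoundsForest k G₁ u₁ n)
    (h₂ : ForcesMatching k G₂ u₂) :
    BoundsForest k (fork G₁ u₁ G₂ u₂) (.inl (.inl ())) (n + 1) := by
  classical
  intro W G' H K φ x hd hφ
  obtain ⟨S, hu, hc, hS⟩ := h₁ _ _ _ _ _ _ hd hφ.fork_left
  refine ⟨insert (φ (.inl (.inl ()))) S, by simp, ?_, fun a ha b hab => ?_⟩
  · have := Finset.card_insert_le (φ (.inl (.inl ()))) S
    omega
  · rcases Finset.mem_insert.1 ha with rfl | ha
    · rcases (hφ.adj_fork_iff b).1 (hd.mono_left hab) with rfl | rfl | rfl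
      · simp [hu]
      · exact absurd (h₂ _ _ _ _ _ _ hd hφ.fork_right) (hd.disj _ _ hab)
      · simp
    · rcases hS a ha b hab with h | h
      · simp [h]
      · simp [h]

theorem ForcesMatching.forcesForest_pendant (h : ForcesMatching k G u) :
    ForcesForest k (pendant G u) (.inl ()) 0 := by
  intro W G' H K φ x hd hφ
  refine ⟨?_, _, .nil, .nil, rfl, by simp⟩
  have hx : G'.Adj (φ (.inl ())) x := (hφ.adj_pendant_iff x).2 (.inr rfl)
  rcases (hd.adj_iff _ _).1 hx with hx | hx
  · exact hx.symm
  · exact absurd (hd.matching _ _ _ (h _ _ _ _ _ _ hd hφ.attach_right) hx)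
      (hφ.not_mem x rfl _)

theorem ForcesMatching.boundsForest_pendant (h : ForcesMatching k G u) :
    BoundsForest k (pendant G u) (.inl ()) 0 := by
  intro W G' H K φ x hd hφ
  refine ⟨{φ (.inl ())}, by simp, by simp, fun a ha b hab => .inr ?_⟩
  obtain rfl := Finset.mem_singleton.1 ha
  rcases (hφ.adj_pendant_iff b).1 (hd.mono_left hab) with rfl | rfl
  · exact absurd (h _ _ _ _ _ _ hd hφ.attach_right) (hd.disj _ _ hab)
  · rfl

theorem ForcesForest.forcesForest_fork_fork (h₁ : ForcesForest k G₁ u₁ n)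
    (h₂ : ForcesForest k G₂ u₂ n) (hk : k ≤ 2 * n + 2) :
    ForcesForest k (fork G₁ u₁ (fork G₂ u₂ (⊥ : SimpleGraph Unit) ()) (.inl (.inl ())))
      (.inl (.inl ())) (n + 1) := by
  intro W G' H K φ x hd hφ
  obtain ⟨y₁, p₁, hp₁, hl₁, hs₁⟩ := h₁.exists_path_from hd hφ.fork_left
  obtain ⟨y₂, p₂, hp₂, hl₂, hs₂⟩ := h₂.exists_path_from hd hφ.fork_right.fork_left
  constructor
  · have hr := (hφ.adj_fork_iff _).2 (.inr (.inl rfl))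
    have hx : G'.Adj (φ (.inl (.inl ()))) x := (hφ.adj_fork_iff x).2 (.inr (.inr rfl))
    rcases (hd.adj_iff _ _).1 hx with hx | hx
    · exact hx.symm
    · rcases (hd.adj_iff _ _).1 hr with hr | hr
      · have := hd.add_length_lt p₁ p₂ hp₁ hp₂ hr (by
          intro w hw₁ hw₂
          rcases hs₁ w hw₁ with rfl | ⟨a, rfl⟩ <;> rcases hs₂ _ hw₂ with h | ⟨b, h⟩ <;>
            simpa using hφ.inj h)
        omega
      · exact absurd (hd.matching _ _ _ hr hx) (hφ.not_mem x rfl _)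
  · refine ⟨y₁, p₁, hp₁, hl₁, fun z hz => ?_⟩
    rcases hs₁ z hz with rfl | ⟨a, rfl⟩ <;> exact Set.mem_range_self _

end forcing

/-- The complete graph on four vertices without the edge joining `0` and `3`. -/
def diamond : SimpleGraph (Fin 4) where
  Adj a b := a ≠ b ∧ ¬ (a = 0 ∧ b = 3) ∧ ¬ (a = 3 ∧ b = 0)
  symm := ⟨by decide⟩
  loopless := ⟨by decide⟩

instance : DecidableRel diamond.Adj := fun a b =>
  inferInstanceAs (Decidable (a ≠ b ∧ ¬ (a = 0 ∧ b = 3) ∧ ¬ (a = 3 ∧ b = 0)))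

/-- A five-cycle `0, 1, 4, 3, 2` together with a vertex `5` adjacent to `3` and `4`. -/
def house : SimpleGraph (Fin 6) where
  Adj a b := s(a, b) ∈ [s(0, 1), s(0, 2), s(2, 3), s(1, 4), s(3, 4), s(3, 5), s(4, 5)]
  symm := ⟨by decide⟩
  loopless := ⟨by decide⟩

instance : DecidableRel house.Adj := fun a b => inferInstanceAs (Decidable
  (s(a, b) ∈ [s(0, 1), s(0, 2), s(2, 3), s(1, 4), s(3, 4), s(3, 5), s(4, 5)]))

namespace IsRootedEmbedding

variable {V W : Type} {G : SimpleGraph V} {u : V} {k : ℕ} {G' H K : SimpleGraph W} {φ : V → W}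
  {x : W}

theorem adj_or_adj (hφ : IsRootedEmbedding G u G' φ {x}) (hd : IsGraphDecomp k G' H K) {i j : V}
    (hij : G.Adj i j) : H.Adj (φ i) (φ j) ∨ K.Adj (φ i) (φ j) :=
  (hd.adj_iff _ _).1 ((hφ.adj_iff _ _).2 (.inl ⟨j, rfl, hij⟩))

theorem adj_root_or_adj_root (hφ : IsRootedEmbedding G u G' φ {x})
    (hd : IsGraphDecomp k G' H K) : H.Adj x (φ u) ∨ K.Adj (φ u) x := by
  rcases (hd.adj_iff _ _).1 ((hφ.adj_iff u x).2 (.inr ⟨rfl, rfl⟩)) with h | h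
  · exact .inl h.symm
  · exact .inr h

theorem adj_of_adj_of_ne (hφ : IsRootedEmbedding G u G' φ {x}) (hd : IsGraphDecomp k G' H K)
    {i j l : V} (hij : K.Adj (φ i) (φ j)) (hil : G.Adj i l) (hjl : j ≠ l) :
    H.Adj (φ i) (φ l) :=
  (hφ.adj_or_adj hd hil).resolve_right fun h => hjl (hφ.inj (hd.matching _ _ _ hij h))

theorem adj_of_adj_root (hφ : IsRootedEmbedding G u G' φ {x}) (hd : IsGraphDecomp k G' H K)
    {j : V} (hx : K.Adj (φ u) x) (huj : G.Adj u j) : H.Adj (φ u) (φ j) :=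
  (hφ.adj_or_adj hd huj).resolve_right fun h => hφ.not_mem x rfl j (hd.matching _ _ _ h hx)

theorem matching_adj_or (hφ : IsRootedEmbedding G u G' φ {x}) (hd : IsGraphDecomp k G' H K)
    {i j : V} (hx : H.Adj x (φ u)) (hui : G.Adj u i) (huj : G.Adj u j) (hij : i ≠ j) :
    K.Adj (φ u) (φ i) ∨ K.Adj (φ u) (φ j) := by
  by_contra! hK
  rcases hd.deg_le_two _ _ _ _ hx.symm ((hφ.adj_or_adj hd hui).resolve_right hK.1)
    ((hφ.adj_or_adj hd huj).resolve_right hK.2) with h | h | h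
  · exact hφ.not_mem x rfl i h.symm
  · exact hφ.not_mem x rfl j h.symm
  · exact hij (hφ.inj h)

end IsRootedEmbedding

theorem forcesForest_diamond (k : ℕ) : ForcesForest k diamond 0 3 := by
  intro W G' H K φ x hd hφ
  have hx : H.Adj x (φ 0) := by
    refine (hφ.adj_root_or_adj_root hd).resolve_right fun hx => ?_
    have h01 := hφ.adj_of_adj_root hd hx (show diamond.Adj 0 1 by decide)
    have h02 := hφ.adj_of_adj_root hd hx (show diamond.Adj 0 2 by decide)
    rcases hφ.adj_or_adj hd (show diamond.Adj 1 2 by decide) with h12 | h12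
    · exact hd.not_triangle h01 h12 h02.symm
    · have h13 := hφ.adj_of_adj_of_ne hd h12 (show diamond.Adj 1 3 by decide) (by decide)
      have h23 := hφ.adj_of_adj_of_ne hd h12.symm (show diamond.Adj 2 3 by decide) (by decide)
      exact hd.not_square h01 h13 h23.symm h02.symm (hφ.inj.ne (by decide))
        (hφ.inj.ne (by decide))
  have key : ∀ i j : Fin 4, diamond.Adj 0 i → diamond.Adj j i → diamond.Adj j 3 → j ≠ i →
      j ≠ 0 → i ≠ 3 → K.Adj (φ 0) (φ j) →
      ∃ (y : W) (p : H.Walk (φ 0) y), p.IsPath ∧ p.length = 3 ∧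
        ∀ z ∈ p.support, z ∈ Set.range φ := by
    intro i j h0i hji hj3 hne hj0 hi3 hK
    have h1 := hφ.adj_of_adj_of_ne hd hK h0i hne
    have h2 := hφ.adj_of_adj_of_ne hd hK.symm hji h0i.ne
    have h3 := hφ.adj_of_adj_of_ne hd hK.symm hj3 (by decide)
    refine ⟨_, .cons h1 (.cons h2.symm (.cons h3 .nil)), ?_, rfl, by simp⟩
    rw [Walk.isPath_def]
    simp [hφ.inj.eq_iff, h0i.ne, hne.symm, hj0.symm, hi3, hj3.ne]
  refine ⟨hx, ?_⟩
  rcases hφ.matching_adj_or hd hx (show diamond.Adj 0 1 by decide)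
    (show diamond.Adj 0 2 by decide) (by decide) with h | h
  · exact key 2 1 (by decide) (by decide) (by decide) (by decide) (by decide) (by decide) h
  · exact key 1 2 (by decide) (by decide) (by decide) (by decide) (by decide) (by decide) h

theorem hasTopRoot_diamond {k : ℕ} (hk : 3 ≤ k) : HasTopRoot k diamond 0 3 := by
  let H : SimpleGraph (Fin 4) :=
    ⟨fun a b => s(a, b) ∈ [s(0, 1), s(1, 2), s(2, 3)], ⟨by decide⟩, ⟨by decide⟩⟩
  let K : SimpleGraph (Fin 4) :=
    ⟨fun a b => s(a, b) ∈ [s(0, 2), s(1, 3)], ⟨by decide⟩, ⟨by decide⟩⟩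
  refine ⟨Unit, H, K, fun _ => (), fun a => 3 - a, ⟨?_, ?_, ?_, ?_, ?_, ?_⟩, rfl, by decide⟩
  · decide +revert
  · decide +revert
  · decide +revert
  · decide
  · intro a
    omega
  · decide +revert

theorem forcesForest_house : ForcesForest 3 house 0 1 := by
  intro W G' H K φ x hd hφ
  have hlt : ∀ {a b c d e : Fin 6}, H.Adj (φ a) (φ b) → H.Adj (φ b) (φ c) → H.Adj (φ c) (φ d) →
      H.Adj (φ d) (φ e) → ¬ [a, b, c, d, e].Nodup := by
    intro a b c d e hab hbc hcd hde hnd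
    exact absurd (hd.four_le hab hbc hcd hde (hnd.map hφ.inj)) (by decide)
  have hx : H.Adj x (φ 0) := by
    refine (hφ.adj_root_or_adj_root hd).resolve_right fun hx => ?_
    have h01 := hφ.adj_of_adj_root hd hx (show house.Adj 0 1 by decide)
    have h02 := hφ.adj_of_adj_root hd hx (show house.Adj 0 2 by decide)
    rcases hφ.adj_or_adj hd (show house.Adj 3 4 by decide) with h34 | h34
    · rcases hφ.adj_or_adj hd (show house.Adj 3 5 by decide) with h35 | h35
      · rcases hφ.adj_or_adj hd (show house.Adj 4 5 by decide) with h45 | h45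
        · exact hd.not_triangle h34 h45 h35.symm
        · have h41 := hφ.adj_of_adj_of_ne hd h45 (show house.Adj 4 1 by decide) (by decide)
          exact hlt h01 h41.symm h34.symm h35 (by decide)
      · have h32 := hφ.adj_of_adj_of_ne hd h35 (show house.Adj 3 2 by decide) (by decide)
        have h54 := hφ.adj_of_adj_of_ne hd h35.symm (show house.Adj 5 4 by decide) (by decide)
        exact hlt h02 h32.symm h34 h54.symm (by decide)
    · have h32 := hφ.adj_of_adj_of_ne hd h34 (show house.Adj 3 2 by decide) (by decide)
      have h35 := hφ.adj_of_adj_of_ne hd h34 (show house.Adj 3 5 by decide) (by decide)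
      have h41 := hφ.adj_of_adj_of_ne hd h34.symm (show house.Adj 4 1 by decide) (by decide)
      have h45 := hφ.adj_of_adj_of_ne hd h34.symm (show house.Adj 4 5 by decide) (by decide)
      exact hlt h32.symm h35 h45.symm h41 (by decide)
  have key : ∀ i : Fin 6, H.Adj (φ 0) (φ i) →
      ∃ (y : W) (p : H.Walk (φ 0) y), p.IsPath ∧ p.length = 1 ∧
        ∀ z ∈ p.support, z ∈ Set.range φ := fun i hi =>
    ⟨_, .cons hi .nil, by simp [Walk.isPath_def, hi.ne], rfl, by simp⟩
  refine ⟨hx, ?_⟩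
  rcases hφ.matching_adj_or hd hx (show house.Adj 0 1 by decide)
    (show house.Adj 0 2 by decide) (by decide) with h | h
  · exact key 2 (hφ.adj_of_adj_of_ne hd h (by decide) (by decide))
  · exact key 1 (hφ.adj_of_adj_of_ne hd h (by decide) (by decide))

theorem hasTopRoot_house : HasTopRoot 3 house 0 1 := by
  let H : SimpleGraph (Fin 6) :=
    ⟨fun a b => s(a, b) ∈ [s(0, 1), s(2, 3), s(3, 4), s(4, 5)], ⟨by decide⟩, ⟨by decide⟩⟩
  let K : SimpleGraph (Fin 6) :=
    ⟨fun a b => s(a, b) ∈ [s(0, 2), s(1, 4), s(3, 5)], ⟨by decide⟩, ⟨by decide⟩⟩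
  refine ⟨Bool, H, K, ![true, true, false, false, false, false], ![1, 0, 0, 1, 2, 3],
    ⟨?_, ?_, ?_, ?_, ?_, ?_⟩, rfl, by decide⟩
  · decide +revert
  · decide +revert
  · decide +revert
  · decide
  · decide
  · decide +revert

theorem exists_forcesMatching_of_forcesForest {k n : ℕ} (hn : n + 1 ≤ k)
    (h : ∃ (V : Type) (_ : Fintype V) (G : SimpleGraph V) (u : V),
      ForcesForest k G u n ∧ HasTopRoot k G u n) :
    ∃ (V : Type) (_ : Fintype V) (G : SimpleGraph V) (u : V),
      ForcesMatching k G u ∧ HasFreeRoot k G u := by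
  induction hm : k - (n + 1) generalizing n with
  | zero =>
    obtain ⟨V, _, G, u, hF, hT⟩ := h
    exact ⟨_, inferInstance, pendant G u, .inl (), hF.forcesMatching_pendant (by omega),
      (hasFreeTopRoot_single.exists_attach hT (by omega)).1⟩
  | succ m ih =>
    obtain ⟨V, _, G, u, hF, hT⟩ := h
    have hP := (hasFreeTopRoot_single.exists_attach hT (by omega)).2 rfl
    by_cases hk : 2 * (n + 1) ≤ k
    · exact ⟨_, inferInstance, fork G u G u, .inl (.inl ()), hF.forcesMatching_fork hF,
        (hP.exists_attach hT (by omega)).1⟩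
    · exact ih (n := n + 1) (by omega) ⟨_, inferInstance, _, _,
        hF.forcesForest_fork_fork hF (by omega), hP.attach_of_hasFreeRoot
          (hP.exists_attach hasFreeTopRoot_single.hasTopRoot (by omega)).1⟩ (by omega)

theorem exists_forcesMatching {k : ℕ} (hk : 3 ≤ k) :
    ∃ (V : Type) (_ : Fintype V) (G : SimpleGraph V) (u : V),
      ForcesMatching k G u ∧ HasFreeRoot k G u := by
  rcases hk.eq_or_lt with rfl | hk
  · exact exists_forcesMatching_of_forcesForest (n := 1) (by decide)
      ⟨_, inferInstance, house, 0, forcesForest_house, hasTopRoot_house⟩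
  · exact exists_forcesMatching_of_forcesForest (n := 3) (by omega)
      ⟨_, inferInstance, diamond, 0, forcesForest_diamond k, hasTopRoot_diamond hk.le⟩

theorem exists_forcesForest_boundsForest {k n : ℕ} (hk : 3 ≤ k) (hn : n ≤ k) :
    ∃ (V : Type) (_ : Fintype V) (G : SimpleGraph V) (u : V),
      ForcesForest k G u n ∧ BoundsForest k G u n ∧ HasTopRoot k G u n := by
  obtain ⟨V₀, _, G₀, u₀, hM, hfree⟩ := exists_forcesMatching hk
  induction n with
  | zero =>
    exact ⟨_, inferInstance, pendant G₀ u₀, .inl (), hM.forcesForest_pendant,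
      hM.boundsForest_pendant, hasFreeTopRoot_single.attach_of_hasFreeRoot hfree⟩
  | succ n ih =>
    obtain ⟨V, _, G, u, hF, hB, hT⟩ := ih (by omega)
    exact ⟨_, inferInstance, fork G u G₀ u₀, .inl (.inl ()), hF.fork_forcesMatching hM,
      hB.fork_forcesMatching hM,
      ((hasFreeTopRoot_single.exists_attach hT (by omega)).2 rfl).attach_of_hasFreeRoot hfree⟩

/-- For all integers `k ≥ 3` and `1 ≤ ℓ ≤ k` there is a finite simple graph `G`
with a vertex `v` of degree 1 such that `G` admits a decomposition into a `k`-bounded linear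
forest and a matching, and for every such decomposition `(F, M)`, the vertex `v` lies on a path
with exactly `ℓ` edges all of whose edges lie in `F`, and on no path with `ℓ+1` edges all of
whose edges lie in `F`.  (An `(ℓF,k)`-forcer exists.) -/
theorem ellFForcer_exists (k ℓ : ℕ) (hk : 3 ≤ k) (hℓ₁ : 1 ≤ ℓ) (hℓk : ℓ ≤ k) :
    ∃ (V : Type) (_ : Fintype V) (G : SimpleGraph V) (v : V) (e : Sym2 V),
      e ∈ G.edgeSet ∧ v ∈ e ∧ (∀ f ∈ G.edgeSet, v ∈ f → f = e) ∧
      (∃ F M : Set (Sym2 V), IsMLFDecomp G k F M) ∧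
      (∀ F M : Set (Sym2 V), IsMLFDecomp G k F M →
        (∃ (u w : V) (p : (SimpleGraph.fromEdgeSet F).Walk u w),
          p.IsPath ∧ p.length = ℓ ∧ v ∈ p.support) ∧
        ¬ ∃ (u w : V) (p : (SimpleGraph.fromEdgeSet F).Walk u w),
          p.IsPath ∧ p.length = ℓ + 1 ∧ v ∈ p.support) := by
  classical
  obtain ⟨n, rfl⟩ : ∃ n, ℓ = n + 1 := ⟨ℓ - 1, by omega⟩
  obtain ⟨V, _, G, u, hF, hB, hT⟩ := exists_forcesForest_boundsForest (n := n) hk (by omega)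
  have hpend : ∀ w, (pendant G u).Adj (.inl ()) w → w = .inr u := by
    rintro (w | w) <;> simp
  refine ⟨_, inferInstance, pendant G u, .inl (), s(.inl (), .inr u), by simp, by simp,
    fun f hf hv => ?_, ?_, fun F M hFM => ?_⟩
  · obtain ⟨w, rfl⟩ := Sym2.mem_iff_exists.1 hv
    rw [hpend w hf]
  · obtain ⟨ι, H, K, idx, pos, hd, -⟩ := (hasFreeTopRoot_single.exists_attach hT (by omega)).1
    exact ⟨_, _, hd.isMLFDecomp⟩
  · have hd := hFM.isGraphDecomp
    have hφ := isRootedEmbedding_inr_attach G u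
    constructor
    · obtain ⟨y, p, hp, hl, -⟩ := hF.exists_path_from hd hφ
      exact ⟨_, y, p, hp, hl, p.start_mem_support⟩
    · rintro ⟨a, b, p, hp, hl, hv⟩
      obtain ⟨S, hu, hc, hS⟩ := hB _ _ _ _ _ _ hd hφ
      set T : Finset (Unit ⊕ V) := insert (.inl ()) S with hTdef
      have hclosed : ∀ a b, (fromEdgeSet F).Adj a b → a ∈ T → b ∈ T := by
        intro a b hab ha
        rcases Finset.mem_insert.1 ha with rfl | ha
        · rw [hpend b (hd.mono_left hab)]
          exact Finset.mem_insert_of_mem hu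
        · rcases hS a ha b hab with h | h <;> simp [hTdef, h]
      have hsupp := apply_eq_of_mem_support (· ∈ T)
        (fun a b hab => propext ⟨hclosed a b hab, hclosed b a hab.symm⟩) p
      have hsub : p.support.toFinset ⊆ T := by
        intro z hz
        have h := (hsupp z (List.mem_toFinset.1 hz)).trans (hsupp _ hv).symm
        exact h.mpr (Finset.mem_insert_self _ _)
      have hcard := Finset.card_le_card hsub
      rw [List.toFinset_card_of_nodup hp.support_nodup, Walk.length_support, hl] at hcard
      have hT' : T.card ≤ S.card + 1 := Finset.card_insert_le _ _
      omega
end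

section
/- For every integer k ≥ 3 there exists a finite simple graph O together with three distinct vertices p₁, p₂, o, each of degree 1 in O, with incident edges e₁, e₂, f respectively, such that: (i) for every partition of the two-element set {e₁, e₂} into sets F̃ and M̃, there exists a partition (F, M) of the edge set of O into a k-bounded linear forest F and a matching M with F̃ ⊆ F and M̃ ⊆ M; (ii) for every partition (F, M) of the edge set of O into a k-bounded linear forest F and a matching M in which e₁ ∈ M and e₂ ∈ M, one has f ∈ M; and (iii) for every partition (F, M) of the edge set of O into a k-bounded linear forest F and a matching M in which e₁ ∈ F or e₂ ∈ F, one has f ∈ F. -/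
namespace ORGadget

open SimpleGraph

/-- Rooted trees in which every node has at most two children; `nil` is the empty tree.
A node may carry a tag, which marks it as an input. -/
inductive Tree : Type
  | nil : Tree
  | node (tag : Option Bool) (a b : Tree) : Tree

namespace Tree

/-- The nodes of a tree. -/
def Vert : Tree → Type
  | nil => Empty
  | node _ a b => Option (Vert a ⊕ Vert b)

instance instFintypeVert : (t : Tree) → Fintype t.Vert
  | nil => inferInstanceAs (Fintype Empty)
  | node _ a b =>
    letI := instFintypeVert a
    letI := instFintypeVert b
    inferInstanceAs (Fintype (Option (a.Vert ⊕ b.Vert)))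

/-- The root of a nonempty tree. -/
def rootV {g : Option Bool} {a b : Tree} : (node g a b).Vert := (none : Option (a.Vert ⊕ b.Vert))

/-- The node of the left subtree, as a node of the whole tree. -/
def inL {g : Option Bool} {a b : Tree} (c : a.Vert) : (node g a b).Vert :=
  (some (Sum.inl c) : Option (a.Vert ⊕ b.Vert))

/-- The node of the right subtree, as a node of the whole tree. -/
def inR {g : Option Bool} {a b : Tree} (c : b.Vert) : (node g a b).Vert :=
  (some (Sum.inr c) : Option (a.Vert ⊕ b.Vert))

lemma vert_cases {g : Option Bool} {a b : Tree} (c : (node g a b).Vert) :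
    c = rootV ∨ (∃ d, c = inL d) ∨ ∃ d, c = inR d := by
  rcases c with _ | c | c
  · exact Or.inl rfl
  · exact Or.inr (Or.inl ⟨c, rfl⟩)
  · exact Or.inr (Or.inr ⟨c, rfl⟩)

section

variable {g : Option Bool} {a b : Tree}

@[simp] lemma inL_inj {c d : a.Vert} : (inL c : (node g a b).Vert) = inL d ↔ c = d :=
  ⟨fun h => Sum.inl.inj (Option.some.inj h), congrArg _⟩
@[simp] lemma inR_inj {c d : b.Vert} : (inR c : (node g a b).Vert) = inR d ↔ c = d :=
  ⟨fun h => Sum.inr.inj (Option.some.inj h), congrArg _⟩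
@[simp] lemma inL_ne_inR {c : a.Vert} {d : b.Vert} : (inL c : (node g a b).Vert) ≠ inR d := by
  change (some (Sum.inl c) : Option (a.Vert ⊕ b.Vert)) ≠ some (Sum.inr d)
  simp
@[simp] lemma inR_ne_inL {c : b.Vert} {d : a.Vert} : (inR c : (node g a b).Vert) ≠ inL d := by
  change (some (Sum.inr c) : Option (a.Vert ⊕ b.Vert)) ≠ some (Sum.inl d)
  simp
@[simp] lemma inL_ne_rootV {c : a.Vert} : (inL c : (node g a b).Vert) ≠ rootV :=
  Option.some_ne_none _
@[simp] lemma inR_ne_rootV {c : b.Vert} : (inR c : (node g a b).Vert) ≠ rootV :=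
  Option.some_ne_none _
@[simp] lemma rootV_ne_inL {c : a.Vert} : (rootV : (node g a b).Vert) ≠ inL c :=
  (Option.some_ne_none _).symm
@[simp] lemma rootV_ne_inR {c : b.Vert} : (rootV : (node g a b).Vert) ≠ inR c :=
  (Option.some_ne_none _).symm

end

/-- The parent of a node, `none` for the root. -/
def up : (t : Tree) → t.Vert → Option t.Vert
  | nil => fun _ => none
  | node _ a b => fun c => match (c : Option (a.Vert ⊕ b.Vert)) with
    | none => none
    | some (Sum.inl d) => some (((up a d).map Sum.inl : Option (a.Vert ⊕ b.Vert)))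
    | some (Sum.inr d) => some (((up b d).map Sum.inr : Option (a.Vert ⊕ b.Vert)))

/-- The tag of a node. -/
def tag : (t : Tree) → t.Vert → Option Bool
  | nil => fun _ => none
  | node g a b => fun c => match (c : Option (a.Vert ⊕ b.Vert)) with
    | none => g
    | some (Sum.inl d) => tag a d
    | some (Sum.inr d) => tag b d

/-- The inclusion of the left subtree, planted at the root, into the planted tree. -/
def plantL {g : Option Bool} {a b : Tree} : Option a.Vert → Option (node g a b).Vert
  | none => some rootV
  | some c => some (inL c)

/-- The inclusion of the right subtree, planted at the root, into the planted tree. -/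
def plantR {g : Option Bool} {a b : Tree} : Option b.Vert → Option (node g a b).Vert
  | none => some rootV
  | some c => some (inR c)

section

variable {g : Option Bool} {a b : Tree}

@[simp] lemma plantL_none : (plantL none : Option (node g a b).Vert) = some rootV := rfl
@[simp] lemma plantR_none : (plantR none : Option (node g a b).Vert) = some rootV := rfl
@[simp] lemma plantL_some (c : a.Vert) :
    (plantL (some c) : Option (node g a b).Vert) = some (inL c) := rfl
@[simp] lemma plantR_some (c : b.Vert) :
    (plantR (some c) : Option (node g a b).Vert) = some (inR c) := rfl

lemma plantL_injective : Function.Injective (plantL : _ → Option (node g a b).Vert) := by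
  rintro (_ | c) (_ | d) <;> simp

lemma plantR_injective : Function.Injective (plantR : _ → Option (node g a b).Vert) := by
  rintro (_ | c) (_ | d) <;> simp

@[simp] lemma up_rootV : (node g a b).up rootV = none := rfl

@[simp] lemma up_inL (c : a.Vert) : (node g a b).up (inL c) = plantL (a.up c) := by
  change some ((a.up c).map Sum.inl : Option (a.Vert ⊕ b.Vert)) = _
  rcases a.up c with _ | d <;> rfl

@[simp] lemma up_inR (c : b.Vert) : (node g a b).up (inR c) = plantR (b.up c) := by
  change some ((b.up c).map Sum.inr : Option (a.Vert ⊕ b.Vert)) = _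
  rcases b.up c with _ | d <;> rfl

@[simp] lemma tag_rootV : (node g a b).tag rootV = g := rfl
@[simp] lemma tag_inL (c : a.Vert) : (node g a b).tag (inL c) = a.tag c := rfl
@[simp] lemma tag_inR (c : b.Vert) : (node g a b).tag (inR c) = b.tag c := rfl

end

lemma eq_of_up_eq_none : ∀ (t : Tree) (c d : t.Vert), t.up c = none → t.up d = none → c = d
  | nil, c, _, _, _ => nomatch (c : Empty)
  | node g a b, c, d, hc, hd => by
    rcases vert_cases c with rfl | ⟨c, rfl⟩ | ⟨c, rfl⟩ <;>
    rcases vert_cases d with rfl | ⟨d, rfl⟩ | ⟨d, rfl⟩ <;>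
    simp at hc hd ⊢ <;>
    first
    | (rcases h : a.up c <;> simp [h] at hc)
    | (rcases h : b.up c <;> simp [h] at hc)
    | (rcases h : a.up d <;> simp [h] at hd)
    | (rcases h : b.up d <;> simp [h] at hd)

lemma up_ne_of_up_eq : ∀ (t : Tree) (c d : t.Vert), t.up c = some d → t.up d ≠ some c
  | nil, c, _, _ => nomatch (c : Empty)
  | node g a b, c, d, hc => by
    intro hd
    rcases vert_cases c with rfl | ⟨c, rfl⟩ | ⟨c, rfl⟩ <;>
    rcases vert_cases d with rfl | ⟨d, rfl⟩ | ⟨d, rfl⟩ <;>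
    simp at hc hd
    · rcases h : a.up c with _ | e <;> rcases h2 : a.up d with _ | e' <;> simp [h, h2] at hc hd
      subst hc hd
      exact up_ne_of_up_eq a _ _ h h2
    · rcases h : a.up c with _ | e <;> simp [h] at hc
    · rcases h : b.up c with _ | e <;> simp [h] at hc
    · rcases h : b.up c with _ | e <;> rcases h2 : b.up d with _ | e' <;> simp [h, h2] at hc hd
      subst hc hd
      exact up_ne_of_up_eq b _ _ h h2

/-- The edge joining a node to its parent, in the planted tree. -/
def edge (t : Tree) (c : t.Vert) : Sym2 (Option t.Vert) := s(some c, t.up c)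

lemma edge_injective (t : Tree) : Function.Injective t.edge := by
  intro c d h
  simp only [edge, Sym2.eq_iff] at h
  rcases h with ⟨h, -⟩ | ⟨h1, h2⟩
  · simpa using h
  · exact absurd h1.symm (up_ne_of_up_eq t c d h2)

/-- The planted tree: the tree together with an extra vertex `none` joined to the root. -/
def graph (t : Tree) : SimpleGraph (Option t.Vert) where
  Adj u v := ∃ c, t.edge c = s(u, v)
  symm := ⟨fun u v ⟨c, h⟩ => ⟨c, h.trans Sym2.eq_swap⟩⟩
  loopless := ⟨fun u ⟨c, h⟩ => by
    simp only [edge, Sym2.eq_iff, or_self] at h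
    exact up_ne_of_up_eq t c c (h.2.trans h.1.symm) (h.2.trans h.1.symm)⟩

lemma mem_edgeSet_graph (t : Tree) (e : Sym2 (Option t.Vert)) :
    e ∈ t.graph.edgeSet ↔ ∃ c, t.edge c = e := by
  induction e with
  | h u v => rfl

/-- `t.Can k x m l` says that the planted tree has a decomposition, compatible with the values `x`
of the inputs, whose edge above the root lies in the matching if `m` is true, and otherwise
begins a downward path of the linear forest that has length `l`. -/
def Can (k : ℕ) (x : Bool → Bool) : Tree → Bool → ℕ → Prop
  | nil => fun m l => m = false ∧ l = 0
  | node g a b => fun m l => (∀ i, g = some i → x i = !m) ∧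
      ∃ ma la mb lb, Can k x a ma la ∧ Can k x b mb lb ∧ ¬ (ma = true ∧ mb = true) ∧
        ((m = true ∧ l = 0 ∧ ma = false ∧ mb = false ∧ la + lb ≤ k) ∨
          (m = false ∧ (la = 0 ∨ lb = 0) ∧ l = la + lb + 1 ∧ l ≤ k))

end Tree

/-- The graph `H` has a non-backtracking walk of length `l` that starts with the edge from `u`
to `v`. -/
def Tail {W : Type} (H : SimpleGraph W) (l : ℕ) (u v : W) : Prop :=
  ∃ (w : W) (h : H.Adj u v) (q : H.Walk v w),
    (Walk.cons h q).edges.IsChain (· ≠ ·) ∧ q.length + 1 = l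

namespace Tail

variable {W : Type} {H : SimpleGraph W} {l m k : ℕ} {u v c d : W}

lemma adj (h : Tail H l u v) : H.Adj u v := by
  obtain ⟨_, h, _⟩ := h; exact h

lemma pos (h : Tail H l u v) : 0 < l := by
  obtain ⟨_, _, q, _, h⟩ := h; omega

lemma single (h : H.Adj u v) : Tail H 1 u v := ⟨v, h, Walk.nil, by simp, rfl⟩

lemma cons (h : Tail H l v c) (huv : H.Adj u v) (huc : u ≠ c) : Tail H (l + 1) u v := by
  obtain ⟨w, hvc, q, hq, rfl⟩ := h
  refine ⟨w, huv, Walk.cons hvc q, ?_, rfl⟩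
  rw [Walk.edges_cons, Walk.edges_cons, List.isChain_cons_cons]
  refine ⟨?_, hq⟩
  simp only [ne_eq, Sym2.eq_iff]
  rintro (⟨rfl, rfl⟩ | ⟨h, -⟩)
  · exact huv.ne rfl
  · exact huc h

lemma le (h : Tail H l u v) (hH : H.IsAcyclic)
    (hk : ∀ (u w : W) (p : H.Walk u w), p.IsPath → p.length ≤ k) : l ≤ k := by
  obtain ⟨w, hvc, q, hq, rfl⟩ := h
  exact hk _ _ _ ((hH.isPath_iff_isChain _).2 hq)

lemma add_le (h : Tail H l v c) (h' : Tail H m v d) (hcd : c ≠ d) (hH : H.IsAcyclic)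
    (hk : ∀ (u w : W) (p : H.Walk u w), p.IsPath → p.length ≤ k) : l + m ≤ k := by
  obtain ⟨w, hvc, q, hq, rfl⟩ := h
  obtain ⟨w', hvd, q', hq', rfl⟩ := h'
  have := hk _ _ ((Walk.cons hvc q).reverse.append (Walk.cons hvd q')) <| by
    rw [hH.isPath_iff_isChain, Walk.edges_append, Walk.edges_reverse, List.isChain_append]
    refine ⟨List.isChain_reverse.2 (hq.imp fun _ _ h => h.symm), hq', ?_⟩
    simp only [Walk.edges_cons, List.reverse_cons, List.getLast?_append, List.getLast?_singleton,
      Option.some_or, Option.mem_def, Option.some.injEq, List.head?_cons]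
    rintro _ rfl _ rfl h
    simp only [Sym2.eq_iff] at h
    rcases h with ⟨-, h⟩ | ⟨rfl, h⟩
    · exact hcd h
    · exact hvd.ne rfl
  simpa [Walk.length_append] using this

end Tail

namespace Tree

lemma exists_can_of_decomp {W : Type} [Finite W] {G : SimpleGraph W} {k : ℕ} {F M : Set (Sym2 W)}
    (h : IsMLFDecomp G k F M) (x : Bool → Bool) :
    ∀ (t : Tree) (φ : Option t.Vert → W), Function.Injective φ →
      (∀ c, G.Adj (φ (some c)) (φ (t.up c))) →
      (∀ c i, t.tag c = some i → (x i = true ↔ s(φ (some c), φ (t.up c)) ∈ F)) →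
      ∃ m l, t.Can k x m l ∧ (m = true → ∃ r, s(φ none, φ (some r)) ∈ M) ∧
        (0 < l → ∃ r, Tail (fromEdgeSet F) l (φ none) (φ (some r)))
  | nil, φ, _, _, _ => ⟨false, 0, ⟨rfl, rfl⟩, by simp, by simp⟩
  | node g a b, φ, hφ, hadj, hx => by
    obtain ⟨ma, la, hca, hMa, hFa⟩ := exists_can_of_decomp h x a (φ ∘ plantL)
      (hφ.comp plantL_injective) (fun c => by simpa using hadj (inL c))
      (fun c i hc => by simpa using hx (inL c) i hc)
    obtain ⟨mb, lb, hcb, hMb, hFb⟩ := exists_can_of_decomp h x b (φ ∘ plantR)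
      (hφ.comp plantR_injective) (fun c => by simpa using hadj (inR c))
      (fun c i hc => by simpa using hx (inR c) i hc)
    obtain ⟨hFM, hdisj, ⟨-, hac, hdeg, hlen⟩, -, hM⟩ := h
    have hroot := hadj rootV
    have hxr := hx rootV
    simp only [Function.comp, plantL_none, plantL_some, plantR_none, plantR_some, up_rootV,
      tag_rootV] at hMa hFa hMb hFb hroot hxr
    have hM' : ∀ v c d, s(v, c) ∈ M → s(v, d) ∈ M → c = d := by
      intro v c d hc hd
      by_contra hne
      exact hM _ hc _ hd (fun h => hne (Sym2.congr_right.1 h)) v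
        (Sym2.mem_mk_left _ _) (Sym2.mem_mk_left _ _)
    have hF' : ∀ v c d e, s(v, c) ∈ F → s(v, d) ∈ F → s(v, e) ∈ F → c ≠ d → c ≠ e → d ≠ e →
        False := by
      intro v c d e hc hd he hcd hce hde
      have h3 : ({s(v, c), s(v, d), s(v, e)} : Set (Sym2 W)).ncard = 3 := by
        rw [Set.ncard_eq_three]
        refine ⟨_, _, _, ?_, ?_, ?_, rfl⟩ <;> rwa [ne_eq, Sym2.congr_right]
      have := Set.ncard_le_ncard (s := {s(v, c), s(v, d), s(v, e)}) (t := {e ∈ F | v ∈ e})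
        (by
          rintro _ (rfl | rfl | rfl)
          exacts [⟨hc, Sym2.mem_mk_left _ _⟩, ⟨hd, Sym2.mem_mk_left _ _⟩,
            ⟨he, Sym2.mem_mk_left _ _⟩]) (Set.toFinite _)
      have := hdeg v
      omega
    have hu : ∀ c, φ none ≠ φ (some c) := fun c h => by simpa using hφ h
    have hab : ∀ c d, φ (some (inL c)) ≠ φ (some (inR d)) := fun c d h => by simpa using hφ h
    have hnab : ¬ (ma = true ∧ mb = true) := by
      rintro ⟨h1, h2⟩
      obtain ⟨r, hr⟩ := hMa h1
      obtain ⟨r', hr'⟩ := hMb h2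
      exact hab _ _ (hM' _ _ _ hr hr')
    have hmem : s(φ (some rootV), φ none) ∈ F ∨ s(φ (some rootV), φ none) ∈ M := by
      rw [← Set.mem_union, hFM]; exact hroot
    have hsw : s(φ none, φ (some (rootV : (node g a b).Vert))) = s(φ (some rootV), φ none) :=
      Sym2.eq_swap
    rcases hmem with hF | hm
    · have hadjF : (fromEdgeSet F).Adj (φ none) (φ (some (rootV : (node g a b).Vert))) := by
        rw [fromEdgeSet_adj, hsw]; exact ⟨hF, hu _⟩
      have h0 : la = 0 ∨ lb = 0 := by
        by_contra hcon
        obtain ⟨r, hr⟩ := hFa (by omega)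
        obtain ⟨r', hr'⟩ := hFb (by omega)
        exact hF' _ _ _ _ hF ((fromEdgeSet_adj _).1 hr.adj).1 ((fromEdgeSet_adj _).1 hr'.adj).1
          (hu _) (hu _) (hab _ _)
      have hT : Tail (fromEdgeSet F) (la + lb + 1) (φ none) (φ (some rootV)) := by
        rcases Nat.eq_zero_or_pos la with rfl | ha
        · rcases Nat.eq_zero_or_pos lb with rfl | hb
          · exact Tail.single hadjF
          · obtain ⟨r, hr⟩ := hFb hb
            rw [Nat.zero_add]
            exact hr.cons hadjF (hu _)
        · obtain rfl : lb = 0 := by omega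
          obtain ⟨r, hr⟩ := hFa ha
          exact hr.cons hadjF (hu _)
      refine ⟨false, la + lb + 1, ⟨?_, ma, la, mb, lb, hca, hcb, hnab,
        Or.inr ⟨rfl, h0, rfl, hT.le hac hlen⟩⟩, by simp, fun _ => ⟨_, hT⟩⟩
      intro i hi
      simpa using (hxr i hi).2 hF
    · have hma : ma = false := by
        by_contra hcon
        obtain ⟨r, hr⟩ := hMa (by simpa using hcon)
        exact hu _ (hM' _ _ _ hm hr)
      have hmb : mb = false := by
        by_contra hcon
        obtain ⟨r, hr⟩ := hMb (by simpa using hcon)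
        exact hu _ (hM' _ _ _ hm hr)
      have hle : la + lb ≤ k := by
        rcases Nat.eq_zero_or_pos la with rfl | ha
        · rcases Nat.eq_zero_or_pos lb with rfl | hb
          · simp
          · obtain ⟨r, hr⟩ := hFb hb
            rw [Nat.zero_add]
            exact hr.le hac hlen
        · obtain ⟨r, hr⟩ := hFa ha
          rcases Nat.eq_zero_or_pos lb with rfl | hb
          · exact hr.le hac hlen
          · obtain ⟨r', hr'⟩ := hFb hb
            exact hr.add_le hr' (hab _ _) hac hlen
      refine ⟨true, 0, ⟨?_, ma, la, mb, lb, hca, hcb, hnab,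
        Or.inl ⟨rfl, rfl, hma, hmb, hle⟩⟩, fun _ => ⟨rootV, hsw ▸ hm⟩, by simp⟩
      intro i hi
      have : ¬ s(φ (some rootV), φ none) ∈ F := fun hF => Set.disjoint_left.1 hdisj hF hm
      simpa using fun hx => this ((hxr i hi).1 hx)

/-- A labelling of the edges of a planted tree by matching (`true`) and forest (`false`), with
positions of the vertices along the paths of the forest. -/
structure Valid (k : ℕ) (t : Tree) (μ : t.Vert → Bool) (pos : Option t.Vert → ℤ) : Prop where
  nonneg : ∀ v, 0 ≤ pos v
  le : ∀ v, pos v ≤ k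
  step : ∀ c, μ c = false → pos (some c) = pos (t.up c) + 1 ∨ pos (some c) = pos (t.up c) - 1
  updown : ∀ c d, μ c = false → μ d = false → t.up d = some c → pos (some d) ≠ pos (t.up c)
  siblings : ∀ c d, μ c = false → μ d = false → t.up c = t.up d → pos (some c) = pos (some d) →
    c = d
  updownM : ∀ c d, μ c = true → t.up d = some c → μ d = false
  siblingsM : ∀ c d, μ c = true → μ d = true → t.up c = t.up d → c = d

/-- Combine labellings of the two subtrees and of the root. -/
def glue {α : Type} {g : Option Bool} {a b : Tree} (z : α) (f : a.Vert → α) (h : b.Vert → α) :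
    (node g a b).Vert → α := fun c => match (c : Option (a.Vert ⊕ b.Vert)) with
    | none => z
    | some (Sum.inl d) => f d
    | some (Sum.inr d) => h d

section

variable {α : Type} {g : Option Bool} {a b : Tree} (z : α) (f : a.Vert → α) (h : b.Vert → α)

@[simp] lemma glue_rootV : glue z f h (rootV : (node g a b).Vert) = z := rfl
@[simp] lemma glue_inR (c : b.Vert) : glue z f h (inR c : (node g a b).Vert) = h c := rfl

/-- Combine positions in the two planted subtrees with the position of the planting vertex. -/
def gluePos (p q : α) (f : Option a.Vert → α) (h : Option b.Vert → α) :
    Option (node g a b).Vert → α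
  | none => p
  | some c => glue q (f ∘ some) (h ∘ some) c

variable (p q : α) (f : Option a.Vert → α) (h : Option b.Vert → α)

@[simp] lemma gluePos_rootV :
    gluePos p q f h (some rootV : Option (node g a b).Vert) = q := rfl
@[simp] lemma gluePos_inL (c : a.Vert) :
    gluePos p q f h (some (inL c) : Option (node g a b).Vert) = f (some c) := rfl
@[simp] lemma gluePos_inR (c : b.Vert) :
    gluePos p q f h (some (inR c) : Option (node g a b).Vert) = h (some c) := rfl

lemma gluePos_plantL (hf : f none = q) (v : Option a.Vert) :
    gluePos p q f h (plantL v : Option (node g a b).Vert) = f v := by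
  rcases v with _ | c
  · exact hf.symm
  · rfl

lemma gluePos_plantR (hh : h none = q) (v : Option b.Vert) :
    gluePos p q f h (plantR v : Option (node g a b).Vert) = h v := by
  rcases v with _ | c
  · exact hh.symm
  · rfl

@[simp] lemma plantL_eq_inL (v : Option a.Vert) (c : a.Vert) :
    (plantL v : Option (node g a b).Vert) = some (inL c) ↔ v = some c :=
  plantL_injective.eq_iff' rfl

@[simp] lemma plantR_eq_inR (v : Option b.Vert) (c : b.Vert) :
    (plantR v : Option (node g a b).Vert) = some (inR c) ↔ v = some c :=
  plantR_injective.eq_iff' rfl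

@[simp] lemma plantL_eq_rootV (v : Option a.Vert) :
    (plantL v : Option (node g a b).Vert) = some rootV ↔ v = none :=
  plantL_injective.eq_iff' rfl

@[simp] lemma plantR_eq_rootV (v : Option b.Vert) :
    (plantR v : Option (node g a b).Vert) = some rootV ↔ v = none :=
  plantR_injective.eq_iff' rfl

@[simp] lemma plantL_ne_inR (v : Option a.Vert) (c : b.Vert) :
    (plantL v : Option (node g a b).Vert) ≠ some (inR c) := by
  rcases v with _ | d <;> simp

@[simp] lemma plantR_ne_inL (v : Option b.Vert) (c : a.Vert) :
    (plantR v : Option (node g a b).Vert) ≠ some (inL c) := by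
  rcases v with _ | d <;> simp

@[simp] lemma plantL_ne_none (v : Option a.Vert) :
    (plantL v : Option (node g a b).Vert) ≠ none := by
  rcases v with _ | d <;> simp

@[simp] lemma plantR_ne_none (v : Option b.Vert) :
    (plantR v : Option (node g a b).Vert) ≠ none := by
  rcases v with _ | d <;> simp

@[simp] lemma none_ne_plantL (v : Option a.Vert) :
    none ≠ (plantL v : Option (node g a b).Vert) := (plantL_ne_none v).symm

@[simp] lemma none_ne_plantR (v : Option b.Vert) :
    none ≠ (plantR v : Option (node g a b).Vert) := (plantR_ne_none v).symm

@[simp] lemma plantL_eq_plantL (v w : Option a.Vert) :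
    (plantL v : Option (node g a b).Vert) = plantL w ↔ v = w := plantL_injective.eq_iff

@[simp] lemma plantR_eq_plantR (v w : Option b.Vert) :
    (plantR v : Option (node g a b).Vert) = plantR w ↔ v = w := plantR_injective.eq_iff

@[simp] lemma plantL_eq_plantR (v : Option a.Vert) (w : Option b.Vert) :
    (plantL v : Option (node g a b).Vert) = plantR w ↔ v = none ∧ w = none := by
  rcases v with _ | d <;> rcases w with _ | e <;> simp

@[simp] lemma plantR_eq_plantL (v : Option b.Vert) (w : Option a.Vert) :
    (plantR v : Option (node g a b).Vert) = plantL w ↔ v = none ∧ w = none := by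
  rcases v with _ | d <;> rcases w with _ | e <;> simp

end

lemma Valid.glue {k : ℕ} {g : Option Bool} {a b : Tree} {μa : a.Vert → Bool} {μb : b.Vert → Bool}
    {pa : Option a.Vert → ℤ} {pb : Option b.Vert → ℤ} {m : Bool} {p q : ℤ}
    (ha : Valid k a μa pa) (hb : Valid k b μb pb) (hqa : pa none = q) (hqb : pb none = q)
    (hp0 : 0 ≤ p) (hpk : p ≤ k) (hq0 : 0 ≤ q) (hqk : q ≤ k)
    (hstep : m = false → q = p + 1 ∨ q = p - 1)
    (hma : ∀ c, a.up c = none → m = true → μa c = false)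
    (hmb : ∀ c, b.up c = none → m = true → μb c = false)
    (hmab : ∀ c d, a.up c = none → b.up d = none → μa c = true → μb d = false)
    (hpa : ∀ c, a.up c = none → m = false → μa c = false → pa (some c) ≠ p)
    (hpb : ∀ c, b.up c = none → m = false → μb c = false → pb (some c) ≠ p)
    (hpab : ∀ c d, a.up c = none → b.up d = none → μa c = false → μb d = false →
      pa (some c) ≠ pb (some d)) :
    Valid k (node g a b) (Tree.glue m μa μb) (gluePos p q pa pb) where
  nonneg v := by
    rcases v with _ | c
    · exact hp0
    · rcases vert_cases c with rfl | ⟨c, rfl⟩ | ⟨c, rfl⟩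
      · exact hq0
      · exact ha.nonneg _
      · exact hb.nonneg _
  le v := by
    rcases v with _ | c
    · exact hpk
    · rcases vert_cases c with rfl | ⟨c, rfl⟩ | ⟨c, rfl⟩
      · exact hqk
      · exact ha.le _
      · exact hb.le _
  step c hc := by
    rcases vert_cases c with rfl | ⟨c, rfl⟩ | ⟨c, rfl⟩
    · exact hstep hc
    · simpa [gluePos_plantL, hqa] using ha.step c hc
    · simpa [gluePos_plantR, hqb] using hb.step c hc
  updown c d hc hd h := by
    rcases vert_cases c with rfl | ⟨c, rfl⟩ | ⟨c, rfl⟩ <;>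
    rcases vert_cases d with rfl | ⟨d, rfl⟩ | ⟨d, rfl⟩ <;>
    simp [gluePos_plantL, gluePos_plantR, hqa, hqb] at hc hd h ⊢
    · exact hpa _ h hc hd
    · exact hpb _ h hc hd
    · exact ha.updown _ _ hc hd h
    · exact hb.updown _ _ hc hd h
  siblings c d hc hd h := by
    rcases vert_cases c with rfl | ⟨c, rfl⟩ | ⟨c, rfl⟩ <;>
    rcases vert_cases d with rfl | ⟨d, rfl⟩ | ⟨d, rfl⟩ <;>
    simp at hc hd h ⊢
    · exact ha.siblings _ _ hc hd h
    · exact hpab _ _ h.1 h.2 hc hd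
    · exact (hpab _ _ h.2 h.1 hd hc).symm
    · exact hb.siblings _ _ hc hd h
  updownM c d hc h := by
    rcases vert_cases c with rfl | ⟨c, rfl⟩ | ⟨c, rfl⟩ <;>
    rcases vert_cases d with rfl | ⟨d, rfl⟩ | ⟨d, rfl⟩ <;>
    simp at hc h ⊢
    · exact hma _ h hc
    · exact hmb _ h hc
    · exact ha.updownM _ _ hc h
    · exact hb.updownM _ _ hc h
  siblingsM c d hc hd h := by
    rcases vert_cases c with rfl | ⟨c, rfl⟩ | ⟨c, rfl⟩ <;>
    rcases vert_cases d with rfl | ⟨d, rfl⟩ | ⟨d, rfl⟩ <;>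
    simp at hc hd h ⊢
    · exact ha.siblingsM _ _ hc hd h
    · simp [hmab _ _ h.1 h.2 hc] at hd
    · simp [hmab _ _ h.2 h.1 hd] at hc
    · exact hb.siblingsM _ _ hc hd h

lemma Can.le {k : ℕ} {x : Bool → Bool} {t : Tree} {m : Bool} {l : ℕ} (h : t.Can k x m l) :
    l ≤ k := by
  cases t with
  | nil => obtain ⟨-, rfl⟩ := h; exact Nat.zero_le k
  | node g a b =>
    obtain ⟨-, ma, la, mb, lb, -, -, -, h⟩ := h
    omega

lemma Can.pos_of_up {k : ℕ} {x : Bool → Bool} {t : Tree} {l : ℕ} (h : t.Can k x false l)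
    (c : t.Vert) : 0 < l := by
  cases t with
  | nil => exact nomatch (c : Empty)
  | node g a b =>
    obtain ⟨-, ma, la, mb, lb, -, -, -, h⟩ := h
    simp at h
    omega

lemma Can.exists_valid {k : ℕ} {x : Bool → Bool} : ∀ {t : Tree} {m : Bool} {l : ℕ},
    t.Can k x m l → ∀ p ε : ℤ, (ε = 1 ∨ ε = -1) → 0 ≤ p → p ≤ k → 0 ≤ p + ε * l → p + ε * l ≤ k →
      ∃ (μ : t.Vert → Bool) (pos : Option t.Vert → ℤ), Valid k t μ pos ∧
        (∀ c i, t.tag c = some i → x i = !μ c) ∧ pos none = p ∧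
        ∀ r, t.up r = none → μ r = m ∧ (m = false → pos (some r) = p + ε)
  | nil, m, l, _, p, ε, hε, hp0, hpk, _, _ =>
    ⟨fun _ => false, fun _ => p,
      ⟨fun _ => hp0, fun _ => hpk, fun c => Empty.elim c, fun c => Empty.elim c,
        fun c => Empty.elim c, fun c => Empty.elim c, fun c => Empty.elim c⟩,
      fun c => Empty.elim c, rfl, fun c => Empty.elim c⟩
  | node g a b, m, l, ⟨hg, ma, la, mb, lb, hca, hcb, hnab, h⟩, p, ε, hε, hp0, hpk, h0, h1 => by
    rcases h with ⟨rfl, rfl, rfl, rfl, hle⟩ | ⟨rfl, hz, rfl, hle⟩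
    · obtain ⟨μa, pa, hva, hxa, hpa, hra⟩ := hca.exists_valid la (-1) (by simp) (by omega)
        (by omega) (by omega) (by omega)
      obtain ⟨μb, pb, hvb, hxb, hpb, hrb⟩ := hcb.exists_valid la 1 (by simp) (by omega)
        (by omega) (by omega) (by omega)
      refine ⟨Tree.glue true μa μb, gluePos p la pa pb, hva.glue hvb hpa hpb hp0 hpk
        (by omega) (by omega) (by simp) (fun c hc _ => (hra c hc).1) (fun c hc _ => (hrb c hc).1)
        (fun c d hc hd hm => (hrb d hd).1) (by simp) (by simp) ?_, ?_, rfl, ?_⟩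
      · intro c d hc hd _ _
        rw [(hra c hc).2 rfl, (hrb d hd).2 rfl]
        omega
      · intro c i
        rcases vert_cases c with rfl | ⟨c, rfl⟩ | ⟨c, rfl⟩
        · exact hg i
        · exact hxa c i
        · exact hxb c i
      · intro r hr
        rcases vert_cases r with rfl | ⟨r, rfl⟩ | ⟨r, rfl⟩
        · simp
        · simp at hr
        · simp at hr
    · obtain ⟨μa, pa, hva, hxa, hpa, hra⟩ := hca.exists_valid (p + ε) ε hε
        (by rcases hε with rfl | rfl <;> omega) (by rcases hε with rfl | rfl <;> omega)
        (by rcases hε with rfl | rfl <;> omega) (by rcases hε with rfl | rfl <;> omega)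
      obtain ⟨μb, pb, hvb, hxb, hpb, hrb⟩ := hcb.exists_valid (p + ε) ε hε
        (by rcases hε with rfl | rfl <;> omega) (by rcases hε with rfl | rfl <;> omega)
        (by rcases hε with rfl | rfl <;> omega) (by rcases hε with rfl | rfl <;> omega)
      refine ⟨Tree.glue false μa μb, gluePos p (p + ε) pa pb, hva.glue hvb hpa hpb hp0 hpk
        (by rcases hε with rfl | rfl <;> omega) (by rcases hε with rfl | rfl <;> omega)
        (fun _ => by rcases hε with rfl | rfl <;> omega) (by simp) (by simp) ?_ ?_ ?_ ?_, ?_, rfl,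
        ?_⟩
      · intro c d hc hd hm
        have h1 := (hra c hc).1
        have h2 := (hrb d hd).1
        rw [hm] at h1
        rw [h2]
        by_contra hcon
        exact hnab ⟨h1.symm, by simpa using hcon⟩
      · intro c hc _ hm
        rw [(hra c hc).2 ((hra c hc).1.symm.trans hm)]
        rcases hε with rfl | rfl <;> omega
      · intro c hc _ hm
        rw [(hrb c hc).2 ((hrb c hc).1.symm.trans hm)]
        rcases hε with rfl | rfl <;> omega
      · intro c d hc hd hm hm'
        obtain rfl := (hra c hc).1.symm.trans hm
        obtain rfl := (hrb d hd).1.symm.trans hm'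
        have := hca.pos_of_up c
        have := hcb.pos_of_up d
        omega
      · intro c i
        rcases vert_cases c with rfl | ⟨c, rfl⟩ | ⟨c, rfl⟩
        · exact hg i
        · exact hxa c i
        · exact hxb c i
      · intro r hr
        rcases vert_cases r with rfl | ⟨r, rfl⟩ | ⟨r, rfl⟩
        · simp
        · simp at hr
        · simp at hr

end Tree

section Positions

variable {W : Type} {H : SimpleGraph W} {pos : W → ℤ}

lemma pos_eq_of_isPath (hstep : ∀ u v, H.Adj u v → pos v = pos u + 1 ∨ pos v = pos u - 1)
    (hinj : ∀ v c d, H.Adj v c → H.Adj v d → pos c = pos d → c = d) :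
    ∀ {u v w : W} (h : H.Adj u v) (p : H.Walk v w), (Walk.cons h p).IsPath →
      pos w = pos u + (pos v - pos u) * ((p.length : ℤ) + 1)
  | u, v, _, h, .nil, _ => by simp
  | u, v, w, h, .cons (v := v') h' p, hp => by
    have ih := pos_eq_of_isPath hstep hinj h' p ((Walk.cons_isPath_iff _ _).1 hp).1
    have hne : pos u ≠ pos v' := by
      intro he
      have := hinj v u v' h.symm h' he
      subst this
      simp [Walk.cons_isPath_iff] at hp
    have : pos v' - pos v = pos v - pos u := by
      have := hstep _ _ h
      have := hstep _ _ h'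
      omega
    rw [this] at ih
    rw [ih, Walk.length_cons]
    push_cast
    ring

lemma isPath_length_le {k : ℕ}
    (hstep : ∀ u v, H.Adj u v → pos v = pos u + 1 ∨ pos v = pos u - 1)
    (hinj : ∀ v c d, H.Adj v c → H.Adj v d → pos c = pos d → c = d)
    (h0 : ∀ v, 0 ≤ pos v) (hk : ∀ v, pos v ≤ k) {u w : W} (p : H.Walk u w) (hp : p.IsPath) :
    p.length ≤ k := by
  cases p with
  | nil => simp
  | cons h p =>
    have h1 := pos_eq_of_isPath hstep hinj h p hp
    have := h0 u; have := hk u; have := h0 w; have := hk w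
    rw [Walk.length_cons]
    rcases hstep _ _ h with h2 | h2 <;> rw [h2] at h1 <;> ring_nf at h1 <;> omega

lemma isAcyclic_of_pos (hstep : ∀ u v, H.Adj u v → pos v = pos u + 1 ∨ pos v = pos u - 1)
    (hinj : ∀ v c d, H.Adj v c → H.Adj v d → pos c = pos d → c = d) : H.IsAcyclic := by
  intro u c hc
  cases c with
  | nil => exact hc.ne_nil rfl
  | cons h p =>
    have hlen := hc.three_le_length
    have hp := ((Walk.cons_isCycle_iff _ _).1 hc).1
    cases p with
    | nil => simp at hlen
    | cons h' p =>
      have h1 := pos_eq_of_isPath hstep hinj h' p hp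
      simp only [Walk.length_cons] at hlen
      have h2 := hstep _ _ h
      rcases hstep _ _ h' with h3 | h3 <;> rw [h3] at h1 <;> ring_nf at h1 <;> omega

lemma ncard_le_two (F : Set (Sym2 W)) (hF : H = fromEdgeSet F) (hd : ∀ e ∈ F, ¬ e.IsDiag)
    (hstep : ∀ u v, H.Adj u v → pos v = pos u + 1 ∨ pos v = pos u - 1)
    (hinj : ∀ v c d, H.Adj v c → H.Adj v d → pos c = pos d → c = d) (v : W) :
    {e ∈ F | v ∈ e}.ncard ≤ 2 := by
  have hex : ∀ e ∈ {e ∈ F | v ∈ e}, ∃ w, e = s(v, w) ∧ H.Adj v w := by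
    rintro e ⟨he, w, rfl⟩
    exact ⟨w, rfl, by rw [hF, fromEdgeSet_adj]; exact ⟨he, fun h => hd _ he (by simpa using h)⟩⟩
  have : ∀ z : ℤ, ∃ w : W, ∀ c, H.Adj v c → pos c = z → c = w := by
    intro z
    by_cases h : ∃ c, H.Adj v c ∧ pos c = z
    · obtain ⟨c, hc, rfl⟩ := h
      exact ⟨c, fun d hd h => hinj v d c hd hc h⟩
    · exact ⟨v, fun c hc h' => absurd ⟨c, hc, h'⟩ h⟩
  obtain ⟨a, ha⟩ := this (pos v + 1)
  obtain ⟨b, hb⟩ := this (pos v - 1)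
  refine (Set.ncard_le_ncard (t := {s(v, a), s(v, b)}) ?_ (Set.toFinite _)).trans
    ((Set.ncard_insert_le _ _).trans (by simp))
  intro e he
  obtain ⟨w, rfl, hw⟩ := hex e he
  rcases hstep _ _ hw with h | h
  · left; rw [ha w hw h]
  · right; rw [hb w hw h]; rfl

end Positions

namespace Tree

lemma Valid.isMLFDecomp {k : ℕ} {t : Tree} {μ : t.Vert → Bool} {pos : Option t.Vert → ℤ}
    (h : Valid k t μ pos) :
    IsMLFDecomp t.graph k (t.edge '' {c | μ c = false}) (t.edge '' {c | μ c = true}) := by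
  have hsub : ∀ s : Set t.Vert, t.edge '' s ⊆ t.graph.edgeSet := by
    rintro s _ ⟨c, -, rfl⟩
    exact (mem_edgeSet_graph t _).2 ⟨c, rfl⟩
  have hadj : ∀ {u v}, (fromEdgeSet (t.edge '' {c | μ c = false})).Adj u v →
      ∃ c, μ c = false ∧ ((u = some c ∧ v = t.up c) ∨ (v = some c ∧ u = t.up c)) := by
    intro u v huv
    obtain ⟨⟨c, hc, he⟩, -⟩ := (fromEdgeSet_adj _).1 huv
    simp only [edge, Sym2.eq_iff] at he
    refine ⟨c, hc, ?_⟩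
    rcases he with ⟨h1, h2⟩ | ⟨h1, h2⟩
    · exact Or.inl ⟨h1.symm, h2.symm⟩
    · exact Or.inr ⟨h1.symm, h2.symm⟩
  have hstep : ∀ u v, (fromEdgeSet (t.edge '' {c | μ c = false})).Adj u v →
      pos v = pos u + 1 ∨ pos v = pos u - 1 := by
    intro u v huv
    obtain ⟨c, hc, ⟨rfl, rfl⟩ | ⟨rfl, rfl⟩⟩ := hadj huv
    · have := h.step c hc
      omega
    · exact h.step c hc
  have hinj : ∀ v c d, (fromEdgeSet (t.edge '' {c | μ c = false})).Adj v c →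
      (fromEdgeSet (t.edge '' {c | μ c = false})).Adj v d → pos c = pos d → c = d := by
    intro v x y hx hy hxy
    obtain ⟨c, hc, ⟨rfl, rfl⟩ | ⟨rfl, rfl⟩⟩ := hadj hx <;>
    obtain ⟨d, hd, ⟨h1, rfl⟩ | ⟨rfl, h1⟩⟩ := hadj hy
    · rw [Option.some.inj h1]
    · exact absurd hxy.symm (h.updown c d hc hd h1.symm)
    · exact absurd hxy (h.updown d c hd hc h1)
    · rw [h.siblings c d hc hd h1 hxy]
  refine ⟨?_, ?_, ⟨hsub _, isAcyclic_of_pos hstep hinj, ?_, ?_⟩, hsub _, ?_⟩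
  · ext e
    rw [mem_edgeSet_graph]
    constructor
    · rintro (⟨c, -, rfl⟩ | ⟨c, -, rfl⟩) <;> exact ⟨c, rfl⟩
    · rintro ⟨c, rfl⟩
      cases hc : μ c
      · exact Or.inl ⟨c, hc, rfl⟩
      · exact Or.inr ⟨c, hc, rfl⟩
  · rw [Set.disjoint_image_iff t.edge_injective, Set.disjoint_left]
    intro c hc hc'
    exact Bool.false_ne_true (hc.symm.trans hc')
  · exact ncard_le_two _ rfl (fun e he => t.graph.not_isDiag_of_mem_edgeSet (hsub _ he)) hstep hinj
  · exact fun u w p hp => isPath_length_le hstep hinj h.nonneg h.le p hp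
  · rintro _ ⟨c, hc, rfl⟩ _ ⟨d, hd, rfl⟩ hne v hv hv'
    simp only [edge, Sym2.mem_iff] at hv hv'
    have hcd : c ≠ d := fun h => hne (h ▸ rfl)
    rcases hv with rfl | rfl <;> rcases hv' with h1 | h1
    · exact hcd (Option.some.inj h1)
    · exact Bool.false_ne_true ((h.updownM c d hc h1.symm).symm.trans hd)
    · exact Bool.false_ne_true ((h.updownM d c hd h1).symm.trans hc)
    · exact hcd (h.siblingsM c d hc hd h1)

variable {k : ℕ} {x : Bool → Bool} {m : Bool} {l : ℕ}

lemma can_nil : nil.Can k x m l ↔ m = false ∧ l = 0 := Iff.rfl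

lemma can_node {a b : Tree} {g : Option Bool} : (node g a b).Can k x m l ↔
    (∀ i, g = some i → x i = !m) ∧
      ∃ ma la mb lb, Can k x a ma la ∧ Can k x b mb lb ∧ ¬ (ma = true ∧ mb = true) ∧
        ((m = true ∧ l = 0 ∧ ma = false ∧ mb = false ∧ la + lb ≤ k) ∨
          (m = false ∧ (la = 0 ∨ lb = 0) ∧ l = la + lb + 1 ∧ l ≤ k)) := Iff.rfl

lemma can_leaf (hk : 1 ≤ k) : (node none nil nil).Can k x m l ↔
    (m = true ∧ l = 0) ∨ (m = false ∧ l = 1) := by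
  simp only [can_node, can_nil]
  constructor
  · grind
  · rintro (⟨rfl, rfl⟩ | ⟨rfl, rfl⟩) <;> exact ⟨by simp, false, 0, false, 0, by grind⟩

lemma can_input (hk : 1 ≤ k) (i : Bool) : (node (some i) nil nil).Can k x m l ↔
    (x i = false ∧ m = true ∧ l = 0) ∨ (x i = true ∧ m = false ∧ l = 1) := by
  simp only [can_node, can_nil]
  constructor
  · grind
  · rintro (⟨hx, rfl, rfl⟩ | ⟨hx, rfl, rfl⟩) <;>
    exact ⟨by simp [hx], false, 0, false, 0, by grind⟩

/-- Complete binary trees. -/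
def complete : ℕ → Tree
  | 0 => node none nil nil
  | n + 1 => node none (complete n) (complete n)

lemma can_complete (hk : 1 ≤ k) : ∀ {n : ℕ} {m : Bool} {l : ℕ}, 2 * n ≤ k + 2 → n + 1 ≤ k →
    ((complete n).Can k x m l ↔ (m = true ∧ l = 0 ∧ 2 * n ≤ k) ∨ (m = false ∧ l = n + 1))
  | 0, m, l, _, _ => by
    rw [complete, can_leaf hk]
    grind
  | n + 1, m, l, h1, h2 => by
    rw [complete, can_node]
    simp only [can_complete hk (n := n) (by omega) (by omega)]
    constructor
    · grind
    · rintro (⟨rfl, rfl, h⟩ | ⟨rfl, rfl⟩)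
      · exact ⟨by simp, false, n + 1, false, n + 1, by grind⟩
      · exact ⟨by simp, true, 0, false, n + 1, by grind⟩

/-- Trees whose root edge is forced into the forest, at the end of a long path. -/
def long (h : ℕ) : ℕ → Tree
  | 0 => complete (h + 1)
  | n + 1 => node none (long h n) (complete h)

lemma can_long {h : ℕ} (h1 : 2 * h ≤ k) (h2 : k < 2 * h + 2) : ∀ {n : ℕ} {m : Bool} {l : ℕ},
    h + 2 + n ≤ k → ((long h n).Can k x m l ↔ m = false ∧ l = h + 2 + n)
  | 0, m, l, hn => by
    rw [long, can_complete (by omega) (by omega) (by omega)]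
    grind
  | n + 1, m, l, hn => by
    rw [long, can_node]
    simp only [can_long h1 h2 (n := n) (by omega),
      can_complete (k := k) (n := h) (by omega) (by omega) (by omega)]
    constructor
    · grind
    · rintro ⟨rfl, rfl⟩
      exact ⟨by simp, false, h + 2 + n, true, 0, by grind⟩

/-- A tree whose root edge is forced into the matching. -/
def forceM (k : ℕ) : Tree := node none (long (k / 2) (k - k / 2 - 2)) nil

lemma can_forceM (hk : 3 ≤ k) : (forceM k).Can k x m l ↔ m = true ∧ l = 0 := by
  rw [forceM, can_node]
  simp only [can_nil, can_long (k := k) (h := k / 2) (n := k - k / 2 - 2) (by omega) (by omega)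
    (by omega)]
  constructor
  · grind
  · rintro ⟨rfl, rfl⟩
    exact ⟨by simp, false, k, false, 0, by grind⟩

/-- A tree whose root edge is forced into the forest, at the end of a path of length `n`. -/
def forceF (k : ℕ) : ℕ → Tree
  | 0 => nil
  | n + 1 => node none (forceM k) (forceF k n)

lemma can_forceF (hk : 3 ≤ k) : ∀ {n : ℕ} {m : Bool} {l : ℕ}, n ≤ k →
    ((forceF k n).Can k x m l ↔ m = false ∧ l = n)
  | 0, m, l, _ => by rw [forceF, can_nil]
  | n + 1, m, l, hn => by
    rw [forceF, can_node]
    simp only [can_forceM hk, can_forceF hk (n := n) (by omega)]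
    constructor
    · grind
    · rintro ⟨rfl, rfl⟩
      exact ⟨by simp, true, 0, false, n, by grind⟩

/-- A tree that repeats the input `i`, with a path of length `n + 1` below its root edge
whenever that edge is in the forest. -/
def wire (k : ℕ) (i : Bool) (n : ℕ) : Tree :=
  node none (node none (node (some i) nil nil) (forceF k (k - 1 - n))) (forceF k n)

lemma can_wire (hk : 3 ≤ k) (i : Bool) {n : ℕ} (hn : n + 2 ≤ k) : (wire k i n).Can k x m l ↔
    (x i = false ∧ m = true ∧ l = 0) ∨ (x i = true ∧ m = false ∧ l = n + 1) := by
  have key : ∀ {m l}, (node none (node (some i) nil nil) (forceF k (k - 1 - n))).Can k x m l ↔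
      (x i = true ∧ m = true ∧ l = 0) ∨ (x i = false ∧ m = false ∧ l = k - n) := by
    intro m l
    rw [can_node]
    simp only [can_input (k := k) (by omega), can_forceF hk (n := k - 1 - n) (by omega)]
    constructor
    · grind
    · rintro (⟨hx, rfl, rfl⟩ | ⟨hx, rfl, rfl⟩)
      · exact ⟨by simp, false, 1, false, k - 1 - n, by grind⟩
      · exact ⟨by simp, true, 0, false, k - 1 - n, by grind⟩
  rw [wire, can_node]
  simp only [key, can_forceF hk (n := n) (by omega)]
  constructor
  · grind
  · rintro (⟨hx, rfl, rfl⟩ | ⟨hx, rfl, rfl⟩)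
    · exact ⟨by simp, false, k - n, false, n, by grind⟩
    · exact ⟨by simp, true, 0, false, n, by grind⟩

/-- The tree underlying the OR gadget. -/
def orTree (k : ℕ) : Tree :=
  node none (node none (wire k false (k - 2)) (node none nil nil))
    (node none (wire k true (k - 3)) nil)

lemma can_orTree_left (hk : 3 ≤ k) :
    (node none (wire k false (k - 2)) (node none nil nil)).Can k x m l ↔
      (x false = false ∧ m = false ∧ l = 2) ∨
      (x false = true ∧ ((m = true ∧ l = 0) ∨ (m = false ∧ l = k))) := by
  rw [can_node]
  simp only [can_wire hk false (n := k - 2) (by omega), can_leaf (k := k) (by omega)]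
  constructor
  · grind
  · rintro (⟨hx, rfl, rfl⟩ | ⟨hx, ⟨rfl, rfl⟩ | ⟨rfl, rfl⟩⟩)
    · exact ⟨by simp, true, 0, false, 1, by grind⟩
    · exact ⟨by simp, false, k - 1, false, 1, by grind⟩
    · exact ⟨by simp, false, l - 1, true, 0, by grind⟩

lemma can_orTree_right (hk : 3 ≤ k) :
    (node none (wire k true (k - 3)) nil).Can k x m l ↔
      (x true = false ∧ m = false ∧ l = 1) ∨
      (x true = true ∧ ((m = true ∧ l = 0) ∨ (m = false ∧ l = k - 1))) := by
  rw [can_node]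
  simp only [can_wire hk true (n := k - 3) (by omega), can_nil]
  constructor
  · grind
  · rintro (⟨hx, rfl, rfl⟩ | ⟨hx, ⟨rfl, rfl⟩ | ⟨rfl, rfl⟩⟩)
    · exact ⟨by simp, true, 0, false, 0, by grind⟩
    · exact ⟨by simp, false, k - 2, false, 0, by grind⟩
    · exact ⟨by simp, false, k - 2, false, 0, by grind⟩

lemma eq_or_of_can_orTree (hk : 3 ≤ k) (h : (orTree k).Can k x m l) :
    m = !(x false || x true) := by
  rw [orTree, can_node] at h
  simp only [can_orTree_left hk, can_orTree_right hk] at h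
  cases hf : x false <;> cases ht : x true <;> grind

lemma exists_can_orTree (hk : 3 ≤ k) (x : Bool → Bool) : ∃ m l, (orTree k).Can k x m l := by
  rw [orTree]
  simp only [can_node (a := node none (wire k false (k - 2)) (node none nil nil)),
    can_orTree_left hk, can_orTree_right hk]
  cases hf : x false <;> cases ht : x true
  · exact ⟨true, 0, by simp, false, 2, false, 1, by grind⟩
  · exact ⟨false, 3, by simp, false, 2, true, 0, by grind⟩
  · exact ⟨false, 2, by simp, true, 0, false, 1, by grind⟩
  · exact ⟨false, k, by simp, true, 0, false, k - 1, by grind⟩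

/-- No node is tagged. -/
def Untagged (t : Tree) : Prop := ∀ c, t.tag c = none

lemma untagged_nil : nil.Untagged := fun c => nomatch (c : Empty)

lemma Untagged.node {a b : Tree} (ha : a.Untagged) (hb : b.Untagged) :
    (node none a b).Untagged := by
  intro c
  rcases vert_cases c with rfl | ⟨c, rfl⟩ | ⟨c, rfl⟩
  · rfl
  · exact ha c
  · exact hb c

lemma untagged_complete : ∀ n, (complete n).Untagged
  | 0 => untagged_nil.node untagged_nil
  | n + 1 => (untagged_complete n).node (untagged_complete n)

lemma untagged_long (h : ℕ) : ∀ n, (long h n).Untagged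
  | 0 => untagged_complete _
  | n + 1 => (untagged_long h n).node (untagged_complete h)

lemma untagged_forceF (k : ℕ) : ∀ n, (forceF k n).Untagged
  | 0 => untagged_nil
  | n + 1 => ((untagged_long _ _).node untagged_nil).node (untagged_forceF k n)

/-- The node of `wire k i n` that carries the input. -/
def wireInput (k : ℕ) (i : Bool) (n : ℕ) : (wire k i n).Vert := inL (inL rootV)

lemma eq_wireInput {i j : Bool} {n : ℕ} {c : (wire k i n).Vert} (h : (wire k i n).tag c = some j) :
    j = i ∧ c = wireInput k i n := by
  unfold wire at c h
  rcases vert_cases c with rfl | ⟨c, rfl⟩ | ⟨c, rfl⟩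
  · simp at h
  · rcases vert_cases c with rfl | ⟨c, rfl⟩ | ⟨c, rfl⟩
    · simp at h
    · rcases vert_cases c with rfl | ⟨c, rfl⟩ | ⟨c, rfl⟩
      · exact ⟨by simpa using h.symm, rfl⟩
      · exact nomatch (c : Empty)
      · exact nomatch (c : Empty)
    · simp [untagged_forceF k _ c] at h
  · simp [untagged_forceF k _ c] at h

lemma up_ne_wireInput {i : Bool} {n : ℕ} (c : (wire k i n).Vert) :
    (wire k i n).up c ≠ some (wireInput k i n) := by
  unfold wireInput
  unfold wire at c ⊢
  rcases vert_cases c with rfl | ⟨c, rfl⟩ | ⟨c, rfl⟩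
  · simp
  · rcases vert_cases c with rfl | ⟨c, rfl⟩ | ⟨c, rfl⟩
    · simp
    · rcases vert_cases c with rfl | ⟨c, rfl⟩ | ⟨c, rfl⟩
      · simp
      · exact nomatch (c : Empty)
      · exact nomatch (c : Empty)
    · simp
  · simp

/-- The node of `orTree k` that carries the input `i`. -/
def orInput (k : ℕ) : Bool → (orTree k).Vert
  | false => inL (inL (wireInput k false (k - 2)))
  | true => inR (inL (wireInput k true (k - 3)))

lemma tag_orInput (k : ℕ) (i : Bool) : (orTree k).tag (orInput k i) = some i := by
  cases i <;> rfl

lemma eq_orInput {c : (orTree k).Vert} {i : Bool} (h : (orTree k).tag c = some i) :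
    c = orInput k i := by
  unfold orTree at c h
  rcases vert_cases c with rfl | ⟨c, rfl⟩ | ⟨c, rfl⟩
  · simp at h
  · rcases vert_cases c with rfl | ⟨c, rfl⟩ | ⟨c, rfl⟩
    · simp at h
    · obtain ⟨rfl, rfl⟩ := eq_wireInput (by simpa using h)
      rfl
    · simp [untagged_nil.node untagged_nil c] at h
  · rcases vert_cases c with rfl | ⟨c, rfl⟩ | ⟨c, rfl⟩
    · simp at h
    · obtain ⟨rfl, rfl⟩ := eq_wireInput (by simpa using h)
      rfl
    · exact nomatch (c : Empty)

lemma up_ne_orInput (c : (orTree k).Vert) (i : Bool) : (orTree k).up c ≠ some (orInput k i) := by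
  unfold orTree at c ⊢
  rcases vert_cases c with rfl | ⟨c, rfl⟩ | ⟨c, rfl⟩
  · simp
  · rcases vert_cases c with rfl | ⟨c, rfl⟩ | ⟨c, rfl⟩ <;> cases i <;>
    simp [orInput, up_ne_wireInput]
  · rcases vert_cases c with rfl | ⟨c, rfl⟩ | ⟨c, rfl⟩ <;> cases i <;>
    simp [orInput, up_ne_wireInput]

/-- The root of `orTree k`. -/
def orRoot (k : ℕ) : (orTree k).Vert := rootV

lemma orInput_ne_orRoot (i : Bool) : orInput k i ≠ orRoot k := by
  intro h
  have := tag_orInput k i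
  rw [h] at this
  cases this

lemma orInput_false_ne_true : orInput k false ≠ orInput k true := by
  intro h
  have := tag_orInput k false
  rw [h, tag_orInput] at this
  cases this

lemma eq_edge_orInput {e : Sym2 (Option (orTree k).Vert)} {i : Bool}
    (he : e ∈ (orTree k).graph.edgeSet) (h : some (orInput k i) ∈ e) :
    e = (orTree k).edge (orInput k i) := by
  obtain ⟨c, rfl⟩ := (mem_edgeSet_graph _ _).1 he
  rcases Sym2.mem_iff.1 h with h | h
  · rw [Option.some.inj h]
  · exact absurd h.symm (up_ne_orInput c i)

lemma eq_edge_orRoot {e : Sym2 (Option (orTree k).Vert)}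
    (he : e ∈ (orTree k).graph.edgeSet) (h : none ∈ e) :
    e = (orTree k).edge (orRoot k) := by
  obtain ⟨c, rfl⟩ := (mem_edgeSet_graph _ _).1 he
  rcases Sym2.mem_iff.1 h with h | h
  · cases h
  · rw [eq_of_up_eq_none _ c (orRoot k) h.symm rfl]

open Classical in
lemma orRoot_mem_iff (hk : 3 ≤ k) {F M : Set (Sym2 (Option (orTree k).Vert))}
    (h : IsMLFDecomp (orTree k).graph k F M) :
    (orTree k).edge (orRoot k) ∈ F ↔
      (orTree k).edge (orInput k false) ∈ F ∨ (orTree k).edge (orInput k true) ∈ F := by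
  set x : Bool → Bool := fun i => decide ((orTree k).edge (orInput k i) ∈ F) with hx
  obtain ⟨m, l, hc, hM, hF⟩ := exists_can_of_decomp h x (orTree k) id Function.injective_id
    (fun c => ⟨c, rfl⟩) (fun c i hc => by
      obtain rfl := eq_orInput hc
      exact decide_eq_true_iff)
  have hm := eq_or_of_can_orTree hk hc
  obtain ⟨hFM, hdisj, ⟨hFG, -⟩, hMG, -⟩ := h
  have hiff : (x false || x true) = true ↔
      (orTree k).edge (orInput k false) ∈ F ∨ (orTree k).edge (orInput k true) ∈ F := by
    simp [hx]
  rw [← hiff]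
  cases hv : (x false || x true)
  · obtain ⟨r, hr⟩ := hM (by rw [hm, hv]; rfl)
    have hr' := eq_edge_orRoot (hMG hr) (Sym2.mem_mk_left _ _)
    simp only [id] at hr'
    simp only [id, hr'] at hr
    exact iff_of_false (fun hF => Set.disjoint_left.1 hdisj hF hr) (by simp)
  · rw [hv] at hm
    subst hm
    obtain ⟨r, hr⟩ := hF (hc.pos_of_up (orRoot k))
    have hr := ((fromEdgeSet_adj _).1 hr.adj).1
    have hr' := eq_edge_orRoot (hFG hr) (Sym2.mem_mk_left _ _)
    simp only [id] at hr'
    simp only [id, hr'] at hr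
    exact iff_of_true hr rfl

lemma exists_decomp_orTree (hk : 3 ≤ k) (x : Bool → Bool) :
    ∃ F M, IsMLFDecomp (orTree k).graph k F M ∧
      ∀ i, if x i then (orTree k).edge (orInput k i) ∈ F else (orTree k).edge (orInput k i) ∈ M := by
  obtain ⟨m, l, hc⟩ := exists_can_orTree hk x
  have := hc.le
  obtain ⟨μ, pos, hv, hx, -⟩ := hc.exists_valid 0 1 (by simp) (by omega) (by omega) (by omega)
    (by omega)
  refine ⟨_, _, hv.isMLFDecomp, fun i => ?_⟩
  have := hx _ i (tag_orInput k i)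
  split
  · exact ⟨_, by simp_all, rfl⟩
  · exact ⟨_, by simp_all, rfl⟩

end Tree

end ORGadget

/-- For every integer `k ≥ 3` there exists a `k`-OR gadget: a finite simple graph
`O` with three distinct degree-1 vertices `p₁, p₂, o`, with unique incident edges `e₁, e₂, f`
respectively, such that (i) every partition of `{e₁, e₂}` extends to a decomposition of `O`
into a `k`-bounded linear forest and a matching, (ii) if `e₁, e₂ ∈ M` then `f ∈ M`, and
(iii) if `e₁ ∈ F` or `e₂ ∈ F` then `f ∈ F`. -/
theorem orGadget_exists (k : ℕ) (hk : 3 ≤ k) :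
    ∃ (V : Type) (_ : Fintype V) (O : SimpleGraph V) (p₁ p₂ o : V) (e₁ e₂ f : Sym2 V),
      p₁ ≠ p₂ ∧ p₁ ≠ o ∧ p₂ ≠ o ∧
      e₁ ≠ e₂ ∧ e₁ ≠ f ∧ e₂ ≠ f ∧
      (e₁ ∈ O.edgeSet ∧ p₁ ∈ e₁ ∧ ∀ g ∈ O.edgeSet, p₁ ∈ g → g = e₁) ∧
      (e₂ ∈ O.edgeSet ∧ p₂ ∈ e₂ ∧ ∀ g ∈ O.edgeSet, p₂ ∈ g → g = e₂) ∧
      (f ∈ O.edgeSet ∧ o ∈ f ∧ ∀ g ∈ O.edgeSet, o ∈ g → g = f) ∧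
      (∀ Ft Mt : Set (Sym2 V), Ft ∪ Mt = {e₁, e₂} → Disjoint Ft Mt →
        ∃ F M : Set (Sym2 V), IsMLFDecomp O k F M ∧ Ft ⊆ F ∧ Mt ⊆ M) ∧
      (∀ F M : Set (Sym2 V), IsMLFDecomp O k F M → e₁ ∈ M → e₂ ∈ M → f ∈ M) ∧
      (∀ F M : Set (Sym2 V), IsMLFDecomp O k F M → (e₁ ∈ F ∨ e₂ ∈ F) → f ∈ F) := by
  classical
  have hmem : ∀ c, (ORGadget.Tree.orTree k).edge c ∈ (ORGadget.Tree.orTree k).graph.edgeSet :=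
    fun c => (ORGadget.Tree.mem_edgeSet_graph _ _).2 ⟨c, rfl⟩
  have hinj := (ORGadget.Tree.orTree k).edge_injective
  refine ⟨Option (ORGadget.Tree.orTree k).Vert, inferInstance, (ORGadget.Tree.orTree k).graph,
    some (ORGadget.Tree.orInput k false), some (ORGadget.Tree.orInput k true), none,
    (ORGadget.Tree.orTree k).edge (ORGadget.Tree.orInput k false),
    (ORGadget.Tree.orTree k).edge (ORGadget.Tree.orInput k true),
    (ORGadget.Tree.orTree k).edge (ORGadget.Tree.orRoot k),
    fun h => ORGadget.Tree.orInput_false_ne_true (Option.some.inj h), Option.some_ne_none _,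
    Option.some_ne_none _, hinj.ne ORGadget.Tree.orInput_false_ne_true,
    hinj.ne (ORGadget.Tree.orInput_ne_orRoot _), hinj.ne (ORGadget.Tree.orInput_ne_orRoot _),
    ⟨hmem _, Sym2.mem_mk_left _ _, fun _ => ORGadget.Tree.eq_edge_orInput⟩,
    ⟨hmem _, Sym2.mem_mk_left _ _, fun _ => ORGadget.Tree.eq_edge_orInput⟩,
    ⟨hmem _, Sym2.mem_mk_right _ _, fun _ => ORGadget.Tree.eq_edge_orRoot⟩, ?_, ?_, ?_⟩
  · intro Ft Mt hunion hdisj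
    obtain ⟨F, M, h, hx⟩ := ORGadget.Tree.exists_decomp_orTree hk
      fun i => decide ((ORGadget.Tree.orTree k).edge (ORGadget.Tree.orInput k i) ∈ Ft)
    have hcases : ∀ e ∈ Ft ∪ Mt,
        ∃ i, e = (ORGadget.Tree.orTree k).edge (ORGadget.Tree.orInput k i) := by
      rw [hunion]
      rintro e (rfl | rfl)
      exacts [⟨false, rfl⟩, ⟨true, rfl⟩]
    refine ⟨F, M, h, fun e he => ?_, fun e he => ?_⟩
    · obtain ⟨i, rfl⟩ := hcases e (Or.inl he)
      simpa [he] using hx i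
    · obtain ⟨i, rfl⟩ := hcases e (Or.inr he)
      simpa [Set.disjoint_right.1 hdisj he] using hx i
  · intro F M h h1 h2
    have hdisj := Set.disjoint_right.1 h.2.1
    have hroot := mt (ORGadget.Tree.orRoot_mem_iff hk h).1 (not_or.2 ⟨hdisj h1, hdisj h2⟩)
    have := hmem (ORGadget.Tree.orRoot k)
    rw [← h.1] at this
    exact this.resolve_left hroot
  · exact fun F M h => (ORGadget.Tree.orRoot_mem_iff hk h).2
end

section
/- For every integer k ≥ 3 there exists a finite simple graph R together with two distinct vertices n′ and n, each of degree 1 in R, with incident edges e′ and e respectively, such that: (i) there is no partition (F, M) of the edge set of R into a k-bounded linear forest F and a matching M with both e′ ∈ F and e ∈ F; and (ii) for every partition of the two-element set {e′, e} into sets F̃ and M̃ such that at least one of e′, e lies in M̃, there exists a partition (F, M) of the edge set of R into a k-bounded linear forest F and a matching M with F̃ ⊆ F and M̃ ⊆ M, and moreover neither e′ nor e is contained in a path of length greater than 1 all of whose edges lie in F. -/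
namespace RejectorGadget

open SimpleGraph

section Layout

variable {V : Type} {H : SimpleGraph V} {lab pos : V → ℕ}

/-- A layout of `H`: each vertex gets a label and a position, jointly injective, so that
adjacent vertices have equal labels and consecutive positions. -/
structure IsLayout (H : SimpleGraph V) (lab pos : V → ℕ) : Prop where
  inj : ∀ u v, lab u = lab v → pos u = pos v → u = v
  lab_eq : ∀ u v, H.Adj u v → lab u = lab v
  pos_succ : ∀ u v, H.Adj u v → pos u = pos v + 1 ∨ pos v = pos u + 1

theorem IsLayout.lab_of_mem_support (h : IsLayout H lab pos) {u w : V} (p : H.Walk u w) :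
    ∀ x ∈ p.support, lab x = lab u := by
  induction p with
  | nil => simp
  | cons hadj p ih =>
    intro x hx
    rw [Walk.support_cons, List.mem_cons] at hx
    rcases hx with rfl | hx
    · rfl
    · rw [ih x hx, h.lab_eq _ _ hadj]

theorem IsLayout.isAcyclic (h : IsLayout H lab pos) : H.IsAcyclic := by
  classical
  intro u c hc
  obtain ⟨x, hx, hmax⟩ := c.support.toFinset.exists_max_image pos ⟨u, by simp⟩
  rw [List.mem_toFinset] at hx
  have hc' := hc.rotate hx
  set d := c.rotate x hx
  have hd : ∀ y ∈ d.support, pos y ≤ pos x := by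
    intro y hy
    apply hmax
    rw [List.mem_toFinset]
    simpa [d] using hy
  have h1 := d.adj_snd hc'.not_nil
  have h2 := d.adj_penultimate hc'.not_nil
  have m1 := hd _ (d.getVert_mem_support 1)
  have m2 := hd _ (d.getVert_mem_support (d.length - 1))
  apply hc'.snd_ne_penultimate
  apply h.inj
  · rw [← h.lab_eq _ _ h1, h.lab_eq _ _ h2]
  · have := h.pos_succ _ _ h1
    have := h.pos_succ _ _ h2
    simp only [Walk.snd, Walk.penultimate] at *
    omega

theorem IsLayout.ncard_incident_le (h : IsLayout H lab pos) (v : V) :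
    {e ∈ H.edgeSet | v ∈ e}.ncard ≤ 2 := by
  have hpair : ({pos v + 1, pos v - 1} : Set ℕ).ncard ≤ 2 := Set.ncard_insert_le _ _ |>.trans (by simp)
  have hmaps : ∀ u ∈ H.neighborSet v, pos u ∈ ({pos v + 1, pos v - 1} : Set ℕ) := by
    intro u hu
    have := h.pos_succ _ _ hu
    simp only [Set.mem_insert_iff, Set.mem_singleton_iff]
    omega
  have hinj : Set.InjOn pos (H.neighborSet v) := fun a ha b hb hab =>
    h.inj a b (by rw [← h.lab_eq _ _ ha, h.lab_eq _ _ hb]) hab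
  have hfin : (H.neighborSet v).Finite :=
    Set.Finite.of_injOn hmaps hinj (Set.toFinite _)
  have hsub : {e ∈ H.edgeSet | v ∈ e} ⊆ (fun u => s(v, u)) '' H.neighborSet v := by
    rintro e ⟨he, hv⟩
    obtain ⟨w, rfl⟩ := hv
    exact ⟨w, he, rfl⟩
  calc _ ≤ _ := Set.ncard_le_ncard hsub (hfin.image _)
    _ ≤ _ := Set.ncard_image_le hfin
    _ ≤ _ := Set.ncard_le_ncard_of_injOn pos hmaps hinj (Set.toFinite _)
    _ ≤ 2 := hpair

theorem IsLayout.length_le (h : IsLayout H lab pos) {lo n : ℕ} {u w x : V} (p : H.Walk u w)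
    (hp : p.IsPath) (hx : x ∈ p.support)
    (hb : ∀ v, lab v = lab x → lo ≤ pos v ∧ pos v ≤ lo + n) : p.length ≤ n := by
  have hlab : ∀ v ∈ p.support, lab v = lab x := fun v hv => by
    rw [h.lab_of_mem_support p v hv, h.lab_of_mem_support p x hx]
  have hnd : (p.support.map pos).Nodup := by
    refine List.Nodup.map_on ?_ hp.support_nodup
    intro a ha b hb' hab
    exact h.inj a b ((hlab a ha).trans (hlab b hb').symm) hab
  have hsub : (p.support.map pos).toFinset ⊆ Finset.Icc lo (lo + n) := by
    intro y hy
    simp only [List.mem_toFinset, List.mem_map] at hy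
    obtain ⟨v, hv, rfl⟩ := hy
    exact Finset.mem_Icc.2 (hb v (hlab v hv))
  have hcard := Finset.card_le_card hsub
  rw [List.toFinset_card_of_nodup hnd] at hcard
  simp at hcard
  omega

/-- The subgraph of `G` formed by the edges joining consecutive positions with equal labels. -/
def layoutGraph (G : SimpleGraph V) (lab pos : V → ℕ) : SimpleGraph V where
  Adj u v := G.Adj u v ∧ lab u = lab v ∧ (pos u = pos v + 1 ∨ pos v = pos u + 1)
  symm := ⟨fun _ _ h => ⟨h.1.symm, h.2.1.symm, h.2.2.symm⟩⟩
  loopless := ⟨fun _ h => h.1.ne rfl⟩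

theorem isLayout_layoutGraph (G : SimpleGraph V)
    (hinj : ∀ u v, lab u = lab v → pos u = pos v → u = v) :
    IsLayout (layoutGraph G lab pos) lab pos :=
  ⟨hinj, fun _ _ h => h.2.1, fun _ _ h => h.2.2⟩

theorem isMLFDecomp_layoutGraph (G : SimpleGraph V) {lo k : ℕ}
    (hinj : ∀ u v, lab u = lab v → pos u = pos v → u = v)
    (hb : ∀ v, lo ≤ pos v ∧ pos v ≤ lo + k)
    (hM : ∀ u v w, G.Adj u v → G.Adj u w → ¬ (layoutGraph G lab pos).Adj u v →
      ¬ (layoutGraph G lab pos).Adj u w → v = w) :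
    IsMLFDecomp G k (layoutGraph G lab pos).edgeSet
      (G.edgeSet \ (layoutGraph G lab pos).edgeSet) := by
  have hl := isLayout_layoutGraph G hinj
  have hle : (layoutGraph G lab pos).edgeSet ⊆ G.edgeSet :=
    SimpleGraph.edgeSet_mono (fun _ _ h => h.1)
  refine ⟨Set.union_sdiff_cancel hle, Set.disjoint_sdiff_right,
    ⟨hle, ?_, hl.ncard_incident_le, ?_⟩, Set.sdiff_subset, ?_⟩
  · rw [fromEdgeSet_edgeSet]
    exact hl.isAcyclic
  · rw [fromEdgeSet_edgeSet]
    intro u w p hp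
    exact hl.length_le p hp p.start_mem_support (fun v _ => hb v)
  · rintro e ⟨he, he'⟩ f ⟨hf, hf'⟩ hne v hve hvf
    obtain ⟨x, rfl⟩ := hve
    obtain ⟨y, rfl⟩ := hvf
    exact hne (by rw [hM v x y he hf he' hf'])

end Layout

section Decomp

variable {V : Type} {G : SimpleGraph V} {k : ℕ} {F M : Set (Sym2 V)}

theorem adj_or_adj_of_decomp (h : IsMLFDecomp G k F M) {u v w : V} (hv : G.Adj u v)
    (hw : G.Adj u w) (hne : v ≠ w) :
    (fromEdgeSet F).Adj u v ∨ (fromEdgeSet F).Adj u w := by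
  obtain ⟨hU, -, -, -, hM⟩ := h
  by_contra! hcon
  simp only [fromEdgeSet_adj, not_and_or, not_not] at hcon
  have hv' : s(u, v) ∈ F ∪ M := by rw [hU]; exact hv
  have hw' : s(u, w) ∈ F ∪ M := by rw [hU]; exact hw
  have hvM := hv'.resolve_left (hcon.1.resolve_right hv.ne)
  have hwM := hw'.resolve_left (hcon.2.resolve_right hw.ne)
  refine hM _ hvM _ hwM ?_ u (by simp) (by simp)
  rwa [Ne, Sym2.congr_right]

theorem false_of_three_adj (h : IsBddLinearForestIn G k F) [Finite V] {u v w x : V}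
    (hv : (fromEdgeSet F).Adj u v) (hw : (fromEdgeSet F).Adj u w)
    (hx : (fromEdgeSet F).Adj u x) (hvw : v ≠ w) (hvx : v ≠ x) (hwx : w ≠ x) : False := by
  rw [fromEdgeSet_adj] at hv hw hx
  have h2 := h.2.2.1 u
  have hsub : ({s(u, v), s(u, w), s(u, x)} : Set (Sym2 V)) ⊆ {e ∈ F | u ∈ e} := by
    rintro e (rfl | rfl | rfl)
    · exact ⟨hv.1, by simp⟩
    · exact ⟨hw.1, by simp⟩
    · exact ⟨hx.1, by simp⟩
  have h3 := Set.ncard_le_ncard hsub (Set.toFinite _)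
  rw [Set.ncard_eq_three.2 ⟨s(u, v), s(u, w), s(u, x), by rwa [Ne, Sym2.congr_right],
    by rwa [Ne, Sym2.congr_right], by rwa [Ne, Sym2.congr_right], rfl⟩] at h3
  omega

end Decomp

/-- One orientation of the edges of the ladder gadget. Vertex `3` is the foot of a ladder with
rails `3, 4, 6, 8, …` and `3, 5, 7, 9, …`; vertex `2` hangs below the foot and, when `L = 2`,
carries the two leaves `0` and `1`. -/
def ladderRel (m L u v : ℕ) : Prop :=
  (L = 2 ∧ u < 2 ∧ v = 2) ∨ (u = 2 ∧ v = 3) ∨ (u = 3 ∧ v = 4) ∨ (3 ≤ u ∧ v = u + 2) ∨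
    (4 ≤ u ∧ u ≤ 2 * m + 2 ∧ u % 2 = 0 ∧ v = u + 1)

/-- The ladder gadget with `m` rungs. -/
def ladder (m L : ℕ) : SimpleGraph (Fin (2 * m + 8)) where
  Adj u v := ladderRel m L u v ∨ ladderRel m L v u
  symm := ⟨fun _ _ h => h.symm⟩
  loopless := ⟨fun u h => by unfold ladderRel at h; omega⟩

theorem ladder_adj {m L : ℕ} {u v : Fin (2 * m + 8)} :
    (ladder m L).Adj u v ↔ ladderRel m L u v ∨ ladderRel m L v u := Iff.rfl

section Rejects

variable {m L : ℕ} {H : SimpleGraph (Fin (2 * m + 8))}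

/-- Some path of `H` with `n` edges starts at `v` and uses only vertices of value at most `B`. -/
def HasPathFrom (H : SimpleGraph (Fin (2 * m + 8))) (v : Fin (2 * m + 8)) (n B : ℕ) : Prop :=
  ∃ (u : Fin (2 * m + 8)) (p : H.Walk v u), p.IsPath ∧ p.length = n ∧ ∀ x ∈ p.support, x.val ≤ B

theorem HasPathFrom.cons {v w : Fin (2 * m + 8)} {n B B' : ℕ} (h : HasPathFrom H v n B)
    (hadj : H.Adj w v) (hw : B < w.val) (hw' : w.val ≤ B') : HasPathFrom H w (n + 1) B' := by
  obtain ⟨u, p, hp, hl, hs⟩ := h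
  refine ⟨u, p.cons hadj, ?_, by simp [hl], ?_⟩
  · rw [Walk.cons_isPath_iff]
    exact ⟨hp, fun hmem => by have := hs _ hmem; omega⟩
  · intro x hx
    rw [Walk.support_cons, List.mem_cons] at hx
    rcases hx with rfl | hx
    · exact hw'
    · have := hs x hx
      omega

/-- Some path of `H` with `n` edges joins `v` to `w` and uses only vertices of value at
most `B`. -/
def HasPathBetween (H : SimpleGraph (Fin (2 * m + 8))) (v w : Fin (2 * m + 8)) (n B : ℕ) : Prop :=
  ∃ p : H.Walk v w, p.IsPath ∧ p.length = n ∧ ∀ x ∈ p.support, x.val ≤ B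

theorem HasPathBetween.extend {v w v' w' : Fin (2 * m + 8)} {n B B' : ℕ}
    (h : HasPathBetween H v w n B) (hv : H.Adj v v') (hw : H.Adj w w') (hne : v' ≠ w')
    (hv1 : B < v'.val) (hw1 : B < w'.val) (hv2 : v'.val ≤ B') (hw2 : w'.val ≤ B') :
    HasPathBetween H v' w' (n + 2) B' := by
  obtain ⟨p, hp, hl, hs⟩ := h
  have hnv : v' ∉ p.support := fun hmem => by have := hs _ hmem; omega
  have hnw : w' ∉ p.support := fun hmem => by have := hs _ hmem; omega
  refine ⟨(p.cons hv.symm).concat hw, ?_, by simp [hl], ?_⟩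
  · refine Walk.IsPath.concat ?_ ?_ hw
    · rw [Walk.cons_isPath_iff]
      exact ⟨hp, hnv⟩
    · rw [Walk.support_cons, List.mem_cons]
      rintro (h | h)
      · exact hne h.symm
      · exact hnw h
  · intro x hx
    rw [Walk.support_concat, Walk.support_cons] at hx
    simp only [List.mem_append, List.mem_cons, List.not_mem_nil,
      or_false] at hx
    rcases hx with (rfl | hx) | rfl
    · exact hv2
    · have := hs x hx
      omega
    · exact hw2

/-- The local constraints on the linear forest part of a decomposition of `ladder m L`. -/
structure IsForestPart (L : ℕ) (H : SimpleGraph (Fin (2 * m + 8))) : Prop where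
  acyclic : H.IsAcyclic
  two : ∀ u v w, (ladder m L).Adj u v → (ladder m L).Adj u w → v ≠ w → H.Adj u v ∨ H.Adj u w
  three : ∀ u v w x, H.Adj u v → H.Adj u w → H.Adj u x → v ≠ w → v ≠ x → w ≠ x → False

/-- At the height where the rails continue along `a a'` and `b b'`, exactly one of the two rails
and the edge below the foot is missing from `H`, and `H` traverses everything below. -/
def LadderState (L : ℕ) (H : SimpleGraph (Fin (2 * m + 8))) (i : ℕ)
    (a b a' b' : Fin (2 * m + 8)) : Prop :=
  (¬ H.Adj a a' ∧ H.Adj b b' ∧ HasPathFrom H b (L + 2 * i) (2 * i + 3)) ∨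
  (¬ H.Adj b b' ∧ H.Adj a a' ∧ HasPathFrom H a (L + 2 * i) (2 * i + 3)) ∨
  (H.Adj a a' ∧ H.Adj b b' ∧ HasPathBetween H a b (2 * i) (2 * i + 3))

theorem IsForestPart.hasPathFrom_foot (h : IsForestPart L H) (hL : L = 1 ∨ L = 2)
    {z c : Fin (2 * m + 8)} (hz : z.val = 2) (hc : c.val = 3) (hzc : H.Adj z c) :
    HasPathFrom H c L 3 := by
  have key : HasPathFrom H z (L - 1) 2 := by
    rcases hL with rfl | rfl
    · exact ⟨z, Walk.nil, by simp, by simp, by simp; omega⟩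
    · have leaf : ∀ w : Fin (2 * m + 8), w.val < 2 → H.Adj z w → HasPathFrom H z 1 2 := by
        intro w hw hadj
        refine ⟨w, Walk.cons hadj Walk.nil, ?_, by simp, ?_⟩
        · simp [hadj.ne]
        · simp
          omega
      rcases h.two z ⟨0, by omega⟩ ⟨1, by omega⟩
        (by rw [ladder_adj]; unfold ladderRel; simp; omega)
        (by rw [ladder_adj]; unfold ladderRel; simp; omega) (by simp) with h' | h'
      · exact leaf _ (by simp) h'
      · exact leaf _ (by simp) h'
  have := key.cons (B' := 3) hzc.symm (by omega) (by omega)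
  rwa [Nat.sub_add_cancel (by omega)] at this

theorem IsForestPart.ladderState (h : IsForestPart L H) (hL : L = 1 ∨ L = 2) (i : ℕ) :
    ∀ a b a' b' : Fin (2 * m + 8), i ≤ m → a.val = (if i = 0 then 3 else 2 * i + 2) →
      b.val = 2 * i + 3 → a'.val = 2 * i + 4 → b'.val = 2 * i + 5 →
      LadderState L H i a b a' b' := by
  have adj : ∀ u v : Fin (2 * m + 8), ladderRel m L u v → (ladder m L).Adj u v :=
    fun _ _ => Or.inl
  have adj' : ∀ u v : Fin (2 * m + 8), ladderRel m L u v → (ladder m L).Adj v u :=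
    fun _ _ => Or.inr
  induction i with
  | zero =>
    intro a b a' b' _ ha hb ha' hb'
    obtain rfl : a = b := by ext; simp_all
    have hz : (2 : ℕ) < 2 * m + 8 := by omega
    obtain ⟨z, hz⟩ : ∃ z : Fin (2 * m + 8), z.val = 2 := ⟨⟨2, hz⟩, rfl⟩
    have e1 : (ladder m L).Adj a a' := adj _ _ (by unfold ladderRel; omega)
    have e2 : (ladder m L).Adj a b' := adj _ _ (by unfold ladderRel; omega)
    have e3 : (ladder m L).Adj a z := adj' _ _ (by unfold ladderRel; omega)
    have n1 : a' ≠ b' := by rw [Ne, Fin.ext_iff]; omega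
    have n2 : a' ≠ z := by rw [Ne, Fin.ext_iff]; omega
    have n3 : b' ≠ z := by rw [Ne, Fin.ext_iff]; omega
    by_cases hA : H.Adj a a'
    · by_cases hB : H.Adj a b'
      · exact Or.inr (Or.inr ⟨hA, hB, Walk.nil, by simp, by simp, by simp; omega⟩)
      · have := (h.two _ _ _ e2 e3 n3).resolve_left hB
        exact Or.inr (Or.inl ⟨hB, hA, h.hasPathFrom_foot hL hz hb this.symm⟩)
    · have hB := (h.two _ _ _ e1 e2 n1).resolve_left hA
      have := (h.two _ _ _ e1 e3 n2).resolve_left hA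
      exact Or.inl ⟨hA, hB, h.hasPathFrom_foot hL hz hb this.symm⟩
  | succ i ih =>
    intro a' b' a'' b'' hi ha' hb' ha'' hb''
    simp only [Nat.add_eq_zero_iff, one_ne_zero, and_false, if_false] at ha'
    obtain ⟨a, ha⟩ : ∃ a : Fin (2 * m + 8), a.val = (if i = 0 then 3 else 2 * i + 2) :=
      ⟨⟨if i = 0 then 3 else 2 * i + 2, by split_ifs <;> omega⟩, rfl⟩
    obtain ⟨b, hb⟩ : ∃ b : Fin (2 * m + 8), b.val = 2 * i + 3 := ⟨⟨_, by omega⟩, rfl⟩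
    have hale : a.val ≤ 2 * i + 3 := by split_ifs at ha <;> omega
    have eR : (ladder m L).Adj a' b' := adj _ _ (by unfold ladderRel; omega)
    have eA : (ladder m L).Adj a' a := adj' _ _ (by unfold ladderRel; split_ifs at ha <;> omega)
    have eB : (ladder m L).Adj b' b := adj' _ _ (by unfold ladderRel; omega)
    have eA' : (ladder m L).Adj a' a'' := adj _ _ (by unfold ladderRel; omega)
    have eB' : (ladder m L).Adj b' b'' := adj _ _ (by unfold ladderRel; omega)
    have n1 : a ≠ b' := by rw [Ne, Fin.ext_iff]; omega
    have n2 : a ≠ a'' := by rw [Ne, Fin.ext_iff]; omega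
    have n3 : b' ≠ a'' := by rw [Ne, Fin.ext_iff]; omega
    have n4 : b ≠ a' := by rw [Ne, Fin.ext_iff]; omega
    have n5 : b ≠ b'' := by rw [Ne, Fin.ext_iff]; omega
    have n6 : a' ≠ b'' := by rw [Ne, Fin.ext_iff]; omega
    rcases ih a b a' b' (by omega) ha hb (by omega) (by omega) with
      ⟨hA, hB, hP⟩ | ⟨hB, hA, hP⟩ | ⟨hA, hB, hP⟩
    · have hR := (h.two _ _ _ eA eR n1).resolve_left fun h' => hA h'.symm
      have hA' := (h.two _ _ _ eA eA' n2).resolve_left fun h' => hA h'.symm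
      have hB' : ¬ H.Adj b' b'' := fun h' => h.three _ _ _ _ hB.symm hR.symm h' n4 n5 n6
      refine Or.inr (Or.inl ⟨hB', hA', ?_⟩)
      obtain ⟨u, p, hp, hl, hs⟩ := hP
      refine ⟨u, (p.cons hB.symm).cons hR, ?_, by simp [hl]; omega, ?_⟩
      · simp only [Walk.cons_isPath_iff, Walk.support_cons, List.mem_cons, not_or]
        exact ⟨⟨hp, fun h' => by have := hs _ h'; omega⟩, eR.ne,
          fun h' => by have := hs _ h'; omega⟩
      · simp only [Walk.support_cons, List.mem_cons]
        rintro x (rfl | rfl | hx)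
        · omega
        · omega
        · have := hs x hx
          omega
    · have hR := (h.two _ _ _ eB eR.symm n4).resolve_left fun h' => hB h'.symm
      have hB' := (h.two _ _ _ eB eB' n5).resolve_left fun h' => hB h'.symm
      have hA' : ¬ H.Adj a' a'' := fun h' => h.three _ _ _ _ hA.symm hR.symm h' n1 n2 n3
      exact Or.inl ⟨hA', hB', (hP.cons (B' := 2 * i + 4) hA.symm (by omega) (by omega)).cons
        hR (by omega) (by omega)⟩
    · have hP' := hP.extend (B' := 2 * (i + 1) + 3) hA hB eR.ne (by omega) (by omega)
        (by omega) (by omega)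
      have hR : ¬ H.Adj a' b' := by
        intro hR
        obtain ⟨p, hp, hl, -⟩ := hP'
        have := h.acyclic.subsingleton_path a' b'
        have := congrArg (fun q : H.Path a' b' => q.1.length)
          (Subsingleton.elim ⟨p, hp⟩ ⟨Walk.cons hR Walk.nil, by simp [hR.ne]⟩)
        simp [hl] at this
      have hA' := (h.two _ _ _ eR eA' n3).resolve_left hR
      have hB' := (h.two _ _ _ eR.symm eB' n6).resolve_left fun h' => hR h'.symm
      exact Or.inr (Or.inr ⟨hA', hB', hP'⟩)

theorem ladder_rejects {k : ℕ} (hL : L = 1 ∨ L = 2) (hk : k = 2 * m + 1 + L)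
    {F M : Set (Sym2 (Fin (2 * m + 8)))} (h : IsMLFDecomp (ladder m L) k F M)
    {x' x n' n : Fin (2 * m + 8)} (hx' : x'.val = 2 * m + 4) (hx : x.val = 2 * m + 5)
    (hn' : n'.val = 2 * m + 6) (hn : n.val = 2 * m + 7) (he' : s(x', n') ∈ F)
    (he : s(x, n) ∈ F) : False := by
  have hF : IsForestPart L (fromEdgeSet F) :=
    ⟨h.2.2.1.2.1, fun _ _ _ => adj_or_adj_of_decomp h,
      fun _ _ _ _ => false_of_three_adj h.2.2.1⟩
  have e' : (fromEdgeSet F).Adj x' n' := by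
    rw [fromEdgeSet_adj]
    exact ⟨he', by rw [Ne, Fin.ext_iff]; omega⟩
  have e : (fromEdgeSet F).Adj x n := by
    rw [fromEdgeSet_adj]
    exact ⟨he, by rw [Ne, Fin.ext_iff]; omega⟩
  obtain ⟨a, ha⟩ : ∃ a : Fin (2 * m + 8), a.val = (if m = 0 then 3 else 2 * m + 2) :=
    ⟨⟨if m = 0 then 3 else 2 * m + 2, by split_ifs <;> omega⟩, rfl⟩
  obtain ⟨b, hb⟩ : ∃ b : Fin (2 * m + 8), b.val = 2 * m + 3 := ⟨⟨_, by omega⟩, rfl⟩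
  rcases hF.ladderState hL m a b x' x le_rfl ha hb hx' hx with
    ⟨-, hB, hP⟩ | ⟨-, hA, hP⟩ | ⟨hA, hB, hP⟩
  · obtain ⟨u, p, hp, hl, -⟩ := (hP.cons (B' := 2 * m + 5) hB.symm (by omega) (by omega)).cons
      (B' := 2 * m + 7) e.symm (by omega) (by omega)
    have := h.2.2.1.2.2.2 _ _ p hp
    omega
  · obtain ⟨u, p, hp, hl, -⟩ := (hP.cons (B' := 2 * m + 5) hA.symm (by omega) (by omega)).cons
      (B' := 2 * m + 7) e'.symm (by omega) (by omega)
    have := h.2.2.1.2.2.2 _ _ p hp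
    omega
  · obtain ⟨p, hp, hl, -⟩ := (hP.extend (B' := 2 * m + 5) hA hB
      (by rw [Ne, Fin.ext_iff]; omega) (by omega) (by omega) (by omega) (by omega)).extend
      (B' := 2 * m + 7) e' e (by rw [Ne, Fin.ext_iff]; omega) (by omega) (by omega) (by omega)
      (by omega)
    have := h.2.2.1.2.2.2 _ _ p hp
    omega

end Rejects

section Extends

variable {m L : ℕ}

/-- Labels of the layout in which the two rails form one path and both leaf edges are left out. -/
def railLab (m v : ℕ) : ℕ :=
  if v ≤ 2 then 1 else if v = 2 * m + 6 then 2 else if v = 2 * m + 7 then 3 else 0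

/-- Positions of the layout in which the two rails form one path. -/
def railPos (m v : ℕ) : ℕ :=
  if v = 0 then 0 else if v = 1 then 2 else if v = 2 then 1 else
  if 2 * m + 6 ≤ v then 0 else if v % 2 = 0 then m + 2 - v / 2 else m + 1 + (v - 3) / 2

/-- Labels of the layout in which one path zigzags through all rungs from the rail end
`2 * m + 5 - s`, and the leaf edge at `2 * m + 4 + s` is a path of its own. -/
def zigzagLab (m L s v : ℕ) : ℕ :=
  if v = 0 then (if L = 2 then 0 else 3) else if v = 1 then 4 else
  if v = 2 * m + 4 + s ∨ v = 2 * m + 6 + s then 1 else if v + s = 2 * m + 7 then 2 else 0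

/-- Positions of the zigzag layout. -/
def zigzagPos (m L s v : ℕ) : ℕ :=
  if v = 0 then 2 - L else if v = 1 then 1 else if v = 2 then 1 else if v = 3 then 2 else
  if v = 2 * m + 4 + s then 1 else if v = 2 * m + 6 + s then 2 else
  if v + s = 2 * m + 7 then 1 else
  if (v + (v - 2) / 2 + m + s) % 2 = 0 then 2 * ((v - 2) / 2) + 1 else 2 * ((v - 2) / 2) + 2

theorem rail_spec {v : ℕ} (hv : v < 2 * m + 8) :
    (v = 0 ∧ railLab m v = 1 ∧ railPos m v = 0) ∨ (v = 1 ∧ railLab m v = 1 ∧ railPos m v = 2) ∨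
    (v = 2 ∧ railLab m v = 1 ∧ railPos m v = 1) ∨
    (v = 2 * m + 6 ∧ railLab m v = 2 ∧ railPos m v = 0) ∨
    (v = 2 * m + 7 ∧ railLab m v = 3 ∧ railPos m v = 0) ∨
    (3 ≤ v ∧ v ≤ 2 * m + 5 ∧ railLab m v = 0 ∧
      (v % 2 = 0 ∧ 2 * railPos m v + v = 2 * m + 4 ∨
        v % 2 = 1 ∧ 2 * railPos m v = 2 * m + v - 1)) := by
  unfold railLab railPos
  split_ifs <;> omega

theorem zigzag_spec {s v : ℕ} (hs : s ≤ 1) (hv : v < 2 * m + 8) :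
    (v = 0 ∧ (L = 2 ∧ zigzagLab m L s v = 0 ∨ L ≠ 2 ∧ zigzagLab m L s v = 3) ∧
      zigzagPos m L s v = 2 - L) ∨
    (v = 1 ∧ zigzagLab m L s v = 4 ∧ zigzagPos m L s v = 1) ∨
    (v = 2 ∧ zigzagLab m L s v = 0 ∧ zigzagPos m L s v = 1) ∨
    (v = 3 ∧ zigzagLab m L s v = 0 ∧ zigzagPos m L s v = 2) ∨
    (v = 2 * m + 4 + s ∧ zigzagLab m L s v = 1 ∧ zigzagPos m L s v = 1) ∨
    (v = 2 * m + 6 + s ∧ zigzagLab m L s v = 1 ∧ zigzagPos m L s v = 2) ∨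
    (v + s = 2 * m + 7 ∧ zigzagLab m L s v = 2 ∧ zigzagPos m L s v = 1) ∨
    (4 ≤ v ∧ (v ≤ 2 * m + 3 ∨ v + s = 2 * m + 5) ∧ zigzagLab m L s v = 0 ∧
      ((v + v / 2 + m + s) % 2 = 1 ∧ zigzagPos m L s v = 2 * (v / 2) - 1 ∨
        (v + v / 2 + m + s) % 2 = 0 ∧ zigzagPos m L s v = 2 * (v / 2))) := by
  have h : (v - 2) / 2 = v / 2 - 1 := by omega
  unfold zigzagLab zigzagPos
  rw [h]
  by_cases h0 : v = 0
  · left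
    split_ifs <;> omega
  right
  by_cases h1 : v = 1
  · left
    split_ifs
    omega
  right
  by_cases h2 : v = 2
  · left
    split_ifs <;> omega
  right
  by_cases h3 : v = 3
  · left
    split_ifs <;> omega
  right
  by_cases h4 : v = 2 * m + 4 + s
  · left
    split_ifs <;> omega
  right
  by_cases h5 : v = 2 * m + 6 + s
  · left
    split_ifs <;> omega
  right
  by_cases h6 : v + s = 2 * m + 7
  · left
    split_ifs <;> omega
  right
  refine ⟨by omega, by omega, ?_, ?_⟩ <;> split_ifs <;> omega

theorem rail_inj {u v : ℕ} (hu : u < 2 * m + 8) (hv : v < 2 * m + 8)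
    (hl : railLab m u = railLab m v) (hp : railPos m u = railPos m v) : u = v := by
  have h1 := rail_spec hu
  have h2 := rail_spec hv
  rw [hl, hp] at h1
  generalize railLab m v = l at *
  generalize railPos m v = p at *
  clear hl hp
  rcases h1 with h1 | h1 | h1 | h1 | h1 | h1 <;> omega

theorem zigzag_inj {s u v : ℕ} (hs : s ≤ 1) (hu : u < 2 * m + 8) (hv : v < 2 * m + 8)
    (hl : zigzagLab m L s u = zigzagLab m L s v) (hp : zigzagPos m L s u = zigzagPos m L s v) :
    u = v := by
  have h1 := zigzag_spec (L := L) hs hu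
  have h2 := zigzag_spec (L := L) hs hv
  rw [hl, hp] at h1
  generalize zigzagLab m L s v = l at *
  generalize zigzagPos m L s v = p at *
  clear hl hp
  rcases h1 with h1 | h1 | h1 | h1 | h1 | h1 | h1 | h1 <;>
  rcases h2 with h2 | h2 | h2 | h2 | h2 | h2 | h2 | h2 <;> omega

/-- Positions `p u`, `p v` with labels `l u`, `l v` are not consecutive. -/
def Skips (l p : ℕ → ℕ) (u v : ℕ) : Prop :=
  l u = l v → p u ≠ p v + 1 ∧ p v ≠ p u + 1

theorem Skips.symm {l p : ℕ → ℕ} {u v : ℕ} (h : Skips l p u v) : Skips l p v u :=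
  fun hl => (h hl.symm).symm

theorem rail_skips {u v : ℕ} (hu : u < 2 * m + 8) (hv : v < 2 * m + 8)
    (hr : ladderRel m L u v) (h : Skips (railLab m) (railPos m) u v) :
    (u = 2 ∧ v = 3) ∨ (4 ≤ u ∧ u ≤ 2 * m + 2 ∧ u % 2 = 0 ∧ v = u + 1) ∨
      (2 * m + 4 ≤ u ∧ v = u + 2) := by
  have h1 := rail_spec hu
  have h2 := rail_spec hv
  unfold Skips at h
  generalize railLab m v = l at *
  generalize railPos m v = p at *
  generalize railLab m u = l' at *
  generalize railPos m u = p' at *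
  rcases hr with hr | hr | hr | hr | hr <;>
  rcases h1 with h1 | h1 | h1 | h1 | h1 | h1 <;> omega

theorem zigzag_skips {s u v : ℕ} (hs : s ≤ 1) (hu : u < 2 * m + 8) (hv : v < 2 * m + 8)
    (hr : ladderRel m L u v) (h : Skips (zigzagLab m L s) (zigzagPos m L s) u v) :
    (u = 1 ∧ v = 2) ∨ (u = 3 ∧ (v = 4 ∨ v = 5) ∧ (v + m + s) % 2 = 0) ∨
      (4 ≤ u ∧ u ≤ 2 * m + 3 ∧ (u + u / 2 + m + s) % 2 = 1 ∧ v = u + 2) ∨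
      (u + s = 2 * m + 5 ∧ v = u + 2) := by
  have h1 := zigzag_spec (L := L) hs hu
  have h2 := zigzag_spec (L := L) hs hv
  unfold Skips at h
  generalize zigzagLab m L s v = l at *
  generalize zigzagPos m L s v = p at *
  generalize zigzagLab m L s u = l' at *
  generalize zigzagPos m L s u = p' at *
  rcases hr with hr | hr | hr | hr | hr
  · exact Or.inl (by omega)
  · omega
  · refine Or.inr (Or.inl ⟨hr.1, Or.inl hr.2, ?_⟩)
    omega
  · by_cases h3 : u = 3
    · refine Or.inr (Or.inl ⟨h3, Or.inr (by omega), ?_⟩)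
      omega
    by_cases h4 : u ≤ 2 * m + 3
    · refine Or.inr (Or.inr (Or.inl ⟨by omega, h4, ?_, hr.2⟩))
      by_contra hne
      have h5 : v / 2 = u / 2 + 1 := by omega
      have h6 : (u + u / 2 + m + s) % 2 = 0 := by omega
      have h7 : (v + v / 2 + m + s) % 2 = 1 := by omega
      have h8 : v ≠ 2 * m + 4 + s := by
        rintro rfl
        have : u / 2 = m + 1 := by omega
        omega
      rcases h1 with h1 | h1 | h1 | h1 | h1 | h1 | h1 | h1 <;> omega
    · refine Or.inr (Or.inr (Or.inr ⟨?_, hr.2⟩))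
      omega
  · exfalso
    rcases h1 with h1 | h1 | h1 | h1 | h1 | h1 | h1 | h1 <;> omega

theorem rail_unique {u v w : ℕ} (hu : u < 2 * m + 8) (hv : v < 2 * m + 8) (hw : w < 2 * m + 8)
    (h1 : ladderRel m L u v ∨ ladderRel m L v u) (h2 : ladderRel m L u w ∨ ladderRel m L w u)
    (h3 : Skips (railLab m) (railPos m) u v) (h4 : Skips (railLab m) (railPos m) u w) :
    v = w := by
  replace h1 := h1.imp (fun h => rail_skips hu hv h h3) (fun h => rail_skips hv hu h h3.symm)
  replace h2 := h2.imp (fun h => rail_skips hu hw h h4) (fun h => rail_skips hw hu h h4.symm)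
  omega

theorem zigzag_unique {s u v w : ℕ} (hs : s ≤ 1) (hu : u < 2 * m + 8) (hv : v < 2 * m + 8)
    (hw : w < 2 * m + 8)
    (h1 : ladderRel m L u v ∨ ladderRel m L v u) (h2 : ladderRel m L u w ∨ ladderRel m L w u)
    (h3 : Skips (zigzagLab m L s) (zigzagPos m L s) u v)
    (h4 : Skips (zigzagLab m L s) (zigzagPos m L s) u w) : v = w := by
  replace h1 := h1.imp (fun h => zigzag_skips hs hu hv h h3)
    (fun h => zigzag_skips hs hv hu h h3.symm)
  replace h2 := h2.imp (fun h => zigzag_skips hs hu hw h h4)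
    (fun h => zigzag_skips hs hw hu h h4.symm)
  rcases h1 with (h1 | h1 | h1 | h1) | (h1 | h1 | h1 | h1) <;> omega

/-- The subgraph of the gadget determined by a layout given on natural numbers. -/
def ladderLayout (m L : ℕ) (l p : ℕ → ℕ) : SimpleGraph (Fin (2 * m + 8)) :=
  layoutGraph (ladder m L) (fun v => l v) (fun v => p v)

theorem skips_of_not_adj {l p : ℕ → ℕ} {u v : Fin (2 * m + 8)} (h : (ladder m L).Adj u v)
    (h' : ¬ (ladderLayout m L l p).Adj u v) : Skips l p u v := by
  intro hl
  by_contra hcon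
  exact h' ⟨h, hl, by tauto⟩

theorem rail_decomp (hL : L = 1 ∨ L = 2) {k : ℕ} (hk : k = 2 * m + 1 + L) :
    IsMLFDecomp (ladder m L) k (ladderLayout m L (railLab m) (railPos m)).edgeSet
      ((ladder m L).edgeSet \ (ladderLayout m L (railLab m) (railPos m)).edgeSet) := by
  refine isMLFDecomp_layoutGraph (lo := 0) _
    (fun u v hl hp => Fin.ext (rail_inj u.2 v.2 hl hp)) ?_ ?_
  · intro v
    have := rail_spec v.2
    omega
  · intro u v w h1 h2 h3 h4
    exact Fin.ext (rail_unique u.2 v.2 w.2 h1 h2 (skips_of_not_adj h1 h3)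
      (skips_of_not_adj h2 h4))

theorem zigzag_isLayout {s : ℕ} (hs : s ≤ 1) :
    IsLayout (ladderLayout m L (zigzagLab m L s) (zigzagPos m L s))
      (fun v => zigzagLab m L s v) (fun v => zigzagPos m L s v) :=
  isLayout_layoutGraph _ (fun u v hl hp => Fin.ext (zigzag_inj hs u.2 v.2 hl hp))

theorem zigzag_decomp (hL : L = 1 ∨ L = 2) {k s : ℕ} (hk : k = 2 * m + 1 + L) (hs : s ≤ 1) :
    IsMLFDecomp (ladder m L) k (ladderLayout m L (zigzagLab m L s) (zigzagPos m L s)).edgeSet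
      ((ladder m L).edgeSet \
        (ladderLayout m L (zigzagLab m L s) (zigzagPos m L s)).edgeSet) := by
  refine isMLFDecomp_layoutGraph (lo := 2 - L) _ (zigzag_isLayout hs).inj ?_ ?_
  · intro v
    have := zigzag_spec (L := L) hs v.2
    omega
  · intro u v w h1 h2 h3 h4
    exact Fin.ext (zigzag_unique hs u.2 v.2 w.2 h1 h2 (skips_of_not_adj h1 h3)
      (skips_of_not_adj h2 h4))

theorem zigzag_length_le_one {s : ℕ} (hs : s ≤ 1) {u w x : Fin (2 * m + 8)}
    (p : (ladderLayout m L (zigzagLab m L s) (zigzagPos m L s)).Walk u w) (hp : p.IsPath)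
    (hx : x ∈ p.support) (hxs : x.val = 2 * m + 4 + s) : p.length ≤ 1 := by
  refine (zigzag_isLayout hs).length_le (lo := 1) p hp hx ?_
  intro v hv
  have h1 := zigzag_spec (L := L) hs x.2
  have h2 := zigzag_spec (L := L) hs v.2
  omega

end Extends

theorem ladder_leaf_unique {m L : ℕ} {x n : Fin (2 * m + 8)} (hn : 2 * m + 6 ≤ n.val)
    (hx : x.val + 2 = n.val) :
    s(x, n) ∈ (ladder m L).edgeSet ∧ n ∈ s(x, n) ∧
      ∀ g ∈ (ladder m L).edgeSet, n ∈ g → g = s(x, n) := by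
  have hadj : (ladder m L).Adj x n := Or.inl (by unfold ladderRel; omega)
  refine ⟨hadj, by simp, ?_⟩
  rintro g hg ⟨y, rfl⟩
  have hy : y = x := by
    rw [mem_edgeSet, ladder_adj] at hg
    unfold ladderRel at hg
    ext
    omega
  rw [hy, Sym2.eq_swap]

theorem extends_of_decomp {V : Type} {G H : SimpleGraph V} {k : ℕ} {e' e : Sym2 V}
    {Ft Mt : Set (Sym2 V)} (hU : Ft ∪ Mt = {e', e}) (hD : Disjoint Ft Mt)
    (h : IsMLFDecomp G k H.edgeSet (G.edgeSet \ H.edgeSet))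
    (he' : e' ∈ G.edgeSet) (he : e ∈ G.edgeSet) (hF' : e' ∈ H.edgeSet ↔ e' ∈ Ft)
    (hF : e ∈ H.edgeSet ↔ e ∈ Ft)
    (hp : ∀ (u w : V) (p : H.Walk u w), p.IsPath → e' ∈ p.edges ∨ e ∈ p.edges → p.length ≤ 1) :
    ∃ F M : Set (Sym2 V), IsMLFDecomp G k F M ∧ Ft ⊆ F ∧ Mt ⊆ M ∧
      ¬ ∃ (u w : V) (p : (SimpleGraph.fromEdgeSet F).Walk u w),
        p.IsPath ∧ 1 < p.length ∧ (e' ∈ p.edges ∨ e ∈ p.edges) := by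
  refine ⟨_, _, h, ?_, ?_, ?_⟩
  · intro g hg
    have : g ∈ Ft ∪ Mt := Or.inl hg
    rw [hU] at this
    rcases this with rfl | rfl
    · exact hF'.2 hg
    · exact hF.2 hg
  · intro g hg
    have : g ∈ Ft ∪ Mt := Or.inr hg
    have hnot : g ∉ Ft := fun h' => Set.disjoint_left.1 hD h' hg
    rw [hU] at this
    rcases this with rfl | rfl
    · exact ⟨he', fun h' => hnot (hF'.1 h')⟩
    · exact ⟨he, fun h' => hnot (hF.1 h')⟩
  · rw [fromEdgeSet_edgeSet]
    rintro ⟨u, w, p, h1, h2, h3⟩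
    exact absurd (hp u w p h1 h3) (by omega)

theorem rail_leaf_not_mem {m L : ℕ} {x n : Fin (2 * m + 8)} (hn : 2 * m + 6 ≤ n.val)
    (hx : x.val + 2 = n.val) :
    s(x, n) ∉ (ladderLayout m L (railLab m) (railPos m)).edgeSet := by
  intro hadj
  have h : railLab m x = railLab m n := hadj.2.1
  have h1 := rail_spec x.2
  have h2 := rail_spec n.2
  omega

theorem zigzag_leaf_not_mem {m L s : ℕ} (hs : s ≤ 1) {x n : Fin (2 * m + 8)}
    (hx : x.val + s = 2 * m + 5) (hn : n.val + s = 2 * m + 7) :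
    s(x, n) ∉ (ladderLayout m L (zigzagLab m L s) (zigzagPos m L s)).edgeSet := by
  intro hadj
  have h : zigzagLab m L s x = zigzagLab m L s n := hadj.2.1
  have h1 := zigzag_spec (L := L) hs x.2
  have h2 := zigzag_spec (L := L) hs n.2
  omega

theorem zigzag_leaf_mem {m L s : ℕ} (hs : s ≤ 1) {x n : Fin (2 * m + 8)}
    (hx : x.val = 2 * m + 4 + s) (hn : n.val = 2 * m + 6 + s) :
    s(x, n) ∈ (ladderLayout m L (zigzagLab m L s) (zigzagPos m L s)).edgeSet := by
  have h1 := zigzag_spec (L := L) hs x.2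
  have h2 := zigzag_spec (L := L) hs n.2
  have hadj : (ladder m L).Adj x n := Or.inl (by unfold ladderRel; omega)
  have hl : zigzagLab m L s x = zigzagLab m L s n := by omega
  have hp : zigzagPos m L s n = zigzagPos m L s x + 1 := by omega
  exact ⟨hadj, hl, Or.inr hp⟩

end RejectorGadget

/-- For every integer `k ≥ 3` there exists a `k`-F-rejector: a finite simple graph
`R` with two distinct degree-1 vertices `n'`, `n`, with unique incident edges `e'`, `e`
respectively, such that (i) no decomposition of `R` into a `k`-bounded linear forest `F` and a
matching has both `e', e ∈ F`, and (ii) every partition of `{e', e}` placing at least one of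
them in the matching side extends to a decomposition `(F, M)` in which, moreover, neither `e'`
nor `e` lies on a path of length greater than `1` all of whose edges lie in `F`. -/
theorem rejector_exists (k : ℕ) (hk : 3 ≤ k) :
    ∃ (V : Type) (_ : Fintype V) (R : SimpleGraph V) (n' n : V) (e' e : Sym2 V),
      n' ≠ n ∧ e' ≠ e ∧
      (e' ∈ R.edgeSet ∧ n' ∈ e' ∧ ∀ g ∈ R.edgeSet, n' ∈ g → g = e') ∧
      (e ∈ R.edgeSet ∧ n ∈ e ∧ ∀ g ∈ R.edgeSet, n ∈ g → g = e) ∧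
      (¬ ∃ F M : Set (Sym2 V), IsMLFDecomp R k F M ∧ e' ∈ F ∧ e ∈ F) ∧
      (∀ Ft Mt : Set (Sym2 V), Ft ∪ Mt = {e', e} → Disjoint Ft Mt →
        (e' ∈ Mt ∨ e ∈ Mt) →
        ∃ F M : Set (Sym2 V), IsMLFDecomp R k F M ∧ Ft ⊆ F ∧ Mt ⊆ M ∧
          ¬ ∃ (u w : V) (p : (SimpleGraph.fromEdgeSet F).Walk u w),
            p.IsPath ∧ 1 < p.length ∧ (e' ∈ p.edges ∨ e ∈ p.edges)) := by
  obtain ⟨m, L, hL, hkm⟩ : ∃ m L : ℕ, (L = 1 ∨ L = 2) ∧ k = 2 * m + 1 + L :=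
    ⟨(k - 2) / 2, k - 1 - 2 * ((k - 2) / 2), by omega, by omega⟩
  obtain ⟨x', hx'⟩ : ∃ v : Fin (2 * m + 8), v.val = 2 * m + 4 := ⟨⟨_, by omega⟩, rfl⟩
  obtain ⟨x, hx⟩ : ∃ v : Fin (2 * m + 8), v.val = 2 * m + 5 := ⟨⟨_, by omega⟩, rfl⟩
  obtain ⟨n', hn'⟩ : ∃ v : Fin (2 * m + 8), v.val = 2 * m + 6 := ⟨⟨_, by omega⟩, rfl⟩
  obtain ⟨n, hn⟩ : ∃ v : Fin (2 * m + 8), v.val = 2 * m + 7 := ⟨⟨_, by omega⟩, rfl⟩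
  have he' := RejectorGadget.ladder_leaf_unique (L := L) (x := x') (n := n') (by omega) (by omega)
  have he := RejectorGadget.ladder_leaf_unique (L := L) (x := x) (n := n) (by omega) (by omega)
  refine ⟨Fin (2 * m + 8), inferInstance, RejectorGadget.ladder m L, n', n, s(x', n'), s(x, n),
    by rw [Ne, Fin.ext_iff]; omega, ?_, he', he, ?_, ?_⟩
  · rw [Ne, Sym2.eq_iff]
    simp only [Fin.ext_iff]
    omega
  · rintro ⟨F, M, h, h1, h2⟩
    exact RejectorGadget.ladder_rejects hL hkm h hx' hx hn' hn h1 h2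
  · intro Ft Mt hU hD hM
    have hsplit : s(x', n') ∉ Ft ∨ s(x, n) ∉ Ft :=
      hM.imp (fun h h' => Set.disjoint_left.1 hD h' h) (fun h h' => Set.disjoint_left.1 hD h' h)
    by_cases h1 : s(x', n') ∈ Ft
    · have h2 := hsplit.resolve_left (not_not.2 h1)
      have hmem := RejectorGadget.zigzag_leaf_mem (L := L) (s := 0) (by omega) hx' hn'
      have hnot := RejectorGadget.zigzag_leaf_not_mem (L := L) (s := 0) (by omega) hx hn
      refine RejectorGadget.extends_of_decomp hU hD
        (RejectorGadget.zigzag_decomp hL hkm (s := 0) (by omega)) he'.1 he.1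
        (iff_of_true hmem h1) (iff_of_false hnot h2) ?_
      rintro u w p hp (h | h)
      · exact RejectorGadget.zigzag_length_le_one (by omega) p hp
          (p.fst_mem_support_of_mem_edges h) (by omega)
      · exact absurd (p.edges_subset_edgeSet h) hnot
    · by_cases h2 : s(x, n) ∈ Ft
      · have hmem := RejectorGadget.zigzag_leaf_mem (L := L) (s := 1) (by omega) hx hn
        have hnot := RejectorGadget.zigzag_leaf_not_mem (L := L) (s := 1) (x := x') (n := n')
          (by omega) (by omega) (by omega)
        refine RejectorGadget.extends_of_decomp hU hD
          (RejectorGadget.zigzag_decomp hL hkm (s := 1) (by omega)) he'.1 he.1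
          (iff_of_false hnot h1) (iff_of_true hmem h2) ?_
        rintro u w p hp (h | h)
        · exact absurd (p.edges_subset_edgeSet h) hnot
        · exact RejectorGadget.zigzag_length_le_one (by omega) p hp
            (p.fst_mem_support_of_mem_edges h) (by omega)
      · have hnot' := RejectorGadget.rail_leaf_not_mem (L := L) (x := x') (n := n')
          (by omega) (by omega)
        have hnot := RejectorGadget.rail_leaf_not_mem (L := L) (x := x) (n := n)
          (by omega) (by omega)
        refine RejectorGadget.extends_of_decomp hU hD (RejectorGadget.rail_decomp hL hkm)
          he'.1 he.1 (iff_of_false hnot' h1) (iff_of_false hnot h2) ?_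
        rintro u w p hp (h | h)
        · exact absurd (p.edges_subset_edgeSet h) hnot'
        · exact absurd (p.edges_subset_edgeSet h) hnot
end
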